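/- Let μ be a centered isotropic measure on S^{n−1}, let c = n^{28n}, and let ε ∈ (0,1). If at least one of the conditions (a) ℓ(Z_∞(μ)) ≥ (1−ε)ℓ(Δ_n), (b) W(Z_∞(μ)°) ≥ (1−ε)W(Δ_n°), (c) ℓ(Z_∞(μ)°) ≤ (1+ε)ℓ(Δ_n°), (d) W(Z_∞(μ)) ≤ (1+ε)W(Δ_n) holds, then there exist n+1 unit vectors w_1,…,w_{n+1} ∈ S^{n−1} forming the vertices of a regular simplex (pairwise inner products −1/n) such that δ_H(supp μ, {w_1,…,w_{n+1}}) ≤ c·ε^{1/4}. -/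

import Mathlib

open MeasureTheory Metric Set
open scoped RealInnerProductSpace ENNReal

noncomputable section

/-- The standard Gaussian measure `γ_n` on `ℝ^n`. -/
def gaussianM (n : ℕ) : Measure (EuclideanSpace ℝ (Fin n)) :=
  volume.withDensity fun x =>
    ENNReal.ofReal ((2 * Real.pi) ^ (-(n : ℝ) / 2) * Real.exp (-‖x‖ ^ 2 / 2))

/-- The ℓ-norm of a convex body: `ℓ(K) = ∫ ‖x‖_K dγ_n(x)`, where `‖·‖_K` is the gauge of `K`. -/
def ellNorm (n : ℕ) (K : Set (EuclideanSpace ℝ (Fin n))) : ℝ :=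
  ∫ x, gauge K x ∂(gaussianM n)

/-- The support function `h_K`. -/
def suppFn {n : ℕ} (K : Set (EuclideanSpace ℝ (Fin n))) (u : EuclideanSpace ℝ (Fin n)) : ℝ :=
  sSup ((fun y => ⟪u, y⟫) '' K)

/-- The mean width `W(K) = (1/(n κ_n)) ∫_{S^{n-1}} (h_K(u) + h_K(-u)) du`, the integration over
the unit sphere being with respect to the (n-1)-dimensional Hausdorff measure. -/
def meanWidth (n : ℕ) (K : Set (EuclideanSpace ℝ (Fin n))) : ℝ :=
  (1 / (n * (volume (closedBall (0 : EuclideanSpace ℝ (Fin n)) 1)).toReal)) *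
    ∫ u in sphere (0 : EuclideanSpace ℝ (Fin n)) 1,
      (suppFn K u + suppFn K (-u)) ∂(μH[(n : ℝ) - 1])

/-- The polar set `K° = {x : ⟨x,y⟩ ≤ 1 for all y ∈ K}`. -/
def polarSet {n : ℕ} (K : Set (EuclideanSpace ℝ (Fin n))) : Set (EuclideanSpace ℝ (Fin n)) :=
  {x | ∀ y ∈ K, ⟪x, y⟫ ≤ 1}

/-- `w` lists the vertices of a regular simplex inscribed in the unit ball: `n+1` unit vectors
with pairwise inner products `-1/n`. -/
def IsRegVerts {n : ℕ} (w : Fin (n + 1) → EuclideanSpace ℝ (Fin n)) : Prop :=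
  (∀ i, ‖w i‖ = 1) ∧ ∀ i j, i ≠ j → ⟪w i, w j⟫ = -1 / n

/-- An ellipsoid: an image of the closed Euclidean unit ball under an invertible affine map. -/
def IsEllipsoid {n : ℕ} (D : Set (EuclideanSpace ℝ (Fin n))) : Prop :=
  ∃ f : EuclideanSpace ℝ (Fin n) ≃ᵃ[ℝ] EuclideanSpace ℝ (Fin n),
    D = f '' closedBall 0 1

/-- `D` is the Löwner ellipsoid (minimal volume ellipsoid containing) of `K`. -/
def IsLoewnerEllipsoid {n : ℕ} (D K : Set (EuclideanSpace ℝ (Fin n))) : Prop :=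
  IsEllipsoid D ∧ K ⊆ D ∧ ∀ D', IsEllipsoid D' → K ⊆ D' → volume D ≤ volume D'

/-- `D` is the John ellipsoid (maximal volume ellipsoid contained in) of `K`. -/
def IsJohnEllipsoid {n : ℕ} (D K : Set (EuclideanSpace ℝ (Fin n))) : Prop :=
  IsEllipsoid D ∧ D ⊆ K ∧ ∀ D', IsEllipsoid D' → D' ⊆ K → volume D' ≤ volume D

/-- The (topological) support of a measure: points all of whose open neighbourhoods have
positive measure. -/
def msupp {n : ℕ} (μ : Measure (EuclideanSpace ℝ (Fin n))) : Set (EuclideanSpace ℝ (Fin n)) :=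
  {x | ∀ U : Set (EuclideanSpace ℝ (Fin n)), IsOpen U → x ∈ U → μ U ≠ 0}

/-- `μ` is a centered isotropic (Borel) measure on the unit sphere `S^{n-1}`. -/
def IsCenteredIsotropic {n : ℕ} (μ : Measure (EuclideanSpace ℝ (Fin n))) : Prop :=
  msupp μ ⊆ sphere (0 : EuclideanSpace ℝ (Fin n)) 1 ∧
  (∀ x : EuclideanSpace ℝ (Fin n), ∫ u, ⟪u, x⟫ ^ 2 ∂μ = ‖x‖ ^ 2) ∧
  (∫ u, u ∂μ) = 0

lemma gauss_dens_cont (n : ℕ) : Continuous fun x : EuclideanSpace ℝ (Fin n) =>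
    ((2 * Real.pi) ^ (-(n : ℝ) / 2) * Real.exp (-‖x‖ ^ 2 / 2)) := by fun_prop

lemma gauss_total (n : ℕ) : ∫ x : EuclideanSpace ℝ (Fin n),
    ((2 * Real.pi) ^ (-(n : ℝ) / 2) * Real.exp (-‖x‖ ^ 2 / 2)) = 1 := by
  rw [integral_const_mul]
  have h := GaussianFourier.integral_rexp_neg_mul_sq_norm (V := EuclideanSpace ℝ (Fin n))
    (b := 1 / 2) (by norm_num)
  have h2 : ∀ x : EuclideanSpace ℝ (Fin n), -‖x‖ ^ 2 / 2 = -(1 / 2) * ‖x‖ ^ 2 := fun x => by ring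
  simp_rw [h2]
  rw [h, finrank_euclideanSpace_fin, show Real.pi / (1 / 2) = 2 * Real.pi by ring,
    ← Real.rpow_add (by positivity)]
  ring_nf
  simp

instance gauss_prob (n : ℕ) : IsProbabilityMeasure (gaussianM n) := by
  constructor
  have hIntg : Integrable (fun x : EuclideanSpace ℝ (Fin n) =>
    ((2 * Real.pi) ^ (-(n : ℝ) / 2) * Real.exp (-‖x‖ ^ 2 / 2))) := by
    by_contra h
    have := gauss_total n
    rw [integral_undef h] at this
    norm_num at this
  rw [gaussianM, withDensity_apply _ MeasurableSet.univ, Measure.restrict_univ,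
    ← ofReal_integral_eq_lintegral_ofReal hIntg (Filter.Eventually.of_forall fun x => by positivity),
    gauss_total, ENNReal.ofReal_one]

lemma gauss_charFun (n : ℕ) (t : EuclideanSpace ℝ (Fin n)) :
    charFun (gaussianM n) t = Complex.exp (- ‖t‖ ^ 2 / 2) := by
  rw [charFun_apply, gaussianM, integral_withDensity_eq_integral_toReal_smul]
  rotate_left
  · exact (gauss_dens_cont n).measurable.ennreal_ofReal
  · exact Filter.Eventually.of_forall fun x => ENNReal.ofReal_lt_top
  have h := GaussianFourier.integral_cexp_neg_mul_sq_norm_add (V := EuclideanSpace ℝ (Fin n))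
    (b := 1 / 2) (by norm_num) Complex.I t
  have h2 : ∀ x : EuclideanSpace ℝ (Fin n),
      (ENNReal.ofReal ((2 * Real.pi) ^ (-(n : ℝ) / 2) * Real.exp (-‖x‖ ^ 2 / 2))).toReal •
        Complex.exp (⟪x, t⟫ * Complex.I) =
      ((((2 * Real.pi) ^ (-(n : ℝ) / 2) : ℝ)) : ℂ) * Complex.exp (-(1 / 2) * ‖x‖ ^ 2 + Complex.I * ⟪t, x⟫) := by
    intro x
    rw [ENNReal.toReal_ofReal (by positivity), Complex.exp_add, real_inner_comm, Complex.real_smul]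
    push_cast
    rw [mul_comm Complex.I, show -(‖x‖:ℂ) ^ 2 / 2 = -(1 / 2) * ‖x‖ ^ 2 by ring]
    ring
  simp_rw [h2]
  rw [integral_const_mul, h, finrank_euclideanSpace_fin,
    show (Real.pi : ℂ) / (1 / 2) = ((2 * Real.pi : ℝ) : ℂ) by push_cast; ring]
  rw [show ((n : ℂ) / 2) = ((n / 2 : ℝ) : ℂ) by push_cast; ring,
    ← Complex.ofReal_cpow (by positivity), ← mul_assoc, ← Complex.ofReal_mul,
    ← Real.rpow_add (by positivity)]
  rw [show (-(n : ℝ) / 2 + n / 2) = 0 by ring, Real.rpow_zero]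
  simp
  ring_nf

lemma gauss_eq_std (n : ℕ) : gaussianM n = ProbabilityTheory.stdGaussian _ := by
  apply Measure.ext_of_charFun
  ext t
  rw [gauss_charFun, ProbabilityTheory.charFun_stdGaussian]

lemma gauss_map (n m : ℕ) (P : EuclideanSpace ℝ (Fin m) →L[ℝ] EuclideanSpace ℝ (Fin n))
    (L : EuclideanSpace ℝ (Fin n) → EuclideanSpace ℝ (Fin m))
    (hL : ∀ x y, ⟪P x, y⟫ = ⟪x, L y⟫) (hn : ∀ y, ‖L y‖ = ‖y‖) :
    (gaussianM m).map P = gaussianM n := by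
  have : IsProbabilityMeasure ((gaussianM m).map P) :=
    Measure.isProbabilityMeasure_map P.continuous.aemeasurable
  apply Measure.ext_of_charFun
  ext t
  rw [gauss_charFun, charFun_apply, integral_map P.continuous.aemeasurable (by fun_prop)]
  simp_rw [hL]
  rw [← charFun_apply, gauss_charFun, hn]

lemma gauss_int_sq (n : ℕ) : Integrable (fun x => ‖x‖ ^ 2) (gaussianM n) := by
  rw [gauss_eq_std]
  exact (ProbabilityTheory.IsGaussian.memLp_two_id
    (μ := ProbabilityTheory.stdGaussian (EuclideanSpace ℝ (Fin n)))).integrable_norm_pow (by norm_num)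

lemma gauss_int_norm (n : ℕ) : Integrable (fun x => ‖x‖) (gaussianM n) := by
  rw [gauss_eq_std]
  exact (ProbabilityTheory.IsGaussian.integrable_id
    (μ := ProbabilityTheory.stdGaussian (EuclideanSpace ℝ (Fin n)))).norm

lemma gauss_pi (n : ℕ) : gaussianM n =
    (Measure.pi (fun _ : Fin n ↦ ProbabilityTheory.gaussianReal 0 1)).map (WithLp.toLp 2) := by
  rw [gauss_eq_std, ProbabilityTheory.map_pi_eq_stdGaussian]

lemma gauss_sq (n : ℕ) : ∫ x, ‖x‖ ^ 2 ∂(gaussianM n) = n := by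
  rw [gauss_pi, integral_map (by fun_prop) (by fun_prop)]
  simp_rw [EuclideanSpace.real_norm_sq_eq]
  have hs : Integrable (fun x : ℝ => x ^ 2) (ProbabilityTheory.gaussianReal 0 1) := by
    simpa using (ProbabilityTheory.IsGaussian.memLp_two_id
      (μ := ProbabilityTheory.gaussianReal 0 1)).integrable_norm_pow (by norm_num)
  rw [integral_finsetSum]
  · have h1 : ∫ x : ℝ, x ^ 2 ∂(ProbabilityTheory.gaussianReal 0 1) = 1 := by
      have h := ProbabilityTheory.variance_id_gaussianReal (μ := 0) (v := 1)
      rw [ProbabilityTheory.variance_eq_sub ProbabilityTheory.IsGaussian.memLp_two_id] at h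
      simpa using h
    have : ∀ i : Fin n, ∫ x : Fin n → ℝ, x i ^ 2 ∂(Measure.pi (fun _ : Fin n ↦ ProbabilityTheory.gaussianReal 0 1)) = 1 := by
      intro i
      have := integral_comp_eval (μ := fun _ : Fin n => ProbabilityTheory.gaussianReal 0 1) (i := i) (f := fun x : ℝ => x ^ 2) (by fun_prop)
      rw [this, h1]
    simp [this]
  · intro i _
    exact integrable_comp_eval (μ := fun _ : Fin n => ProbabilityTheory.gaussianReal 0 1) (i := i) (f := fun x : ℝ => x ^ 2) hs

lemma gauss_norm_le (n : ℕ) (hn : 1 ≤ n) : ∫ x, ‖x‖ ∂(gaussianM n) ≤ n := by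
  have h1 : ∫ x, ‖x‖ ∂(gaussianM n) ≤ ∫ x, (1 / 2 + (1 / 2) * ‖x‖ ^ 2) ∂(gaussianM n) := by
    apply integral_mono (gauss_int_norm n)
    · exact (integrable_const _).add ((gauss_int_sq n).const_mul _)
    · intro x
      simp only
      nlinarith [sq_nonneg (‖x‖ - 1)]
  rw [integral_add (integrable_const _) ((gauss_int_sq n).const_mul _), integral_const_mul,
    gauss_sq] at h1
  simp at h1
  have : (1 : ℝ) ≤ n := by exact_mod_cast hn
  linarith

/-- standard normal cdf -/
def Phi (t : ℝ) : ℝ := (ProbabilityTheory.gaussianReal 0 1).real (Iic t)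

lemma gauss_prod (n : ℕ) (t : ℝ) : (gaussianM n).real {x | ∀ i, x i ≤ t} = Phi t ^ n := by
  rw [gauss_pi, measureReal_def, Measure.map_apply (by fun_prop)]
  · have : (WithLp.toLp 2 ⁻¹' {x : EuclideanSpace ℝ (Fin n) | ∀ i, x i ≤ t}) =
        Set.pi univ fun _ : Fin n => Iic t := by
      ext x; simp [Pi.le_def]
    rw [this, Measure.pi_pi]
    simp [Phi, measureReal_def]
  · have : {x : EuclideanSpace ℝ (Fin n) | ∀ i, x i ≤ t} = ⋂ i, {x | x i ≤ t} := by
      ext; simp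
    rw [this]
    exact MeasurableSet.iInter fun i => measurableSet_le (by fun_prop) (by fun_prop)

lemma gauss_prod_lt (n : ℕ) (t : ℝ) : (gaussianM n).real {x | ∀ i, x i < t} = Phi t ^ n := by
  rw [gauss_pi, measureReal_def, Measure.map_apply (by fun_prop)]
  · have : (WithLp.toLp 2 ⁻¹' {x : EuclideanSpace ℝ (Fin n) | ∀ i, x i < t}) =
        Set.pi univ fun _ : Fin n => Iio t := by
      ext x; simp
    rw [this, Measure.pi_pi]
    have : NullSingletonClass (ProbabilityTheory.gaussianReal 0 1) :=
      ProbabilityTheory.nullSingletonClass_gaussianReal (by norm_num)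
    simp [Phi, measureReal_def, measure_congr (Iio_ae_eq_Iic (μ := ProbabilityTheory.gaussianReal 0 1) (a := t))]
  · have : {x : EuclideanSpace ℝ (Fin n) | ∀ i, x i < t} = ⋂ i, {x | x i < t} := by
      ext; simp
    rw [this]
    exact MeasurableSet.iInter fun i => measurableSet_lt (by fun_prop) (by fun_prop)

lemma vol_ball_ge (n : ℕ) (hn : 1 ≤ n) (y : EuclideanSpace ℝ (Fin n)) (r : ℝ) (hr : 0 < r) :
    ENNReal.ofReal ((r / n) ^ n) ≤ volume (ball y r) := by
  have hn' : (0 : ℝ) < n := by exact_mod_cast hn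
  have h1 : WithLp.toLp 2 '' (Set.pi univ fun i : Fin n => Ioo (y i) (y i + r / n)) ⊆ ball y r := by
    rintro _ ⟨z, hz, rfl⟩
    rw [mem_ball, EuclideanSpace.dist_eq]
    have h2 : ∑ i, dist ((WithLp.toLp 2 z : EuclideanSpace ℝ (Fin n)) i) (y i) ^ 2 < r ^ 2 := by
      have h3 : ∑ i : Fin n, dist ((WithLp.toLp 2 z : EuclideanSpace ℝ (Fin n)) i) (y i) ^ 2 < ∑ i : Fin n, (r / n) ^ 2 := by
        apply Finset.sum_lt_sum_of_nonempty
        · have : Nonempty (Fin n) := ⟨⟨0, by omega⟩⟩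
          exact Finset.univ_nonempty
        · intro i _
          have := hz i (mem_univ i)
          simp only [mem_Ioo] at this
          rw [Real.dist_eq, sq_abs]
          simp only
          have : 0 < z i - y i ∧ z i - y i < r / n := ⟨by linarith, by linarith⟩
          nlinarith
      refine h3.trans_le ?_
      simp only [Finset.sum_const, Finset.card_univ, Fintype.card_fin, nsmul_eq_mul]
      have : (1 : ℝ) ≤ n := by exact_mod_cast hn
      rw [div_pow, pow_two (n : ℝ)]
      rw [mul_div_assoc', div_le_iff₀ (by positivity)]
      have := sq_nonneg r
      nlinarith [mul_nonneg this hn'.le]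
    calc _ < √(r ^ 2) := Real.sqrt_lt_sqrt (by positivity) h2
      _ = r := Real.sqrt_sq hr.le
  refine le_trans ?_ (measure_mono h1)
  have h4 := fun s => MeasurePreserving.measure_preimage_equiv (f := MeasurableEquiv.toLp 2 (Fin n → ℝ))
    (PiLp.volume_preserving_toLp (Fin n)) s
  have : (WithLp.toLp 2 '' (Set.pi univ fun i : Fin n => Ioo (y i) (y i + r / n)) : Set (EuclideanSpace ℝ (Fin n))) =
    (MeasurableEquiv.toLp 2 (Fin n → ℝ)) '' (Set.pi univ fun i : Fin n => Ioo (y i) (y i + r / n)) := rfl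
  rw [this, ← h4, MeasurableEquiv.preimage_image, Real.volume_pi_Ioo]
  simp [ENNReal.ofReal_pow (by positivity : (0:ℝ) ≤ r / n)]

lemma gauss_ball_ge (n : ℕ) (hn : 1 ≤ n) (y : EuclideanSpace ℝ (Fin n)) (r : ℝ) (hr : 0 < r) :
    (2 * Real.pi) ^ (-(n : ℝ) / 2) * Real.exp (-(‖y‖ + r) ^ 2 / 2) * (r / n) ^ n ≤
      (gaussianM n).real (ball y r) := by
  rw [measureReal_def, ← ENNReal.ofReal_le_iff_le_toReal (measure_ne_top _ _)]
  rw [gaussianM, withDensity_apply _ measurableSet_ball]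
  have h : ∫⁻ x in ball y r, ENNReal.ofReal ((2 * Real.pi) ^ (-(n : ℝ) / 2) * Real.exp (-(‖y‖ + r) ^ 2 / 2)) ≤
    ∫⁻ x in ball y r, ENNReal.ofReal ((2 * Real.pi) ^ (-(n : ℝ) / 2) * Real.exp (-‖x‖ ^ 2 / 2)) := by
    apply setLIntegral_mono' measurableSet_ball
    intro x hx
    apply ENNReal.ofReal_le_ofReal
    have : ‖x‖ ≤ ‖y‖ + r := by
      have := norm_sub_norm_le x y
      rw [mem_ball, dist_eq_norm] at hx
      linarith
    gcongr
  refine le_trans ?_ h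
  rw [setLIntegral_const, ENNReal.ofReal_mul (by positivity)]
  gcongr
  exact vol_ball_ge n hn y r hr

lemma concave_log_sq (b : ℝ) (hb : 0 < b) :
    ConcaveOn ℝ (Ioc 0 b) (fun s : ℝ => Real.log s + s ^ 2 / (2 * b ^ 2)) := by
  have hd : ∀ s : ℝ, 0 < s → HasDerivAt (fun s : ℝ => Real.log s + s ^ 2 / (2 * b ^ 2))
      (s⁻¹ + s / b ^ 2) s := by
    intro s hs
    have h1 := (Real.hasDerivAt_log hs.ne').add (((hasDerivAt_id s).pow 2).div_const (2 * b ^ 2))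
    convert! h1 using 1
    simp
    field_simp
  apply AntitoneOn.concaveOn_of_deriv (convex_Ioc 0 b)
  · intro s hs
    exact (hd s hs.1).continuousAt.continuousWithinAt
  · intro s hs
    rw [interior_Ioc] at hs
    exact (hd s hs.1).differentiableAt.differentiableWithinAt
  · rw [interior_Ioc]
    intro x hx y hy hxy
    rw [(hd x hx.1).deriv, (hd y hy.1).deriv]
    have hx0 := hx.1
    have hy0 := hy.1
    have h1 : x⁻¹ - y⁻¹ = (y - x) / (x * y) := by field_simp
    have h2 : (y - x) / b ^ 2 ≤ (y - x) / (x * y) := by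
      apply div_le_div_of_nonneg_left (by linarith) (by positivity)
      nlinarith [hx.2, hy.2]
    have h3 : (y - x) / b ^ 2 = y / b ^ 2 - x / b ^ 2 := by ring
    linarith

section
variable {m : ℕ} {ι : Type*} [Fintype ι]

/-- the operator `∑ c_i t_i u_i ⊗ u_i` -/
def frameOp (c t : ι → ℝ) (u : ι → EuclideanSpace ℝ (Fin m)) :
    EuclideanSpace ℝ (Fin m) →L[ℝ] EuclideanSpace ℝ (Fin m) :=
  ∑ i, (c i * t i) • (innerSL ℝ (u i)).smulRight (u i)

lemma frameOp_apply (c t : ι → ℝ) (u : ι → EuclideanSpace ℝ (Fin m)) (x : EuclideanSpace ℝ (Fin m)) :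
    frameOp c t u x = ∑ i, (c i * t i * ⟪u i, x⟫) • u i := by
  simp [frameOp, smul_smul]

lemma frameOp_inner (c t : ι → ℝ) (u : ι → EuclideanSpace ℝ (Fin m)) (x y : EuclideanSpace ℝ (Fin m)) :
    ⟪frameOp c t u x, y⟫ = ∑ i, c i * t i * ⟪u i, x⟫ * ⟪u i, y⟫ := by
  simp [frameOp_apply, sum_inner, real_inner_smul_left]

lemma frameOp_det (c t : ι → ℝ) (u : ι → EuclideanSpace ℝ (Fin m)) (b : ℝ) (hb : 0 < b)
    (hc : ∀ i, 0 ≤ c i) (hu : ∀ i, ‖u i‖ = 1)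
    (hiso : ∀ x, ∑ i, c i * ⟪u i, x⟫ ^ 2 = ‖x‖ ^ 2)
    (ht : ∀ i, 0 < t i) (htb : ∀ i, t i ≤ b) :
    Real.exp (∑ i, c i * Real.log (t i)) *
      (1 + 1 / (4 * b ^ 2) * ∑ i, ∑ j, c i * c j * (t i - t j) ^ 2 * ⟪u i, u j⟫ ^ 2) ≤
      (frameOp c t u).det := by
  set A := frameOp c t u with hA
  have hsym : (A : EuclideanSpace ℝ (Fin m) →ₗ[ℝ] EuclideanSpace ℝ (Fin m)).IsSymmetric := by
    intro x y
    show ⟪A x, y⟫ = ⟪x, A y⟫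
    have h0 : ⟪x, A y⟫ = ⟪A y, x⟫ := real_inner_comm _ _
    rw [h0, hA, frameOp_inner, frameOp_inner]
    refine Finset.sum_congr rfl fun i _ => by ring
  have hn : Module.finrank ℝ (EuclideanSpace ℝ (Fin m)) = m := finrank_euclideanSpace_fin
  set e := hsym.eigenvectorBasis hn with he
  set l := hsym.eigenvalues hn with hl
  have hAe : ∀ k, A (e k) = l k • e k := fun k => by
    have := hsym.apply_eigenvectorBasis hn k
    exact this
  have hp1 : ∀ k, ∑ i, c i * ⟪u i, e k⟫ ^ 2 = 1 := fun k => by rw [hiso, e.norm_eq_one]; norm_num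
  have hp2 : ∀ i, ∑ k, c i * ⟪u i, e k⟫ ^ 2 = c i := fun i => by
    rw [← Finset.mul_sum, e.sum_sq_inner_left, hu]; norm_num
  have hlk : ∀ k, l k = ∑ i, (c i * ⟪u i, e k⟫ ^ 2) * t i := fun k => by
    have h1 : ⟪A (e k), e k⟫ = l k := by
      rw [hAe, real_inner_smul_left, real_inner_self_eq_norm_sq, e.norm_eq_one]; norm_num
    rw [← h1, hA, frameOp_inner]
    exact Finset.sum_congr rfl fun i _ => by ring
  have hconc := concave_log_sq b hb
  have hmem : ∀ k, l k ∈ Ioc 0 b := fun k => by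
    have := (convex_Ioc (0:ℝ) b).sum_mem (t := Finset.univ) (w := fun i => c i * ⟪u i, e k⟫ ^ 2) (z := t)
      (fun i _ => mul_nonneg (hc i) (sq_nonneg _)) (hp1 k) (fun i _ => ⟨ht i, htb i⟩)
    rw [hlk]
    simpa using this
  have hJ : ∀ k, ∑ i, (c i * ⟪u i, e k⟫ ^ 2) * (Real.log (t i) + t i ^ 2 / (2 * b ^ 2)) ≤
      Real.log (l k) + l k ^ 2 / (2 * b ^ 2) := fun k => by
    have := hconc.le_map_sum (t := Finset.univ) (w := fun i => c i * ⟪u i, e k⟫ ^ 2) (p := t)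
      (fun i _ => mul_nonneg (hc i) (sq_nonneg _)) (hp1 k) (fun i _ => ⟨ht i, htb i⟩)
    simp only [smul_eq_mul, ← hlk k] at this
    exact this
  have hJ2 : ∑ i, c i * (Real.log (t i) + t i ^ 2 / (2 * b ^ 2)) ≤
      ∑ k, (Real.log (l k) + l k ^ 2 / (2 * b ^ 2)) := by
    refine le_trans (le_of_eq ?_) (Finset.sum_le_sum fun k _ => hJ k)
    rw [Finset.sum_comm]
    refine Finset.sum_congr rfl fun i _ => ?_
    rw [← Finset.sum_mul, hp2]
  have hl2 : ∑ k, l k ^ 2 = ∑ i, ∑ j, c i * c j * (t i * t j) * ⟪u i, u j⟫ ^ 2 := by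
    have h1 : ∀ k, l k ^ 2 = ∑ i, c i * t i * (⟪u i, e k⟫ * ⟪e k, A (u i)⟫) := fun k => by
      rw [pow_two]; nth_rw 2 [hlk]
      rw [Finset.mul_sum]
      refine Finset.sum_congr rfl fun i _ => ?_
      have : ⟪e k, A (u i)⟫ = l k * ⟪u i, e k⟫ := by
        have h2 := hsym (e k) (u i)
        simp only [ContinuousLinearMap.coe_coe] at h2
        rw [← h2, hAe, real_inner_smul_left, real_inner_comm]
      rw [this]; ring
    simp_rw [h1]
    rw [Finset.sum_comm]
    refine Finset.sum_congr rfl fun i _ => ?_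
    rw [← Finset.mul_sum, e.sum_inner_mul_inner, real_inner_comm, hA, frameOp_inner, Finset.mul_sum]
    refine Finset.sum_congr rfl fun j _ => ?_
    rw [real_inner_comm (u i) (u j)]
    ring
  have ht2 : ∑ i, ∑ j, c i * c j * (t i) ^ 2 * ⟪u i, u j⟫ ^ 2 = ∑ i, c i * t i ^ 2 := by
    refine Finset.sum_congr rfl fun i _ => ?_
    have : ∑ j, c j * ⟪u j, u i⟫ ^ 2 = 1 := by rw [hiso, hu]; norm_num
    calc _ = c i * t i ^ 2 * ∑ j, c j * ⟪u j, u i⟫ ^ 2 := by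
          rw [Finset.mul_sum]
          refine Finset.sum_congr rfl fun j _ => ?_
          rw [real_inner_comm (u i) (u j)]; ring
      _ = _ := by rw [this]; ring
  have ht3 : ∑ i, ∑ j, c i * c j * (t j) ^ 2 * ⟪u i, u j⟫ ^ 2 = ∑ i, c i * t i ^ 2 := by
    rw [← ht2, Finset.sum_comm]
    refine Finset.sum_congr rfl fun i _ => Finset.sum_congr rfl fun j _ => ?_
    rw [real_inner_comm (u i) (u j)]; ring
  have hQ : ∑ i, ∑ j, c i * c j * (t i - t j) ^ 2 * ⟪u i, u j⟫ ^ 2 =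
      2 * (∑ i, c i * t i ^ 2 - ∑ k, l k ^ 2) := by
    have : ∑ i, ∑ j, c i * c j * (t i - t j) ^ 2 * ⟪u i, u j⟫ ^ 2 =
      ∑ i, ∑ j, c i * c j * (t i) ^ 2 * ⟪u i, u j⟫ ^ 2 + ∑ i, ∑ j, c i * c j * (t j) ^ 2 * ⟪u i, u j⟫ ^ 2
       - 2 * ∑ i, ∑ j, c i * c j * (t i * t j) * ⟪u i, u j⟫ ^ 2 := by
      simp only [Finset.mul_sum, ← Finset.sum_add_distrib, ← Finset.sum_sub_distrib]
      refine Finset.sum_congr rfl fun i _ => Finset.sum_congr rfl fun j _ => by ring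
    rw [this, ht2, ht3, hl2]; ring
  have hdet : A.det = ∏ k, l k := by
    have := hsym.det_eq_prod_eigenvalues hn
    simpa using this
  have hdetpos : 0 < ∏ k, l k := Finset.prod_pos fun k _ => (hmem k).1
  have hlog : Real.log (∏ k, l k) = ∑ k, Real.log (l k) :=
    Real.log_prod fun k _ => (hmem k).1.ne'
  have hfin : ∑ i, c i * Real.log (t i) + 1 / (4 * b ^ 2) * ∑ i, ∑ j, c i * c j * (t i - t j) ^ 2 * ⟪u i, u j⟫ ^ 2
      ≤ Real.log (∏ k, l k) := by
    rw [hlog, hQ]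
    simp only [mul_add, Finset.sum_add_distrib, ← Finset.sum_div, mul_div_assoc'] at hJ2
    have h5 : 1 / (4 * b ^ 2) * (2 * (∑ i, c i * t i ^ 2 - ∑ k, l k ^ 2)) =
      (∑ i, c i * t i ^ 2) / (2 * b ^ 2) - (∑ k, l k ^ 2) / (2 * b ^ 2) := by
      field_simp; ring
    rw [h5]
    linarith
  rw [hdet, ← Real.exp_log hdetpos]
  refine le_trans ?_ (Real.exp_le_exp.2 hfin)
  rw [Real.exp_add]
  gcongr
  have := Real.add_one_le_exp (1 / (4 * b ^ 2) * ∑ i, ∑ j, c i * c j * (t i - t j) ^ 2 * ⟪u i, u j⟫ ^ 2)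
  linarith
end

section
variable {m : ℕ} {ι : Type*} [Fintype ι]

lemma frame_sum_c (c : ι → ℝ) (u : ι → EuclideanSpace ℝ (Fin m)) (hu : ∀ i, ‖u i‖ = 1)
    (hiso : ∀ x, ∑ i, c i * ⟪u i, x⟫ ^ 2 = ‖x‖ ^ 2) : ∑ i, c i = m := by
  have e := EuclideanSpace.basisFun (Fin m) ℝ
  have h1 : ∑ k, ∑ i, c i * ⟪u i, e k⟫ ^ 2 = m := by
    simp [hiso, e.norm_eq_one]
  rw [Finset.sum_comm] at h1
  rw [← h1]
  refine Finset.sum_congr rfl fun i _ => ?_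
  rw [← Finset.mul_sum, e.sum_sq_inner_left, hu]; norm_num

lemma frame_norm_le (c s : ι → ℝ) (u : ι → EuclideanSpace ℝ (Fin m)) (hc : ∀ i, 0 ≤ c i)
    (hiso : ∀ x, ∑ i, c i * ⟪u i, x⟫ ^ 2 = ‖x‖ ^ 2) :
    ‖∑ i, (c i * s i) • u i‖ ^ 2 ≤ ∑ i, c i * s i ^ 2 := by
  set y := ∑ i, (c i * s i) • u i with hy
  have h1 : ‖y‖ ^ 2 = ∑ i, c i * s i * ⟪u i, y⟫ := by
    rw [← real_inner_self_eq_norm_sq]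
    nth_rw 1 [hy]
    simp [sum_inner, real_inner_smul_left]
  have h2 : 0 ≤ ∑ i, c i * (s i - ⟪u i, y⟫) ^ 2 :=
    Finset.sum_nonneg fun i _ => mul_nonneg (hc i) (sq_nonneg _)
  have h3 : ∑ i, c i * (s i - ⟪u i, y⟫) ^ 2 =
      ∑ i, c i * s i ^ 2 - 2 * ∑ i, c i * s i * ⟪u i, y⟫ + ∑ i, c i * ⟪u i, y⟫ ^ 2 := by
    rw [Finset.mul_sum, ← Finset.sum_sub_distrib, ← Finset.sum_add_distrib]
    exact Finset.sum_congr rfl fun i _ => by ring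
  rw [h3, hiso, ← h1] at h2
  linarith

lemma frameOp_det_ge (c t : ι → ℝ) (u : ι → EuclideanSpace ℝ (Fin m))
    (hc : ∀ i, 0 ≤ c i) (hu : ∀ i, ‖u i‖ = 1)
    (hiso : ∀ x, ∑ i, c i * ⟪u i, x⟫ ^ 2 = ‖x‖ ^ 2)
    (ht : ∀ i, 0 < t i) :
    Real.exp (∑ i, c i * Real.log (t i)) ≤ (frameOp c t u).det := by
  have hs : 0 ≤ ∑ i, t i := Finset.sum_nonneg fun i _ => (ht i).le
  have := frameOp_det c t u (1 + ∑ i, t i) (by linarith) hc hu hiso ht (fun i => by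
    have := Finset.single_le_sum (f := t) (fun j _ => (ht j).le) (Finset.mem_univ i)
    linarith)
  refine le_trans ?_ this
  apply le_mul_of_one_le_right (Real.exp_pos _).le
  have : 0 ≤ ∑ i, ∑ j, c i * c j * (t i - t j) ^ 2 * ⟪u i, u j⟫ ^ 2 :=
    Finset.sum_nonneg fun i _ => Finset.sum_nonneg fun j _ => by
      have := hc i; have := hc j; positivity
  have : 0 ≤ 1 / (4 * (1 + ∑ i, t i) ^ 2) * ∑ i, ∑ j, c i * c j * (t i - t j) ^ 2 * ⟪u i, u j⟫ ^ 2 := by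
    positivity
  linarith

/-- transport map -/
def thMap (c : ι → ℝ) (u : ι → EuclideanSpace ℝ (Fin m)) (T : ℝ → ℝ)
    (x : EuclideanSpace ℝ (Fin m)) : EuclideanSpace ℝ (Fin m) := ∑ i, (c i * T ⟪u i, x⟫) • u i

/-- quadratic deficit form -/
def qForm (c : ι → ℝ) (u : ι → EuclideanSpace ℝ (Fin m)) (x : EuclideanSpace ℝ (Fin m)) : ℝ :=
  ∑ i, ∑ j, c i * c j * ⟪u i - u j, x⟫ ^ 2 * ⟪u i, u j⟫ ^ 2

lemma qForm_nonneg (c : ι → ℝ) (u : ι → EuclideanSpace ℝ (Fin m)) (hc : ∀ i, 0 ≤ c i)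
    (x : EuclideanSpace ℝ (Fin m)) : 0 ≤ qForm c u x :=
  Finset.sum_nonneg fun i _ => Finset.sum_nonneg fun j _ => by
      have := hc i; have := hc j; positivity

lemma qForm_cont (c : ι → ℝ) (u : ι → EuclideanSpace ℝ (Fin m)) : Continuous (qForm c u) := by
  unfold qForm; fun_prop

lemma inner_sq_integrable (w : EuclideanSpace ℝ (Fin m)) :
    Integrable (fun x => ⟪w, x⟫ ^ 2) (gaussianM m) := by
  have h := (gauss_int_sq m).const_mul (‖w‖ ^ 2)
  refine h.mono' (by fun_prop) (Filter.Eventually.of_forall fun x => ?_)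
  rw [Real.norm_eq_abs, abs_of_nonneg (sq_nonneg _), ← mul_pow]
  exact sq_le_sq' (by have := abs_le.1 (abs_real_inner_le_norm w x); linarith) (real_inner_le_norm w x)

lemma qForm_integrable (c : ι → ℝ) (u : ι → EuclideanSpace ℝ (Fin m)) :
    Integrable (qForm c u) (gaussianM m) := by
  unfold qForm
  refine integrable_finsetSum _ fun i _ => integrable_finsetSum _ fun j _ => ?_
  exact ((inner_sq_integrable (u i - u j)).const_mul _).mul_const _

lemma thMap_hasFDerivAt (c : ι → ℝ) (u : ι → EuclideanSpace ℝ (Fin m)) (T T' : ℝ → ℝ)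
    (x : EuclideanSpace ℝ (Fin m)) (h : ∀ i, HasDerivAt T (T' ⟪u i, x⟫) ⟪u i, x⟫) :
    HasFDerivAt (thMap c u T) (frameOp c (fun i => T' ⟪u i, x⟫) u) x := by
  unfold thMap frameOp
  apply HasFDerivAt.fun_sum
  intro i _
  have h1 : HasFDerivAt (fun x => T ⟪u i, x⟫) (T' ⟪u i, x⟫ • innerSL ℝ (u i)) x :=
    (h i).comp_hasFDerivAt x (innerSL ℝ (u i)).hasFDerivAt
  have h2 := (h1.const_mul (c i)).smul_const (u i)
  convert! h2 using 1
  ext y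
  simp [smul_smul, mul_assoc]

lemma thMap_inj (c : ι → ℝ) (u : ι → EuclideanSpace ℝ (Fin m)) (hc : ∀ i, 0 ≤ c i)
    (hiso : ∀ x, ∑ i, c i * ⟪u i, x⟫ ^ 2 = ‖x‖ ^ 2) (T : ℝ → ℝ) (I : Set ℝ)
    (hT : StrictMonoOn T I) :
    InjOn (thMap c u T) {x | ∀ i, ⟪u i, x⟫ ∈ I} := by
  intro x hx y hy hxy
  have h0 : ⟪thMap c u T x - thMap c u T y, x - y⟫ = 0 := by rw [hxy]; simp
  have h1 : ⟪thMap c u T x - thMap c u T y, x - y⟫ =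
      ∑ i, c i * ((T ⟪u i, x⟫ - T ⟪u i, y⟫) * (⟪u i, x⟫ - ⟪u i, y⟫)) := by
    unfold thMap
    rw [← Finset.sum_sub_distrib, sum_inner]
    refine Finset.sum_congr rfl fun i _ => ?_
    rw [← sub_smul, real_inner_smul_left, inner_sub_right]; ring
  rw [h1] at h0
  have key : ∀ a ∈ I, ∀ b ∈ I, a ≠ b → 0 < (T a - T b) * (a - b) := by
    intro a ha b hb hab
    rcases lt_or_gt_of_ne hab with h | h
    · have := hT ha hb h; nlinarith
    · have := hT hb ha h; nlinarith
  have h2 : ∀ i, 0 ≤ c i * ((T ⟪u i, x⟫ - T ⟪u i, y⟫) * (⟪u i, x⟫ - ⟪u i, y⟫)) := fun i => by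
    refine mul_nonneg (hc i) ?_
    by_cases h : ⟪u i, x⟫ = ⟪u i, y⟫
    · simp [h]
    · exact (key _ (hx i) _ (hy i) h).le
  have h3 := (Finset.sum_eq_zero_iff_of_nonneg fun i _ => h2 i).1 h0
  have h4 : ‖x - y‖ ^ 2 = 0 := by
    rw [← hiso]
    refine Finset.sum_eq_zero fun i hi => ?_
    have := h3 i hi
    rw [mul_eq_zero] at this
    rcases this with h | h
    · simp [h]
    · by_cases h' : ⟪u i, x⟫ = ⟪u i, y⟫
      · simp [inner_sub_right, h']
      · exact absurd h (key _ (hx i) _ (hy i) h').ne'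
  have h5 : x - y = 0 := by simpa using h4
  exact sub_eq_zero.1 h5

lemma core_transport (c : ι → ℝ) (u : ι → EuclideanSpace ℝ (Fin m)) (hc : ∀ i, 0 ≤ c i)
    (hu : ∀ i, ‖u i‖ = 1) (hiso : ∀ x, ∑ i, c i * ⟪u i, x⟫ ^ 2 = ‖x‖ ^ 2)
    (T T' : ℝ → ℝ) (I J : Set ℝ) (hI : IsOpen I) (K a b : ℝ) (hK : 0 < K)
    (hT : StrictMonoOn T I) (ha : 0 ≤ a) (hb : 0 < b)
    (hT' : ∀ s ∈ I, HasDerivAt T (T' s) s)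
    (hTK : ∀ s ∈ I, T' s = K * Real.exp ((T s ^ 2 - s ^ 2) / 2))
    (hJI : J ⊆ I) (hJb : ∀ s ∈ J, T' s ≤ b)
    (hJa : ∀ s ∈ J, ∀ r ∈ J, a * |s - r| ≤ |T' s - T' r|)
    (R : Set (EuclideanSpace ℝ (Fin m))) (hR : MeasurableSet R)
    (hRJ : ∀ x ∈ R, ∀ i, ⟪u i, x⟫ ∈ J) :
    K ^ m * ((gaussianM m).real {x | ∀ i, ⟪u i, x⟫ ∈ I} +
        a ^ 2 / (4 * b ^ 2) * ∫ x in R, qForm c u x ∂(gaussianM m)) ≤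
      (gaussianM m).real (thMap c u T '' {x | ∀ i, ⟪u i, x⟫ ∈ I}) := by
  set D : Set (EuclideanSpace ℝ (Fin m)) := {x | ∀ i, ⟪u i, x⟫ ∈ I} with hD
  have hDo : IsOpen D := by
    have : D = ⋂ i, (fun x => ⟪u i, x⟫) ⁻¹' I := by ext x; simp [hD]
    rw [this]
    exact isOpen_iInter_of_finite fun i => hI.preimage (by fun_prop)
  have hRD : R ⊆ D := fun x hx i => hJI (hRJ x hx i)
  set A : EuclideanSpace ℝ (Fin m) → EuclideanSpace ℝ (Fin m) →L[ℝ] EuclideanSpace ℝ (Fin m) :=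
    fun x => frameOp c (fun i => T' ⟪u i, x⟫) u with hA
  set κ := a ^ 2 / (4 * b ^ 2) with hκ
  have hκ0 : 0 ≤ κ := by positivity
  set dn : EuclideanSpace ℝ (Fin m) → ℝ := fun x => (2 * Real.pi) ^ (-(m : ℝ) / 2) * Real.exp (-‖x‖ ^ 2 / 2) with hdn
  have hdn0 : ∀ x, 0 ≤ dn x := fun x => by positivity
  have hdnc : Continuous dn := by fun_prop
  have hpos : ∀ s ∈ I, 0 < T' s := fun s hs => by rw [hTK s hs]; positivity
  have himg : MeasurableSet (thMap c u T '' D) := by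
    apply measurable_image_of_fderivWithin hDo.measurableSet
      (f' := A) (fun x hx => (thMap_hasFDerivAt c u T T' x fun i => hT' _ (hx i)).hasFDerivWithinAt)
      (thMap_inj c u hc hiso T I hT)
  have hexp : ∀ x ∈ D, Real.exp (∑ i, c i * Real.log (T' ⟪u i, x⟫)) =
      K ^ m * (Real.exp ((∑ i, c i * T ⟪u i, x⟫ ^ 2) / 2) * Real.exp (-‖x‖ ^ 2 / 2)) := by
    intro x hx
    have h1 : ∀ i, c i * Real.log (T' ⟪u i, x⟫) = c i * Real.log K +
        (c i * T ⟪u i, x⟫ ^ 2 / 2 - c i * ⟪u i, x⟫ ^ 2 / 2) := fun i => by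
      rw [hTK _ (hx i), Real.log_mul hK.ne' (Real.exp_pos _).ne', Real.log_exp]; ring
    simp_rw [h1]
    rw [Finset.sum_add_distrib, Finset.sum_sub_distrib, ← Finset.sum_mul, ← Finset.sum_div,
      ← Finset.sum_div, frame_sum_c c u hu hiso, hiso, Real.exp_add, Real.exp_nat_mul, Real.exp_log hK]
    rw [← Real.exp_add]
    congr 2; ring
  have hpt : ∀ x ∈ D, K ^ m * (dn x * (1 + R.indicator (fun x => κ * qForm c u x) x)) ≤
      |(A x).det| * dn (thMap c u T x) := by
    intro x hx
    have hn := frame_norm_le c (fun i => T ⟪u i, x⟫) u hc hiso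
    have hd : Real.exp (∑ i, c i * Real.log (T' ⟪u i, x⟫)) *
        (1 + R.indicator (fun x => κ * qForm c u x) x) ≤ (A x).det := by
      by_cases hxR : x ∈ R
      · rw [indicator_of_mem hxR]
        have h := frameOp_det c (fun i => T' ⟪u i, x⟫) u b hb hc hu hiso (fun i => hpos _ (hx i))
          (fun i => hJb _ (hRJ x hxR i))
        refine le_trans ?_ h
        refine mul_le_mul_of_nonneg_left ?_ (Real.exp_pos _).le
        rw [hκ, div_eq_mul_one_div, mul_comm (a ^ 2), mul_assoc]
        refine add_le_add le_rfl (mul_le_mul_of_nonneg_left ?_ (by positivity))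
        unfold qForm
        rw [Finset.mul_sum]
        refine Finset.sum_le_sum fun i _ => ?_
        rw [Finset.mul_sum]
        refine Finset.sum_le_sum fun j _ => ?_
        have h6 := hJa _ (hRJ x hxR i) _ (hRJ x hxR j)
        have h7 : a ^ 2 * ⟪u i - u j, x⟫ ^ 2 ≤ (T' ⟪u i, x⟫ - T' ⟪u j, x⟫) ^ 2 := by
          rw [← sq_abs (T' _ - _), ← sq_abs ⟪u i - u j, x⟫, ← mul_pow, inner_sub_left]
          gcongr
        have h8 : 0 ≤ c i * c j * ⟪u i, u j⟫ ^ 2 := by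
          have := hc i; have := hc j; positivity
        nlinarith [mul_le_mul_of_nonneg_left h7 h8]
      · rw [indicator_of_notMem hxR]
        have h := frameOp_det_ge c (fun i => T' ⟪u i, x⟫) u hc hu hiso (fun i => hpos _ (hx i))
        simpa using h
    have hi0 : 0 ≤ R.indicator (fun x => κ * qForm c u x) x :=
      indicator_nonneg (fun x _ => mul_nonneg hκ0 (qForm_nonneg c u hc x)) x
    rw [hexp x hx] at hd
    have hE : 1 ≤ Real.exp ((∑ i, c i * T ⟪u i, x⟫ ^ 2) / 2) * Real.exp (-‖thMap c u T x‖ ^ 2 / 2) := by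
      rw [← Real.exp_add]
      apply Real.one_le_exp
      have : ‖thMap c u T x‖ ^ 2 ≤ ∑ i, c i * T ⟪u i, x⟫ ^ 2 := hn
      linarith
    have hd2 : (A x).det ≤ |(A x).det| := le_abs_self _
    calc _ ≤ K ^ m * (dn x * (1 + R.indicator (fun x => κ * qForm c u x) x)) *
          (Real.exp ((∑ i, c i * T ⟪u i, x⟫ ^ 2) / 2) * Real.exp (-‖thMap c u T x‖ ^ 2 / 2)) := by
          apply le_mul_of_one_le_right _ hE
          have := hdn0 x
          positivity
      _ = (K ^ m * (Real.exp ((∑ i, c i * T ⟪u i, x⟫ ^ 2) / 2) * Real.exp (-‖x‖ ^ 2 / 2)) *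
          (1 + R.indicator (fun x => κ * qForm c u x) x)) * dn (thMap c u T x) := by
          simp only [hdn]; ring
      _ ≤ _ := by
          have := hdn0 (thMap c u T x)
          gcongr
          exact hd.trans hd2
  have hl : gaussianM m (thMap c u T '' D) =
      ∫⁻ x in D, ENNReal.ofReal |(A x).det| * ENNReal.ofReal (dn (thMap c u T x)) := by
    rw [gaussianM, withDensity_apply _ himg]
    exact lintegral_image_eq_lintegral_abs_det_fderiv_mul volume hDo.measurableSet
      (f' := A) (fun x hx => (thMap_hasFDerivAt c u T T' x fun i => hT' _ (hx i)).hasFDerivWithinAt)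
      (thMap_inj c u hc hiso T I hT) _
  have hq : ENNReal.ofReal (∫ x in R, κ * qForm c u x ∂(gaussianM m)) =
      ∫⁻ x in D, ENNReal.ofReal (R.indicator (fun x => κ * qForm c u x) x) ∂(gaussianM m) := by
    rw [ofReal_integral_eq_lintegral_ofReal ((qForm_integrable c u).const_mul κ).integrableOn
      (Filter.Eventually.of_forall fun x => mul_nonneg hκ0 (qForm_nonneg c u hc x))]
    have : (fun x => ENNReal.ofReal (R.indicator (fun x => κ * qForm c u x) x)) =
        R.indicator (fun x => ENNReal.ofReal (κ * qForm c u x)) := by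
      ext x; by_cases h : x ∈ R <;> simp [h]
    rw [this, lintegral_indicator hR, Measure.restrict_restrict hR, inter_eq_left.2 hRD]
  have hmeasI : Measurable (R.indicator (fun x => κ * qForm c u x)) :=
    ((qForm_cont c u).measurable.const_mul κ).indicator hR
  have hi0 : ∀ x, 0 ≤ R.indicator (fun x => κ * qForm c u x) x := fun x =>
      indicator_nonneg (fun x _ => mul_nonneg hκ0 (qForm_nonneg c u hc x)) x
  have hmain : ENNReal.ofReal (K ^ m) * (gaussianM m D +
      ENNReal.ofReal (∫ x in R, κ * qForm c u x ∂(gaussianM m))) ≤ gaussianM m (thMap c u T '' D) := by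
    rw [hl, hq, ← setLIntegral_one, ← lintegral_add_left measurable_const,
      ← lintegral_const_mul _ (by fun_prop)]
    unfold gaussianM
    rw [restrict_withDensity hDo.measurableSet, lintegral_withDensity_eq_lintegral_mul _ (by fun_prop) (by fun_prop)]
    refine setLIntegral_mono' hDo.measurableSet fun x hx => ?_
    rw [Pi.mul_apply, ← ENNReal.ofReal_mul (abs_nonneg _), ← ENNReal.ofReal_one,
      ← ENNReal.ofReal_add zero_le_one (hi0 x), ← ENNReal.ofReal_mul (by positivity),
      ← ENNReal.ofReal_mul (hdn0 x)]
    apply ENNReal.ofReal_le_ofReal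
    refine le_trans (le_of_eq ?_) (hpt x hx)
    simp only [hdn]; ring
  have hq0 : 0 ≤ ∫ x in R, κ * qForm c u x ∂(gaussianM m) :=
    integral_nonneg fun x => mul_nonneg hκ0 (qForm_nonneg c u hc x)
  have h9 := ENNReal.toReal_mono (measure_ne_top _ _) hmain
  rw [ENNReal.toReal_mul, ENNReal.toReal_add (measure_ne_top _ _) ENNReal.ofReal_ne_top,
    ENNReal.toReal_ofReal (by positivity), ENNReal.toReal_ofReal hq0, integral_const_mul] at h9
  exact h9
end

/-- one-dimensional gaussian density -/
def phi (t : ℝ) : ℝ := (√(2 * Real.pi))⁻¹ * Real.exp (-t ^ 2 / 2)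

lemma phi_pos (t : ℝ) : 0 < phi t := by unfold phi; positivity

lemma phi_eq (t : ℝ) : ProbabilityTheory.gaussianPDFReal 0 1 t = phi t := by
  simp [ProbabilityTheory.gaussianPDFReal, phi]

lemma phi_cont : Continuous phi := by unfold phi; fun_prop

lemma phi_int : Integrable phi := by
  have := ProbabilityTheory.integrable_gaussianPDFReal 0 1
  simpa only [funext phi_eq] using this

lemma Phi_eq_int (t : ℝ) : Phi t = ∫ x in Iic t, phi x := by
  unfold Phi
  rw [measureReal_def, ProbabilityTheory.gaussianReal_apply_eq_integral _ (by norm_num), ENNReal.toReal_ofReal]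
  · simp_rw [phi_eq]
  · exact integral_nonneg fun x => ProbabilityTheory.gaussianPDFReal_nonneg _ _ _

lemma Phi_hasDerivAt (t : ℝ) : HasDerivAt Phi (phi t) t := by
  have h : ∀ s, Phi s = Phi 0 + ∫ x in (0:ℝ)..s, phi x := fun s => by
    rw [Phi_eq_int, Phi_eq_int, ← intervalIntegral.integral_Iic_sub_Iic phi_int.integrableOn phi_int.integrableOn]
    ring
  have h2 : Phi = fun s => Phi 0 + ∫ x in (0:ℝ)..s, phi x := funext h
  rw [h2]
  exact (intervalIntegral.integral_hasDerivAt_right (phi_cont.intervalIntegrable _ _)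
    (phi_cont.stronglyMeasurableAtFilter _ _) phi_cont.continuousAt).const_add _

lemma phi_hasDerivAt (t : ℝ) : HasDerivAt phi (-t * phi t) t := by
  unfold phi
  have h : HasDerivAt (fun t : ℝ => -t ^ 2 / 2) (-t) t := by
    have := (((hasDerivAt_id t).pow 2).neg).div_const 2
    convert! this using 1
    simp; ring
  convert! (h.exp.const_mul (√(2 * Real.pi))⁻¹) using 1
  ring

lemma Phi_cont : Continuous Phi := continuous_iff_continuousAt.2 fun t => (Phi_hasDerivAt t).continuousAt

lemma Phi_strictMono : StrictMono Phi :=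
  strictMono_of_deriv_pos fun t => by rw [(Phi_hasDerivAt t).deriv]; exact phi_pos t

lemma Phi_top : Filter.Tendsto Phi Filter.atTop (nhds 1) := by
  have := tendsto_measure_Iic_atTop (ProbabilityTheory.gaussianReal 0 1)
  rw [measure_univ] at this
  exact (ENNReal.tendsto_toReal ENNReal.one_ne_top).comp this

lemma Phi_bot : Filter.Tendsto Phi Filter.atBot (nhds 0) := by
  have h2 : ∀ t, Phi t = ProbabilityTheory.cdf (ProbabilityTheory.gaussianReal 0 1) t := fun t => by
    rw [ProbabilityTheory.cdf_eq_real]; rfl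
  rw [funext h2]
  exact ProbabilityTheory.tendsto_cdf_atBot _

lemma Phi_pos (t : ℝ) : 0 < Phi t := by
  have h1 : 0 ≤ Phi (t - 1) := measureReal_nonneg
  exact h1.trans_lt (Phi_strictMono (by linarith))

lemma Phi_lt_one (t : ℝ) : Phi t < 1 := by
  have h1 : Phi (t + 1) ≤ 1 := measureReal_le_one
  exact (Phi_strictMono (by linarith)).trans_le h1

lemma Phi_neg (t : ℝ) : Phi (-t) = 1 - Phi t := by
  rw [Phi_eq_int]
  have h1 : ∫ x in Iic (-t), phi x = ∫ x in Ioi t, phi x := by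
    have := integral_comp_neg_Iic (-t) phi
    rw [neg_neg] at this
    rw [← this]
    simp [phi]
  have h2 := intervalIntegral.integral_Iic_add_Ioi (b := t) phi_int.integrableOn phi_int.integrableOn
  have h3 : ∫ x, phi x = 1 := by
    have := ProbabilityTheory.integral_gaussianPDFReal_eq_one 0 (v := 1) (by norm_num)
    simpa only [funext phi_eq] using this
  rw [h1, Phi_eq_int]; linarith

lemma Phi_zero : Phi 0 = 1 / 2 := by
  have := Phi_neg 0
  simp at this; linarith

lemma Phi_half {t : ℝ} (ht : 0 ≤ t) : 1 / 2 ≤ Phi t := by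
  rw [← Phi_zero]; exact Phi_strictMono.monotone ht

lemma phi_abs_anti {s t : ℝ} (h : |s| ≤ |t|) : phi t ≤ phi s := by
  unfold phi
  have := sq_le_sq.2 h
  gcongr

/-- mean value bounds -/
lemma Phi_mvt {s t : ℝ} (h : s < t) : ∃ x ∈ Ioo s t, Phi t - Phi s = phi x * (t - s) := by
  obtain ⟨x, hx, h2⟩ := exists_hasDerivAt_eq_slope Phi phi h Phi_cont.continuousOn
    (fun x _ => Phi_hasDerivAt x)
  refine ⟨x, hx, ?_⟩
  rw [h2]
  have : t - s ≠ 0 := by linarith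
  field_simp

lemma Phi_mills {t : ℝ} (ht : 1 ≤ t) : 1 - Phi t ≤ phi t := by
  have hd : ∀ x, HasDerivAt (fun x => phi x - (1 - Phi x)) (-x * phi x + phi x) x := fun x => by
    have := (phi_hasDerivAt x).sub ((Phi_hasDerivAt x).const_sub 1)
    convert! this using 1; ring
  have hanti : AntitoneOn (fun x => phi x - (1 - Phi x)) (Ici 1) := by
    apply antitoneOn_of_deriv_nonpos (convex_Ici 1)
    · exact fun x _ => (hd x).continuousAt.continuousWithinAt
    · exact fun x _ => (hd x).differentiableAt.differentiableWithinAt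
    · intro x hx
      rw [interior_Ici] at hx
      rw [(hd x).deriv]
      have := phi_pos x
      have : (1:ℝ) < x := hx
      nlinarith
  have h2 : ∀ x, t ≤ x → -(1 - Phi x) ≤ phi t - (1 - Phi t) := fun x hx => by
    have := hanti (mem_Ici.2 ht) (mem_Ici.2 (ht.trans hx)) hx
    simp only at this
    have := phi_pos x
    linarith
  have h3 : Filter.Tendsto (fun x => -(1 - Phi x)) Filter.atTop (nhds (-(1 - 1))) :=
    (Phi_top.const_sub 1).neg
  have h4 := le_of_tendsto h3 (Filter.eventually_atTop.2 ⟨t, h2⟩)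
  linarith

lemma Phi_surj {y : ℝ} (h0 : 0 < y) (h1 : y < 1) : ∃ x, Phi x = y := by
  obtain ⟨a, ha⟩ := (Phi_bot.eventually (gt_mem_nhds h0)).exists
  obtain ⟨b, hb⟩ := (Phi_top.eventually (lt_mem_nhds h1)).exists
  have hab : a ≤ b := by
    by_contra h
    have := Phi_strictMono (not_le.1 h); linarith
  obtain ⟨x, _, hx⟩ := intermediate_value_Icc hab Phi_cont.continuousOn ⟨ha.le, hb.le⟩
  exact ⟨x, hx⟩

/-- inverse of `Phi` -/
def PhiInv (y : ℝ) : ℝ := Function.invFun Phi y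

lemma Phi_PhiInv {y : ℝ} (h0 : 0 < y) (h1 : y < 1) : Phi (PhiInv y) = y :=
  Function.invFun_eq (Phi_surj h0 h1)

lemma PhiInv_Phi (x : ℝ) : PhiInv (Phi x) = x := Function.leftInverse_invFun Phi_strictMono.injective x

lemma PhiInv_strictMonoOn : StrictMonoOn PhiInv (Ioo 0 1) := by
  intro x hx y hy hxy
  rw [← Phi_strictMono.lt_iff_lt, Phi_PhiInv hx.1 hx.2, Phi_PhiInv hy.1 hy.2]; exact hxy

lemma PhiInv_hasDerivAt {y : ℝ} (h : y ∈ Ioo (0:ℝ) 1) : HasDerivAt PhiInv (phi (PhiInv y))⁻¹ y := by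
  have hc : ContinuousAt PhiInv y := by
    apply PhiInv_strictMonoOn.continuousAt_of_image_mem_nhds (isOpen_Ioo.mem_nhds h)
    have : PhiInv '' Ioo 0 1 = univ := by
      rw [eq_univ_iff_forall]
      exact fun x => ⟨Phi x, ⟨Phi_pos x, Phi_lt_one x⟩, PhiInv_Phi x⟩
    rw [this]; exact Filter.univ_mem
  apply HasDerivAt.of_local_left_inverse hc (Phi_hasDerivAt _) (phi_pos _).ne'
  filter_upwards [isOpen_Ioo.mem_nhds h] with z hz
  exact Phi_PhiInv hz.1 hz.2

/-- general transport derivative -/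
lemma trans_gen (K : ℝ) (hK : 0 < K) (I : Set ℝ) (hI : ∀ s ∈ I, K * Phi s < 1) :
    (StrictMonoOn (fun s => PhiInv (K * Phi s)) I) ∧
    (∀ s ∈ I, HasDerivAt (fun s => PhiInv (K * Phi s))
      (K * Real.exp ((PhiInv (K * Phi s) ^ 2 - s ^ 2) / 2)) s) := by
  have hm : ∀ s ∈ I, K * Phi s ∈ Ioo (0:ℝ) 1 := fun s hs => ⟨mul_pos hK (Phi_pos s), hI s hs⟩
  constructor
  · intro s hs r hr h
    exact PhiInv_strictMonoOn (hm s hs) (hm r hr) (mul_lt_mul_of_pos_left (Phi_strictMono h) hK)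
  · intro s hs
    have h := (PhiInv_hasDerivAt (hm s hs)).comp s ((Phi_hasDerivAt s).const_mul K)
    convert! h using 1
    set T := PhiInv (K * Phi s)
    have h1 : phi s = Real.exp ((T ^ 2 - s ^ 2) / 2) * phi T := by
      unfold phi
      rw [mul_left_comm, ← Real.exp_add]; congr 2; ring
    rw [h1]
    have := (phi_pos T).ne'
    field_simp

lemma trans_second (T : ℝ → ℝ) (K : ℝ) (s : ℝ)
    (h : HasDerivAt T (K * Real.exp ((T s ^ 2 - s ^ 2) / 2)) s) :
    HasDerivAt (fun s => K * Real.exp ((T s ^ 2 - s ^ 2) / 2))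
      ((K * Real.exp ((T s ^ 2 - s ^ 2) / 2)) *
        (T s * (K * Real.exp ((T s ^ 2 - s ^ 2) / 2)) - s)) s := by
  set d := K * Real.exp ((T s ^ 2 - s ^ 2) / 2)
  have h1 : HasDerivAt (fun s => (T s ^ 2 - s ^ 2) / 2) (T s * d - s) s := by
    have := ((h.pow 2).sub ((hasDerivAt_id s).pow 2)).div_const 2
    convert! this using 1
    simp; ring
  convert! h1.exp.const_mul K using 1
  simp only [d]; ring

lemma sep_of_deriv (f f' : ℝ → ℝ) (a p q : ℝ) (hd : ∀ s ∈ Icc p q, HasDerivAt f (f' s) s)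
    (ha : ∀ s ∈ Icc p q, a ≤ |f' s|) :
    ∀ s ∈ Icc p q, ∀ r ∈ Icc p q, a * |s - r| ≤ |f s - f r| := by
  have key : ∀ s ∈ Icc p q, ∀ r ∈ Icc p q, s < r → a * |s - r| ≤ |f s - f r| := by
    intro s hs r hr h
    obtain ⟨x, hx, h2⟩ := exists_hasDerivAt_eq_slope f f' h
      (fun x hx => (hd x ⟨hs.1.trans hx.1, hx.2.trans hr.2⟩).continuousAt.continuousWithinAt)
      (fun x hx => hd x ⟨hs.1.trans hx.1.le, hx.2.le.trans hr.2⟩)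
    have h3 := ha x ⟨hs.1.trans hx.1.le, hx.2.le.trans hr.2⟩
    have h4 : f r - f s = f' x * (r - s) := by
      rw [h2]
      have : r - s ≠ 0 := by linarith
      field_simp
    rw [abs_sub_comm (f s), h4, abs_mul, abs_sub_comm s]
    gcongr
  intro s hs r hr
  rcases lt_trichotomy s r with h | h | h
  · exact key s hs r hr h
  · simp [h]
  · rw [abs_sub_comm, abs_sub_comm (f s)]; exact key r hr s hs h

lemma gap_lower {x y : ℝ} (h : (1 / 2) * phi 3 ≤ Phi y - Phi x) : 1 / 2 * Real.exp (-9 / 2) ≤ y - x := by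
  have h0 : x < y := by
    rw [← Phi_strictMono.lt_iff_lt]; have := phi_pos 3; linarith
  obtain ⟨z, _, hz⟩ := Phi_mvt h0
  rw [hz] at h
  have h1 : phi z ≤ phi 0 := phi_abs_anti (by simp)
  have h2 : phi 3 = phi 0 * Real.exp (-9 / 2) := by
    unfold phi; norm_num
  have h3 := phi_pos 0
  rw [h2] at h
  have h4 : phi z * (y - x) ≤ phi 0 * (y - x) := by gcongr
  have h5 : phi 0 * (1 / 2 * Real.exp (-9 / 2)) ≤ phi 0 * (y - x) := by linarith
  exact le_of_mul_le_mul_left h5 h3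

lemma one_sub_Phi_two {t : ℝ} (ht : t ≤ 2) : phi 3 ≤ 1 - Phi t := by
  obtain ⟨z, hz, h⟩ := Phi_mvt (s := 2) (t := 3) (by norm_num)
  have h1 : phi 3 ≤ phi z := phi_abs_anti (by
    rw [abs_of_pos (by linarith [hz.1]), abs_of_pos (by norm_num)]; exact hz.2.le)
  have := Phi_lt_one 3
  have := Phi_strictMono.monotone ht
  linarith

lemma exp_num1 : (1:ℝ) / 300 ≤ 1 / 2 * Real.exp (-9 / 2) := by
  have h : Real.exp (9 / 2) ≤ 150 := by
    have h1 : Real.exp (9/2) = Real.exp 1 ^ 4 * Real.exp (1/2) := by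
      rw [← Real.exp_nat_mul, ← Real.exp_add]; norm_num
    have h3 : Real.exp (1/2) ^ 2 = Real.exp 1 := by rw [← Real.exp_nat_mul]; norm_num
    have h2 := Real.exp_one_lt_d9
    have h5 : Real.exp (1/2) ≤ 1.65 := by
      by_contra hcon
      push Not at hcon
      nlinarith
    rw [h1]
    have h6 : Real.exp 1 ^ 4 ≤ 2.7182818286 ^ 4 := by gcongr
    have h7 := Real.exp_pos (1/2)
    have h8 := Real.exp_pos 1
    nlinarith
  have h2 : Real.exp (-9 / 2) = (Real.exp (9 / 2))⁻¹ := by rw [← Real.exp_neg]; norm_num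
  rw [h2]
  have h3 : (150:ℝ)⁻¹ ≤ (Real.exp (9 / 2))⁻¹ := by
    apply inv_anti₀ (Real.exp_pos _) h
  linarith

lemma exp_half_le : Real.exp (1 / 2) ≤ 1.65 := by
  have h3 : Real.exp (1/2) ^ 2 = Real.exp 1 := by rw [← Real.exp_nat_mul]; norm_num
  have h2 := Real.exp_one_lt_d9
  by_contra hcon
  push Not at hcon
  nlinarith

lemma phi_zero_le : phi 0 ≤ 1.65 * phi 1 := by
  have h : phi 0 = Real.exp (1/2) * phi 1 := by
    unfold phi
    rw [mul_comm, mul_comm (Real.exp (1/2)), mul_assoc, ← Real.exp_add]; norm_num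
  rw [h]
  have := phi_pos 1
  have := exp_half_le
  gcongr

lemma transC (t : ℝ) (ht1 : 1 ≤ t) (ht2 : t ≤ 2) : ∃ T T' : ℝ → ℝ, StrictMonoOn T (Iio t) ∧
    (∀ s ∈ Iio t, HasDerivAt T (T' s) s) ∧
    (∀ s ∈ Iio t, T' s = (1 / Phi t) * Real.exp ((T s ^ 2 - s ^ 2) / 2)) ∧
    (∀ s ∈ Icc (1/4 : ℝ) (3/4), T' s ≤ 14) ∧
    (∀ s ∈ Icc (1/4 : ℝ) (3/4), ∀ r ∈ Icc (1/4 : ℝ) (3/4), 1/600 * |s - r| ≤ |T' s - T' r|) := by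
  set K := 1 / Phi t with hK
  have hPt := Phi_pos t
  have hPt1 := Phi_lt_one t
  have hK0 : 0 < K := by positivity
  have hK1 : 1 ≤ K := by rw [hK, le_div_iff₀ hPt]; linarith
  have hlt : ∀ s ∈ Iio t, K * Phi s < 1 := fun s hs => by
    rw [hK, one_div_mul_eq_div, div_lt_one hPt]; exact Phi_strictMono hs
  obtain ⟨h1, h2⟩ := trans_gen K hK0 (Iio t) hlt
  set T : ℝ → ℝ := fun s => PhiInv (K * Phi s) with hT
  have hPT : ∀ s ∈ Iio t, Phi (T s) = K * Phi s := fun s hs =>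
    Phi_PhiInv (mul_pos hK0 (Phi_pos s)) (hlt s hs)
  have hsub : ∀ s ∈ Icc (1/4 : ℝ) (3/4), s ∈ Iio t := fun s hs => by
    have := hs.2; show s < t; linarith
  have hgap : ∀ s ∈ Icc (1/4 : ℝ) (3/4), 1 / 300 ≤ T s - s := fun s hs => by
    refine exp_num1.trans (gap_lower ?_)
    rw [hPT s (hsub s hs)]
    have h3 := Phi_half (t := s) (by linarith [hs.1])
    have h4 := one_sub_Phi_two ht2
    have h5 : 1 - Phi t ≤ K - 1 := by
      have : K - 1 = K * (1 - Phi t) := by rw [hK]; field_simp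
      rw [this]; nlinarith
    have h6 := phi_pos 3
    nlinarith
  have hge1 : ∀ s ∈ Icc (1/4 : ℝ) (3/4), 1 ≤ K * Real.exp ((T s ^ 2 - s ^ 2) / 2) := fun s hs => by
    have := hgap s hs
    have h4 : 1 ≤ Real.exp ((T s ^ 2 - s ^ 2) / 2) := by
      apply Real.one_le_exp
      nlinarith [hs.1]
    nlinarith
  refine ⟨T, fun s => K * Real.exp ((T s ^ 2 - s ^ 2) / 2), h1, h2, fun s _ => rfl, ?_, ?_⟩
  · intro s hs
    have hs' := hsub s hs
    have hTs : s ≤ T s := by linarith [hgap s hs]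
    have h3 : phi 1 / 4 ≤ 1 - Phi (T s) := by
      have h4 : 1 - Phi (T s) = K * (Phi t - Phi s) := by
        rw [hPT s hs', hK]; field_simp
      have h5 : phi 1 / 4 ≤ Phi t - Phi s := by
        have h6 : Phi 1 - Phi (3/4) ≤ Phi t - Phi s := by
          have := Phi_strictMono.monotone ht1
          have := Phi_strictMono.monotone hs.2
          linarith
        obtain ⟨z, hz, h⟩ := Phi_mvt (s := 3/4) (t := 1) (by norm_num)
        have h1 : phi 1 ≤ phi z := phi_abs_anti (by
          rw [abs_of_pos (by linarith [hz.1]), abs_of_pos (by norm_num)]; exact hz.2.le)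
        linarith
      rw [h4]
      have := phi_pos 1
      nlinarith
    have h7 : phi 1 / 4 ≤ phi (T s) := by
      rcases le_total 1 (T s) with h | h
      · exact h3.trans (Phi_mills h)
      · have : phi 1 ≤ phi (T s) := phi_abs_anti (by
          rw [abs_of_pos (by linarith [hs.1]), abs_of_pos (by norm_num)]; exact h)
        have := phi_pos 1
        linarith
    have h8 : Real.exp ((T s ^ 2 - s ^ 2) / 2) * phi (T s) = phi s := by
      unfold phi
      rw [mul_comm, mul_assoc, ← Real.exp_add]; congr 2; ring
    have h9 : phi s ≤ phi 0 := phi_abs_anti (by simp)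
    have h10 := phi_zero_le
    have h11 := phi_pos 1
    have h12 : K ≤ 2 := by
      rw [hK, div_le_iff₀ hPt]; linarith [Phi_half (t := t) (by linarith)]
    have h13 := Real.exp_pos ((T s ^ 2 - s ^ 2) / 2)
    have h14 : Real.exp ((T s ^ 2 - s ^ 2) / 2) ≤ 6.6 := by
      have : Real.exp ((T s ^ 2 - s ^ 2) / 2) * (phi 1 / 4) ≤ 6.6 * (phi 1 / 4) := by
        calc _ ≤ Real.exp ((T s ^ 2 - s ^ 2) / 2) * phi (T s) := by gcongr
          _ ≤ _ := by rw [h8]; linarith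
      exact le_of_mul_le_mul_right this (by positivity)
    simp only
    nlinarith
  · apply sep_of_deriv _ _ _ _ _ (fun s hs => trans_second T K s (h2 s (hsub s hs)))
    intro s hs
    have h3 := hgap s hs
    have h4 := hge1 s hs
    set d := K * Real.exp ((T s ^ 2 - s ^ 2) / 2)
    have h5 : 1/300 ≤ T s * d - s := by nlinarith [hs.1]
    rw [abs_of_nonneg (by nlinarith)]
    nlinarith

lemma transA (t : ℝ) (ht1 : 1 ≤ t) (ht2 : t ≤ 2) : ∃ T T' : ℝ → ℝ, StrictMono T ∧
    (∀ s, HasDerivAt T (T' s) s) ∧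
    (∀ s, T' s = Phi t * Real.exp ((T s ^ 2 - s ^ 2) / 2)) ∧
    (∀ s ∈ Icc (1/4 : ℝ) (3/4), T' s ≤ 14) ∧
    (∀ s ∈ Icc (1/4 : ℝ) (3/4), ∀ r ∈ Icc (1/4 : ℝ) (3/4), 1/600 * |s - r| ≤ |T' s - T' r|) ∧
    ∀ s, T s ≤ t := by
  set K := Phi t with hK
  have hPt := Phi_pos t
  have hPt1 := Phi_lt_one t
  have hPth := Phi_half (t := t) (by linarith)
  have hlt : ∀ s ∈ (univ : Set ℝ), K * Phi s < 1 := fun s hs => by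
    have := Phi_lt_one s; have := Phi_pos s; nlinarith
  obtain ⟨h1, h2⟩ := trans_gen K hPt univ hlt
  set T : ℝ → ℝ := fun s => PhiInv (K * Phi s) with hT
  have hPT : ∀ s, Phi (T s) = K * Phi s := fun s =>
    Phi_PhiInv (mul_pos hPt (Phi_pos s)) (hlt s trivial)
  have hgap : ∀ s ∈ Icc (1/4 : ℝ) (3/4), 1 / 2 * Real.exp (-9/2) ≤ s - T s := fun s hs => by
    refine (gap_lower ?_)
    rw [hPT s]
    have h3 := Phi_half (t := s) (by linarith [hs.1])
    have h4 := one_sub_Phi_two ht2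
    have h6 := phi_pos 3
    nlinarith
  have h8 : ∀ s, Real.exp ((T s ^ 2 - s ^ 2) / 2) * phi (T s) = phi s := fun s => by
      unfold phi
      rw [mul_comm, mul_assoc, ← Real.exp_add]; congr 2; ring
  refine ⟨T, fun s => K * Real.exp ((T s ^ 2 - s ^ 2) / 2), ?_, fun s => h2 s trivial, fun s => rfl, ?_, ?_, ?_⟩
  · exact strictMonoOn_univ.1 h1
  · intro s hs
    have h13 := Real.exp_pos ((T s ^ 2 - s ^ 2) / 2)
    have hE : Real.exp ((T s ^ 2 - s ^ 2) / 2) ≤ 14 := by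
      rcases le_total (-1) (T s) with h | h
      · have h3 : phi 1 ≤ phi (T s) := phi_abs_anti (by
          rw [abs_of_pos (by norm_num : (0:ℝ) < 1)]; rw [abs_le]; 
          have := hgap s hs
          have := Real.exp_pos (-9/2)
          exact ⟨h, by linarith [hs.2]⟩)
        have h9 : phi s ≤ phi 0 := phi_abs_anti (by simp)
        have h10 := phi_zero_le
        have h11 := phi_pos 1
        have : Real.exp ((T s ^ 2 - s ^ 2) / 2) * (phi 1) ≤ 14 * (phi 1) := by
          calc _ ≤ Real.exp ((T s ^ 2 - s ^ 2) / 2) * phi (T s) := by gcongr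
            _ ≤ _ := by rw [h8]; linarith
        exact le_of_mul_le_mul_right this (by positivity)
      · have h3 : 1/4 ≤ Phi (T s) := by
          rw [hPT]; nlinarith [Phi_half (t := s) (by linarith [hs.1])]
        have h4 := Phi_mills (t := - T s) (by linarith)
        rw [Phi_neg] at h4
        have h5 : phi (-T s) = phi (T s) := by simp [phi]
        have h6 : phi s ≤ 1 := by
          have h9 : phi s ≤ phi 0 := phi_abs_anti (by simp)
          refine h9.trans ?_
          simp only [phi]
          have h20 : Real.exp (-0 ^ 2 / 2) = 1 := by norm_num
          rw [h20, mul_one, Real.sqrt_mul (by norm_num)]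
          apply inv_le_one_of_one_le₀
          have h15 : (1:ℝ) ≤ √2 := Real.one_le_sqrt.2 (by norm_num)
          have h16 : (1:ℝ) ≤ √Real.pi := Real.one_le_sqrt.2 (by linarith [Real.pi_gt_three])
          nlinarith
        have : Real.exp ((T s ^ 2 - s ^ 2) / 2) * (1/4) ≤ 14 * (1/4) := by
          calc _ ≤ Real.exp ((T s ^ 2 - s ^ 2) / 2) * phi (T s) := by gcongr; linarith
            _ ≤ _ := by rw [h8]; linarith
        exact le_of_mul_le_mul_right this (by positivity)
    simp only
    nlinarith
  · apply sep_of_deriv _ _ _ _ _ (fun s hs => trans_second T K s (h2 s trivial))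
    intro s hs
    have h3 := hgap s hs
    have h3' := exp_num1
    have hlow : 1 / 2 * Real.exp (-9/32) ≤ K * Real.exp ((T s ^ 2 - s ^ 2) / 2) := by
      have : Real.exp (-9/32) ≤ Real.exp ((T s ^ 2 - s ^ 2) / 2) := by
        apply Real.exp_le_exp.2
        nlinarith [hs.1, hs.2, sq_nonneg (T s)]
      have := Real.exp_pos (-9/32)
      nlinarith
    have hl2 : 23/32 ≤ Real.exp (-9/32) := by
      have := Real.add_one_le_exp (-9/32 : ℝ); linarith
    have hup : T s ≤ 0 ∨ (0 < T s ∧ K * Real.exp ((T s ^ 2 - s ^ 2) / 2) ≤ 1) := by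
      rcases le_or_gt (T s) 0 with h | h
      · exact Or.inl h
      · refine Or.inr ⟨h, ?_⟩
        have : Real.exp ((T s ^ 2 - s ^ 2) / 2) ≤ 1 := by
          apply Real.exp_le_one_iff.2
          nlinarith
        have := Real.exp_pos ((T s ^ 2 - s ^ 2) / 2)
        nlinarith
    have hexp2 : 1 / 2 * Real.exp (-9/2) ≤ 1/4 := by
      have h17 : Real.exp (-9/2) ≤ 1/2 := by
        have h18 : Real.exp (-9 / 2) = (Real.exp (9 / 2))⁻¹ := by rw [← Real.exp_neg]; norm_num
        rw [h18]
        have h19 := Real.add_one_le_exp (9/2 : ℝ)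
        rw [inv_le_comm₀ (Real.exp_pos _) (by norm_num)]
        linarith
      linarith
    set g := 1 / 2 * Real.exp (-9/2) with hg
    have hgl : (1:ℝ)/200 ≤ g := by
      have h : Real.exp (9 / 2) ≤ 100 := by
        have h1 : Real.exp (9/2) = Real.exp 1 ^ 4 * Real.exp (1/2) := by
          rw [← Real.exp_nat_mul, ← Real.exp_add]; norm_num
        have h2 := Real.exp_one_lt_d9
        rw [h1]
        have h6 : Real.exp 1 ^ 4 ≤ 2.7182818286 ^ 4 := by gcongr
        have h7 := Real.exp_pos (1/2)
        have h8 := Real.exp_pos 1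
        have h9 := exp_half_le
        nlinarith
      have h2 : Real.exp (-9 / 2) = (Real.exp (9 / 2))⁻¹ := by rw [← Real.exp_neg]; norm_num
      rw [hg, h2]
      have h3 : (100:ℝ)⁻¹ ≤ (Real.exp (9 / 2))⁻¹ := by
        apply inv_anti₀ (Real.exp_pos _) h
      linarith
    set d := K * Real.exp ((T s ^ 2 - s ^ 2) / 2)
    have h5 : g ≤ s - T s * d := by
      rcases hup with h | ⟨h, h'⟩
      · have : T s * d ≤ 0 := mul_nonpos_of_nonpos_of_nonneg h (by linarith)
        linarith [hs.1]
      · nlinarith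
    have hd : 23/64 ≤ d := by linarith
    rw [abs_of_nonpos (by nlinarith)]
    nlinarith
  · intro s
    rw [← Phi_strictMono.le_iff_le, hPT]
    have := Phi_lt_one s
    nlinarith

section
variable {m : ℕ} {ι : Type*} [Fintype ι]

lemma ball_quad_lower (x0 w : EuclideanSpace ℝ (Fin m)) (h0 : ⟪w, x0⟫ = 0) (p : ℝ) (hp : 0 ≤ p)
    (hball : ∀ y, ‖y - x0‖ ≤ 1/8 → p ≤ (gaussianM m).real (ball y (1/16))) :
    ‖w‖ ^ 2 * (p / 256) ≤ ∫ x in ball x0 (1/4), ⟪w, x⟫ ^ 2 ∂(gaussianM m) := by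
  by_cases hw : w = 0
  · subst hw; simp
  have hw' : 0 < ‖w‖ := norm_pos_iff.2 hw
  set y := x0 + (1 / (8 * ‖w‖)) • w with hy
  have hyx : ‖y - x0‖ = 1/8 := by
    rw [hy, add_sub_cancel_left, norm_smul, Real.norm_eq_abs, abs_of_pos (by positivity)]
    field_simp
  have hsub : ball y (1/16) ⊆ ball x0 (1/4) := by
    apply ball_subset_ball'
    rw [dist_eq_norm, hyx]; norm_num
  have h1 : ∫ x in ball y (1/16), ‖w‖ ^ 2 / 256 ∂(gaussianM m) ≤
      ∫ x in ball y (1/16), ⟪w, x⟫ ^ 2 ∂(gaussianM m) := by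
    apply setIntegral_mono_on (integrable_const _).integrableOn (inner_sq_integrable w).integrableOn measurableSet_ball
    intro x hx
    have h2 : ⟪w, x⟫ = ‖w‖ / 8 + ⟪w, x - y⟫ := by
      rw [inner_sub_right, hy, inner_add_right, h0, real_inner_smul_right, real_inner_self_eq_norm_sq]
      field_simp; ring
    have h3 : |⟪w, x - y⟫| ≤ ‖w‖ * (1/16) := by
      refine (abs_real_inner_le_norm _ _).trans ?_
      gcongr
      rw [mem_ball, dist_eq_norm] at hx; exact hx.le
    have h4 : ‖w‖ / 16 ≤ ⟪w, x⟫ := by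
      have := (abs_le.1 h3).1; rw [h2]; linarith
    nlinarith
  have h5 : ∫ x in ball y (1/16), ⟪w, x⟫ ^ 2 ∂(gaussianM m) ≤ ∫ x in ball x0 (1/4), ⟪w, x⟫ ^ 2 ∂(gaussianM m) :=
    setIntegral_mono_set (inner_sq_integrable w).integrableOn
      (Filter.Eventually.of_forall fun x => sq_nonneg _) hsub.eventuallyLE
  have h6 := hball y hyx.le
  rw [setIntegral_const, smul_eq_mul] at h1
  calc _ = p * (‖w‖ ^ 2 / 256) := by ring
    _ ≤ (gaussianM m).real (ball y (1/16)) * (‖w‖ ^ 2 / 256) := by gcongr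
    _ ≤ _ := h1.trans h5

/-- total deficit -/
def etaF (c : ι → ℝ) (u : ι → EuclideanSpace ℝ (Fin m)) : ℝ :=
  ∑ i, ∑ j, c i * c j * ‖u i - u j‖ ^ 2 * ⟪u i, u j⟫ ^ 2

lemma qForm_lower (c : ι → ℝ) (u : ι → EuclideanSpace ℝ (Fin m)) (hc : ∀ i, 0 ≤ c i)
    (x0 : EuclideanSpace ℝ (Fin m)) (h0 : ∀ i, ⟪u i, x0⟫ = 1/2) (p : ℝ) (hp : 0 ≤ p)
    (hball : ∀ y, ‖y - x0‖ ≤ 1/8 → p ≤ (gaussianM m).real (ball y (1/16))) :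
    etaF c u * (p / 256) ≤ ∫ x in ball x0 (1/4), qForm c u x ∂(gaussianM m) := by
  unfold qForm etaF
  rw [integral_finsetSum _ fun i _ => integrable_finsetSum _ fun j _ =>
    (((inner_sq_integrable (u i - u j)).const_mul _).mul_const _).integrableOn, Finset.sum_mul]
  refine Finset.sum_le_sum fun i _ => ?_
  rw [integral_finsetSum _ fun j _ =>
    (((inner_sq_integrable (u i - u j)).const_mul _).mul_const _).integrableOn, Finset.sum_mul]
  refine Finset.sum_le_sum fun j _ => ?_
  rw [integral_mul_const, integral_const_mul]
  have := ball_quad_lower x0 (u i - u j) (by rw [inner_sub_left, h0, h0]; ring) p hp hball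
  have h8 : 0 ≤ c i * c j * ⟪u i, u j⟫ ^ 2 := by
    have := hc i; have := hc j; positivity
  nlinarith [mul_le_mul_of_nonneg_left this h8]

/-- greedy selection of nearly orthogonal vectors -/
lemma greedy (c : ι → ℝ) (u : ι → EuclideanSpace ℝ (Fin m)) (hc : ∀ i, 0 ≤ c i)
    (hu : ∀ i, ‖u i‖ = 1) (hiso : ∀ x, ∑ i, c i * ⟪u i, x⟫ ^ 2 = ‖x‖ ^ 2)
    (η : ℝ) (hη : 0 < η) (he : etaF c u ≤ η) :
    ∃ f : Fin m → ι, ∀ i j, i ≠ j → ⟪u (f i), u (f j)⟫ ^ 2 ≤ 16 * m * η := by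
  set F : ι → ℝ := fun j => ∑ i, c i * ‖u i - u j‖ ^ 2 * ⟪u i, u j⟫ ^ 2 with hF
  have hFs : ∑ j, c j * F j ≤ η := by
    refine le_trans (le_of_eq ?_) he
    unfold etaF
    rw [Finset.sum_comm]
    refine Finset.sum_congr rfl fun j _ => ?_
    rw [hF, Finset.mul_sum]
    exact Finset.sum_congr rfl fun i _ => by ring
  have hF0 : ∀ j, 0 ≤ F j := fun j => Finset.sum_nonneg fun i _ => by have := hc i; positivity
  have key : ∀ k, k ≤ m → ∃ f : Fin k → ι, (∀ i, F (f i) ≤ 4 * η) ∧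
      ∀ i j, i ≠ j → ⟪u (f i), u (f j)⟫ ^ 2 ≤ 16 * m * η := by
    intro k
    induction k with
    | zero => exact fun _ => ⟨Fin.elim0, fun i => i.elim0, fun i => i.elim0⟩
    | succ k ih =>
      intro hk
      obtain ⟨f, hf1, hf2⟩ := ih (by omega)
      have hm : (1:ℝ) ≤ m := by exact_mod_cast (by omega : 1 ≤ m)
      have hkm : (k:ℝ) + 1 ≤ m := by exact_mod_cast hk
      set s : ι → ℝ := fun i => ∑ j, ⟪u i, u (f j)⟫ ^ 2 with hs
      have hs0 : ∀ i, 0 ≤ s i := fun i => Finset.sum_nonneg fun j _ => sq_nonneg _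
      obtain ⟨i0, h1, h2⟩ : ∃ i, F i ≤ 4 * η ∧ s i ≤ 16 * m * η := by
        by_contra hcon
        push Not at hcon
        have hterm : ∀ i, c i * (1 - s i) ≤ c i * ((∑ j, ‖u i - u (f j)‖ ^ 2 * ⟪u i, u (f j)⟫ ^ 2) / (16 * m * η)
            + F i / (4 * η)) := by
          intro i
          apply mul_le_mul_of_nonneg_left _ (hc i)
          have hA : 0 ≤ (∑ j, ‖u i - u (f j)‖ ^ 2 * ⟪u i, u (f j)⟫ ^ 2) :=
            Finset.sum_nonneg fun j _ => by positivity
          rcases le_or_gt (F i) (4 * η) with h | h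
          · have h3 := hcon i h
            have h4 : 0 ≤ F i / (4 * η) := by have := hF0 i; positivity
            rcases le_or_gt 1 (s i) with h5 | h5
            · have : 0 ≤ (∑ j, ‖u i - u (f j)‖ ^ 2 * ⟪u i, u (f j)⟫ ^ 2) / (16 * m * η) := by positivity
              linarith
            have h6 : (1 - s i) * s i ≤ ∑ j, ‖u i - u (f j)‖ ^ 2 * ⟪u i, u (f j)⟫ ^ 2 := by
              simp only [hs, Finset.mul_sum]
              refine Finset.sum_le_sum fun j _ => ?_
              gcongr
              have h7 : ⟪u i, u (f j)⟫ ^ 2 ≤ s i :=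
                Finset.single_le_sum (f := fun j => ⟪u i, u (f j)⟫ ^ 2) (fun j _ => sq_nonneg _) (Finset.mem_univ j)
              rw [norm_sub_sq_real, hu, hu]
              simp only [hs] at h7
              nlinarith [sq_nonneg (1 - ⟪u i, u (f j)⟫)]
            have h8 : 1 - s i ≤ (∑ j, ‖u i - u (f j)‖ ^ 2 * ⟪u i, u (f j)⟫ ^ 2) / (16 * m * η) := by
              rw [le_div_iff₀ (by positivity)]
              nlinarith
            linarith
          · have h4 : 1 ≤ F i / (4 * η) := by rw [le_div_iff₀ (by positivity)]; linarith
            have : 0 ≤ (∑ j, ‖u i - u (f j)‖ ^ 2 * ⟪u i, u (f j)⟫ ^ 2) / (16 * m * η) := by positivity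
            have := hs0 i
            linarith
        have hsum := Finset.sum_le_sum (s := Finset.univ) fun i _ => hterm i
        have hL : ∑ i, c i * (1 - s i) = m - k := by
          simp only [mul_sub, mul_one, Finset.sum_sub_distrib, frame_sum_c c u hu hiso, hs, Finset.mul_sum]
          rw [Finset.sum_comm]
          simp [hiso, hu]
        have hR : ∑ i, c i * ((∑ j, ‖u i - u (f j)‖ ^ 2 * ⟪u i, u (f j)⟫ ^ 2) / (16 * m * η)
            + F i / (4 * η)) = (∑ j, F (f j)) / (16 * m * η) + (∑ i, c i * F i) / (4 * η) := by
          simp only [mul_add, Finset.sum_add_distrib]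
          congr 1
          · rw [hF, Finset.sum_comm, Finset.sum_div]
            refine Finset.sum_congr rfl fun i _ => ?_
            rw [← mul_div_assoc, Finset.mul_sum]
            congr 1
            exact Finset.sum_congr rfl fun j _ => by ring
          · rw [Finset.sum_div]
            exact Finset.sum_congr rfl fun i _ => by ring
        rw [hL, hR] at hsum
        have h9 : ∑ j, F (f j) ≤ k * (4 * η) := by
          have := Finset.sum_le_sum (s := Finset.univ) fun j _ => hf1 j
          simpa using this
        have h10 : (∑ j, F (f j)) / (16 * m * η) ≤ 1/4 := by
          rw [div_le_iff₀ (by positivity)]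
          nlinarith
        have h11 : (∑ i, c i * F i) / (4 * η) ≤ 1/4 := by
          rw [div_le_iff₀ (by positivity)]; linarith
        linarith
      have hb : ∀ j, ⟪u i0, u (f j)⟫ ^ 2 ≤ 16 * m * η := fun j =>
        (Finset.single_le_sum (f := fun j => ⟪u i0, u (f j)⟫ ^ 2) (fun j _ => sq_nonneg _) (Finset.mem_univ j)).trans h2
      refine ⟨Fin.cons i0 f, ?_, ?_⟩
      · intro i
        refine Fin.cases ?_ (fun i => ?_) i
        · simpa using h1
        · simpa using hf1 i
      · intro i j
        refine Fin.cases ?_ (fun i => ?_) i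
        · refine Fin.cases ?_ (fun j => ?_) j
          · intro h; exact absurd rfl h
          · intro _; simpa using hb j
        · refine Fin.cases ?_ (fun j => ?_) j
          · intro _; simpa [real_inner_comm] using hb i
          · intro h; simpa using hf2 i j (fun h' => h (by rw [h']))
  obtain ⟨f, _, hf⟩ := key m le_rfl
  exact ⟨f, hf⟩
end

section
variable {n : ℕ}

lemma reg_gram (hn : 1 ≤ n) {w : Fin (n + 1) → EuclideanSpace ℝ (Fin n)} (hw : IsRegVerts w) (i j : Fin (n + 1)) :
    ⟪w i, w j⟫ = (if i = j then (1 + 1 / (n:ℝ)) else 0) - 1 / n := by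
  split_ifs with h
  · subst h; rw [real_inner_self_eq_norm_sq, hw.1]; ring
  · rw [hw.2 i j h]; ring

lemma reg_sum (hn : 1 ≤ n) {w : Fin (n + 1) → EuclideanSpace ℝ (Fin n)} (hw : IsRegVerts w) :
    ∑ i, w i = 0 := by
  have hn' : (n:ℝ) ≠ 0 := by positivity
  have : ‖∑ i, w i‖ ^ 2 = 0 := by
    rw [← real_inner_self_eq_norm_sq, sum_inner]
    simp_rw [inner_sum, reg_gram hn hw]
    simp
    field_simp; ring
  simpa using this

lemma reg_frame (hn : 1 ≤ n) {w : Fin (n + 1) → EuclideanSpace ℝ (Fin n)} (hw : IsRegVerts w)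
    (y : EuclideanSpace ℝ (Fin n)) : ∑ i, ⟪w i, y⟫ • w i = (((n:ℝ) + 1) / n) • y := by
  have hn' : (n:ℝ) ≠ 0 := by positivity
  set e := EuclideanSpace.basisFun (Fin n) ℝ
  set S : EuclideanSpace ℝ (Fin n) →ₗ[ℝ] EuclideanSpace ℝ (Fin n) :=
    ∑ i, ((innerSL ℝ (w i) : EuclideanSpace ℝ (Fin n) →L[ℝ] ℝ) : EuclideanSpace ℝ (Fin n) →ₗ[ℝ] ℝ).smulRight (w i) - (((n:ℝ) + 1) / n) • LinearMap.id with hS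
  have hSa : ∀ y, S y = ∑ i, ⟪w i, y⟫ • w i - (((n:ℝ) + 1) / n) • y := fun y => by
    simp [hS]
  have h1 : ∀ y, ‖S y‖ ^ 2 = ∑ i, ∑ j, ⟪w i, w j⟫ * (⟪w i, y⟫ * ⟪y, w j⟫)
      - 2 * (((n:ℝ) + 1) / n) * ∑ i, (⟪w i, y⟫ * ⟪y, w i⟫) + (((n:ℝ) + 1) / n) ^ 2 * ‖y‖ ^ 2 := fun y => by
    rw [hSa, norm_sub_sq_real, ← real_inner_self_eq_norm_sq, sum_inner, sum_inner, norm_smul, mul_pow, Real.norm_eq_abs, sq_abs]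
    congr 2
    · refine Finset.sum_congr rfl fun i _ => ?_
      rw [inner_sum]
      refine Finset.sum_congr rfl fun j _ => ?_
      rw [real_inner_smul_left, real_inner_smul_right, real_inner_comm y (w j)]; ring
    · rw [Finset.mul_sum, Finset.mul_sum]
      refine Finset.sum_congr rfl fun i _ => ?_
      rw [real_inner_smul_left, real_inner_smul_right, real_inner_comm y (w i)]; ring
  have h2 : ∑ k, ‖S (e k)‖ ^ 2 = 0 := by
    have hA : ∑ k, ∑ i, ∑ j, ⟪w i, w j⟫ * (⟪w i, e k⟫ * ⟪e k, w j⟫) = ∑ i, ∑ j, ⟪w i, w j⟫ ^ 2 := by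
      rw [Finset.sum_comm]
      refine Finset.sum_congr rfl fun i _ => ?_
      rw [Finset.sum_comm]
      refine Finset.sum_congr rfl fun j _ => ?_
      rw [← Finset.mul_sum, e.sum_inner_mul_inner]; ring
    have hB : ∑ k, ∑ i, (⟪w i, e k⟫ * ⟪e k, w i⟫) = n + 1 := by
      rw [Finset.sum_comm]
      simp_rw [e.sum_inner_mul_inner, real_inner_self_eq_norm_sq, hw.1]
      simp
    have hC : ∑ i, ∑ j, ⟪w i, w j⟫ ^ 2 = ((n:ℝ) + 1) * (((n:ℝ) + 1) / n) := by
      have : ∀ i j, ⟪w i, w j⟫ ^ 2 = (if i = j then 1 - 1 / (n:ℝ) ^ 2 else 0) + 1 / (n:ℝ) ^ 2 := fun i j => by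
        rw [reg_gram hn hw]
        split_ifs <;> ring
      simp_rw [this]
      simp [Finset.sum_add_distrib]
      field_simp; ring
    simp only [h1, Finset.sum_add_distrib, Finset.sum_sub_distrib]
    rw [hA, ← Finset.mul_sum, hB, hC]
    simp [e.norm_eq_one]
    field_simp
    ring
  have h3 : ∀ k, S (e k) = 0 := fun k => by
    have := (Finset.sum_eq_zero_iff_of_nonneg (fun k _ => sq_nonneg ‖S (e k)‖)).1 h2 k (Finset.mem_univ k)
    simpa using this
  have h4 : S = 0 := e.toBasis.ext fun k => by simpa using h3 k
  have h5 := hSa y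
  rw [h4] at h5
  simp only [LinearMap.zero_apply] at h5
  exact (sub_eq_zero.1 h5.symm)

lemma reg_frame_sq (hn : 1 ≤ n) {w : Fin (n + 1) → EuclideanSpace ℝ (Fin n)} (hw : IsRegVerts w)
    (y z : EuclideanSpace ℝ (Fin n)) : ∑ i, ⟪w i, y⟫ * ⟪w i, z⟫ = (((n:ℝ) + 1) / n) * ⟪y, z⟫ := by
  have := congrArg (fun x => ⟪x, z⟫) (reg_frame hn hw y)
  simpa [sum_inner, real_inner_smul_left] using this

/-- an almost isometric linear map is close to an isometry -/
lemma near_isometry (M : EuclideanSpace ℝ (Fin n) →L[ℝ] EuclideanSpace ℝ (Fin n)) (τ : ℝ) (hτ1 : τ < 1)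
    (hM : ∀ x, |‖M x‖ ^ 2 - ‖x‖ ^ 2| ≤ τ * ‖x‖ ^ 2) :
    ∃ R : EuclideanSpace ℝ (Fin n) ≃ₗᵢ[ℝ] EuclideanSpace ℝ (Fin n), ∀ x, ‖M x - R x‖ ≤ τ * ‖x‖ := by
  set A := (ContinuousLinearMap.adjoint M).comp M with hA
  have hAi : ∀ x y, ⟪A x, y⟫ = ⟪M x, M y⟫ := fun x y => by
    rw [hA, ContinuousLinearMap.comp_apply, ContinuousLinearMap.adjoint_inner_left]
  have hsym : (A : EuclideanSpace ℝ (Fin n) →ₗ[ℝ] EuclideanSpace ℝ (Fin n)).IsSymmetric := by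
    intro x y
    show ⟪A x, y⟫ = ⟪x, A y⟫
    have h0 : ⟪x, A y⟫ = ⟪A y, x⟫ := real_inner_comm _ _
    rw [h0, hAi, hAi, real_inner_comm]
  have hfr : Module.finrank ℝ (EuclideanSpace ℝ (Fin n)) = n := finrank_euclideanSpace_fin
  set e := hsym.eigenvectorBasis hfr with he
  set l := hsym.eigenvalues hfr with hl
  have hAe : ∀ k, A (e k) = l k • e k := fun k => hsym.apply_eigenvectorBasis hfr k
  have hMe : ∀ k j, ⟪M (e k), M (e j)⟫ = if k = j then l k else 0 := fun k j => by
    rw [← hAi, hAe, real_inner_smul_left, orthonormal_iff_ite.1 e.orthonormal]; simp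
  have hlk : ∀ k, ‖M (e k)‖ ^ 2 = l k := fun k => by
    rw [← real_inner_self_eq_norm_sq, hMe]; simp
  have hlb : ∀ k, |l k - 1| ≤ τ := fun k => by
    have := hM (e k); rw [hlk, e.norm_eq_one] at this; simpa using this
  have hlpos : ∀ k, 0 < l k := fun k => by have := (abs_le.1 (hlb k)).1; linarith
  set f : Fin n → EuclideanSpace ℝ (Fin n) := fun k => (√(l k))⁻¹ • M (e k) with hf
  have hforth : Orthonormal ℝ f := by
    rw [orthonormal_iff_ite]
    intro k j
    rw [hf]
    simp only
    rw [real_inner_smul_left, real_inner_smul_right, hMe]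
    split_ifs with h
    · subst h
      have := Real.mul_self_sqrt (hlpos k).le
      have h2 := Real.sqrt_pos.2 (hlpos k)
      field_simp
      nlinarith
    · simp
  have hcard : Fintype.card (Fin n) = Module.finrank ℝ (EuclideanSpace ℝ (Fin n)) := by simp
  set fb : OrthonormalBasis (Fin n) ℝ (EuclideanSpace ℝ (Fin n)) :=
    OrthonormalBasis.mk hforth (by
      rw [hforth.linearIndependent.span_eq_top_of_card_eq_finrank' hcard]) with hfb
  have hfbk : ∀ k, fb k = f k := fun k => by simp [hfb]
  set R := e.equiv fb (Equiv.refl _) with hR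
  have hRe : ∀ k, R (e k) = f k := fun k => by simp [hR, hfbk]
  refine ⟨R, fun x => ?_⟩
  have hx : x = ∑ k, ⟪e k, x⟫ • e k := (e.sum_repr' x).symm
  have h1 : M x - R x = ∑ k, (⟪e k, x⟫ * (√(l k) - 1)) • fb k := by
    conv_lhs => rw [hx]
    rw [map_sum, map_sum, ← Finset.sum_sub_distrib]
    refine Finset.sum_congr rfl fun k _ => ?_
    rw [map_smul, map_smul, hRe, hfbk, ← smul_sub, mul_smul]
    congr 1
    rw [sub_smul, one_smul, hf]
    simp only
    rw [smul_smul, mul_inv_cancel₀ (Real.sqrt_pos.2 (hlpos k)).ne', one_smul]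
  have hin : ∀ k, ⟪fb k, M x - R x⟫ = ⟪e k, x⟫ * (√(l k) - 1) := fun k => by
    rw [h1, inner_sum]
    simp [real_inner_smul_right, orthonormal_iff_ite.1 fb.orthonormal]
  have h0τ : ∀ k, 0 ≤ τ := fun k => (abs_nonneg _).trans (hlb k)
  have h2 : ‖M x - R x‖ ^ 2 ≤ (τ * ‖x‖) ^ 2 := by
    rw [← fb.sum_sq_inner_right, mul_pow, ← e.sum_sq_inner_right, Finset.mul_sum]
    refine Finset.sum_le_sum fun k _ => ?_
    rw [hin, mul_pow, mul_comm]
    gcongr ?_ * _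
    have h3 : |√(l k) - 1| ≤ τ := by
      refine le_trans ?_ (hlb k)
      have h4 : l k - 1 = (√(l k) - 1) * (√(l k) + 1) := by
        have := Real.mul_self_sqrt (hlpos k).le; linear_combination -this
      rw [h4, abs_mul]
      apply le_mul_of_one_le_right (abs_nonneg _)
      rw [abs_of_nonneg (by positivity)]
      have := Real.sqrt_nonneg (l k)
      linarith
    rw [← sq_abs]; gcongr
  rcases Nat.eq_zero_or_pos n with h | h
  · subst h
    have : M x - R x = 0 := Subsingleton.elim _ _
    have h' : x = 0 := Subsingleton.elim _ _
    rw [this, h']; simp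
  · have := h0τ ⟨0, h⟩
    exact (pow_le_pow_iff_left₀ (norm_nonneg _) (by positivity) two_ne_zero).1 h2

lemma near_regular (hn : 1 ≤ n) {w : Fin (n + 1) → EuclideanSpace ℝ (Fin n)} (hw : IsRegVerts w)
    (u : Fin (n + 1) → EuclideanSpace ℝ (Fin n)) (hu : ∀ i, ‖u i‖ = 1) (θ : ℝ) (hθ : 0 ≤ θ)
    (hθ1 : n * θ < 1) (h : ∀ i j, i ≠ j → |⟪u i, u j⟫ + 1 / n| ≤ θ) :
    ∃ v : Fin (n + 1) → EuclideanSpace ℝ (Fin n), IsRegVerts v ∧ ∀ i, ‖u i - v i‖ ≤ √θ + n * θ := by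
  have hn' : (n:ℝ) ≠ 0 := by positivity
  have hn0 : (0:ℝ) < n := by positivity
  set M : EuclideanSpace ℝ (Fin n) →L[ℝ] EuclideanSpace ℝ (Fin n) :=
    ((n:ℝ) / (n + 1)) • ∑ i, (innerSL ℝ (w i)).smulRight (u i) with hM
  have hMa : ∀ x, M x = ((n:ℝ) / (n + 1)) • ∑ i, ⟪w i, x⟫ • u i := fun x => by
    simp [hM]
  have hd : ∀ i j, |⟪u i, u j⟫ - ⟪w i, w j⟫| ≤ θ := fun i j => by
    by_cases hij : i = j
    · subst hij
      rw [real_inner_self_eq_norm_sq, real_inner_self_eq_norm_sq, hu, hw.1]; simpa using hθ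
    · rw [hw.2 i j hij]
      have := h i j hij
      convert this using 2; ring
  have hnear : ∀ x, |‖M x‖ ^ 2 - ‖x‖ ^ 2| ≤ (n * θ) * ‖x‖ ^ 2 := by
    intro x
    have hx : x = ((n:ℝ) / (n + 1)) • ∑ i, ⟪w i, x⟫ • w i := by
      rw [reg_frame hn hw, smul_smul]
      have : (n:ℝ) / (n + 1) * ((n + 1) / n) = 1 := by field_simp
      rw [this, one_smul]
    have e1 : ‖M x‖ ^ 2 = ((n:ℝ) / (n + 1)) ^ 2 * ∑ i, ∑ j, ⟪w i, x⟫ * ⟪w j, x⟫ * ⟪u i, u j⟫ := by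
      rw [hMa, norm_smul, mul_pow, Real.norm_eq_abs, sq_abs, ← real_inner_self_eq_norm_sq, sum_inner]
      congr 1
      refine Finset.sum_congr rfl fun i _ => ?_
      rw [inner_sum]
      refine Finset.sum_congr rfl fun j _ => ?_
      rw [real_inner_smul_left, real_inner_smul_right]; ring
    have e2 : ‖x‖ ^ 2 = ((n:ℝ) / (n + 1)) ^ 2 * ∑ i, ∑ j, ⟪w i, x⟫ * ⟪w j, x⟫ * ⟪w i, w j⟫ := by
      nth_rw 1 [hx]
      rw [norm_smul, mul_pow, Real.norm_eq_abs, sq_abs, ← real_inner_self_eq_norm_sq, sum_inner]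
      congr 1
      refine Finset.sum_congr rfl fun i _ => ?_
      rw [inner_sum]
      refine Finset.sum_congr rfl fun j _ => ?_
      rw [real_inner_smul_left, real_inner_smul_right]; ring
    have e3 : |‖M x‖ ^ 2 - ‖x‖ ^ 2| ≤ ((n:ℝ) / (n + 1)) ^ 2 * (θ * (∑ i, |⟪w i, x⟫|) ^ 2) := by
      rw [e1, e2, ← mul_sub, abs_mul, abs_of_nonneg (by positivity)]
      gcongr
      rw [← Finset.sum_sub_distrib, pow_two, Finset.sum_mul, Finset.mul_sum]
      refine (Finset.abs_sum_le_sum_abs _ _).trans (Finset.sum_le_sum fun i _ => ?_)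
      rw [← Finset.sum_sub_distrib, Finset.mul_sum, Finset.mul_sum]
      refine (Finset.abs_sum_le_sum_abs _ _).trans (Finset.sum_le_sum fun j _ => ?_)
      rw [← mul_sub, abs_mul, abs_mul, mul_comm θ]
      gcongr
      exact hd i j
    have e4 : (∑ i, |⟪w i, x⟫|) ^ 2 ≤ (n + 1) * (((n:ℝ) + 1) / n * ‖x‖ ^ 2) := by
      have := sq_sum_le_card_mul_sum_sq (s := Finset.univ) (f := fun i => |⟪w i, x⟫|)
      simp only [sq_abs, Finset.card_univ, Fintype.card_fin] at this
      refine this.trans (le_of_eq ?_)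
      rw [← real_inner_self_eq_norm_sq, ← reg_frame_sq hn hw]
      push_cast
      simp [pow_two]
    refine e3.trans ?_
    calc _ ≤ ((n:ℝ) / (n + 1)) ^ 2 * (θ * ((n + 1) * (((n:ℝ) + 1) / n * ‖x‖ ^ 2))) := by gcongr
      _ = _ := by field_simp
  obtain ⟨R, hR⟩ := near_isometry M (n * θ) hθ1 hnear
  refine ⟨fun i => R (w i), ⟨fun i => by rw [R.norm_map, hw.1], fun i j hij => by
    rw [R.inner_map_map, hw.2 i j hij]⟩, fun i => ?_⟩
  have h1 : M (w i) = u i - (1 / ((n:ℝ) + 1)) • ∑ j, u j := by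
    rw [hMa]
    simp_rw [reg_gram hn hw, sub_smul, Finset.sum_sub_distrib, ite_smul, zero_smul]
    rw [Finset.sum_ite_eq' , ← Finset.smul_sum]
    simp only [Finset.mem_univ, if_true, smul_sub, smul_smul]
    congr 1
    · have : (n:ℝ) / (n + 1) * (1 + 1 / n) = 1 := by field_simp
      rw [this, one_smul]
    · congr 1; field_simp
  have h2 : ‖∑ j, u j‖ ^ 2 ≤ (n + 1) * n * θ := by
    rw [← real_inner_self_eq_norm_sq, sum_inner]
    simp_rw [inner_sum]
    have h3 : ∀ i j, ⟪u i, u j⟫ ≤ (if i = j then 1 + 1 / (n:ℝ) - θ else 0) + (θ - 1 / n) := fun i j => by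
      split_ifs with hij
      · subst hij; rw [real_inner_self_eq_norm_sq, hu]; norm_num
      · have := (abs_le.1 (h i j hij)).2; linarith
    calc _ ≤ ∑ i : Fin (n+1), ∑ j : Fin (n+1), ((if i = j then 1 + 1 / (n:ℝ) - θ else 0) + (θ - 1 / n)) :=
          Finset.sum_le_sum fun i _ => Finset.sum_le_sum fun j _ => h3 i j
      _ = _ := by
          simp [Finset.sum_add_distrib]
          field_simp; ring
  have h4 : ‖u i - M (w i)‖ ≤ √θ := by
    rw [h1, sub_sub_cancel, norm_smul, Real.norm_eq_abs, abs_of_pos (by positivity)]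
    apply Real.le_sqrt_of_sq_le
    rw [mul_pow]
    calc _ ≤ (1 / ((n:ℝ) + 1)) ^ 2 * ((n + 1) * n * θ) := by gcongr
      _ = n / (n + 1) * θ := by field_simp
      _ ≤ 1 * θ := by
          gcongr
          rw [div_le_one (by positivity)]; linarith
      _ = θ := one_mul θ
  calc ‖u i - R (w i)‖ = ‖(u i - M (w i)) + (M (w i) - R (w i))‖ := by rw [sub_add_sub_cancel]
    _ ≤ ‖u i - M (w i)‖ + ‖M (w i) - R (w i)‖ := norm_add_le _ _
    _ ≤ √θ + n * θ * ‖w i‖ := add_le_add h4 (hR _)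
    _ = _ := by rw [hw.1, mul_one]
end

section
variable {n : ℕ}

lemma supp_bdd {K : Set (EuclideanSpace ℝ (Fin n))} (hK : ∀ y ∈ K, ‖y‖ ≤ 1) (x : EuclideanSpace ℝ (Fin n)) :
    BddAbove ((fun y => ⟪x, y⟫) '' K) := by
  refine ⟨‖x‖, ?_⟩
  rintro _ ⟨y, hy, rfl⟩
  have := real_inner_le_norm x y
  have := hK y hy
  have := norm_nonneg x
  simp only
  nlinarith

lemma le_supp {K : Set (EuclideanSpace ℝ (Fin n))} (hK : ∀ y ∈ K, ‖y‖ ≤ 1) (x : EuclideanSpace ℝ (Fin n))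
    {y : EuclideanSpace ℝ (Fin n)} (hy : y ∈ K) : ⟪x, y⟫ ≤ suppFn K x :=
  le_csSup (supp_bdd hK x) ⟨y, hy, rfl⟩

lemma supp_le {K : Set (EuclideanSpace ℝ (Fin n))} (hne : K.Nonempty) {x : EuclideanSpace ℝ (Fin n)} {c : ℝ}
    (h : ∀ y ∈ K, ⟪x, y⟫ ≤ c) : suppFn K x ≤ c := by
  apply csSup_le (hne.image _)
  rintro _ ⟨y, hy, rfl⟩
  exact h y hy

lemma hull_norm_le {A : Set (EuclideanSpace ℝ (Fin n))} (hA : ∀ y ∈ A, ‖y‖ ≤ 1) :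
    ∀ y ∈ convexHull ℝ A, ‖y‖ ≤ 1 := by
  have : convexHull ℝ A ⊆ closedBall 0 1 := convexHull_min (fun y hy => by simpa using hA y hy) (convex_closedBall 0 1)
  intro y hy
  simpa using this hy

lemma hull_inner_le {A : Set (EuclideanSpace ℝ (Fin n))} {x : EuclideanSpace ℝ (Fin n)} {c : ℝ}
    (h : ∀ y ∈ A, ⟪x, y⟫ ≤ c) : ∀ y ∈ convexHull ℝ A, ⟪x, y⟫ ≤ c := by
  have hc : Convex ℝ {y : EuclideanSpace ℝ (Fin n) | ⟪x, y⟫ ≤ c} :=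
    convex_halfSpace_le (innerₛₗ ℝ x).isLinear c
  exact convexHull_min h hc

lemma supp_hull_le {A : Set (EuclideanSpace ℝ (Fin n))} (hne : A.Nonempty) {x : EuclideanSpace ℝ (Fin n)} {c : ℝ}
    (h : ∀ y ∈ A, ⟪x, y⟫ ≤ c) : suppFn (convexHull ℝ A) x ≤ c :=
  supp_le (hne.convexHull) (hull_inner_le h)

lemma supp_lip {K : Set (EuclideanSpace ℝ (Fin n))} (hne : K.Nonempty) (hK : ∀ y ∈ K, ‖y‖ ≤ 1)
    (x z : EuclideanSpace ℝ (Fin n)) : suppFn K x ≤ suppFn K z + ‖x - z‖ := by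
  apply supp_le hne
  intro y hy
  have h1 := le_supp hK z hy
  have h2 : ⟪x, y⟫ = ⟪z, y⟫ + ⟪x - z, y⟫ := by rw [inner_sub_left]; ring
  have h3 := real_inner_le_norm (x - z) y
  have := hK y hy
  have := norm_nonneg (x - z)
  nlinarith

lemma supp_cont {K : Set (EuclideanSpace ℝ (Fin n))} (hne : K.Nonempty) (hK : ∀ y ∈ K, ‖y‖ ≤ 1) :
    Continuous (suppFn K) := by
  have : LipschitzWith 1 (suppFn K) := LipschitzWith.of_dist_le_mul fun x z => by
    rw [Real.dist_eq, dist_eq_norm, NNReal.coe_one, one_mul, abs_le]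
    have h1 := supp_lip hne hK x z
    have h2 := supp_lip hne hK z x
    rw [norm_sub_rev] at h2
    constructor <;> linarith
  exact this.continuous

lemma supp_le_norm {K : Set (EuclideanSpace ℝ (Fin n))} (hne : K.Nonempty) (hK : ∀ y ∈ K, ‖y‖ ≤ 1)
    (x : EuclideanSpace ℝ (Fin n)) : suppFn K x ≤ ‖x‖ := by
  apply supp_le hne
  intro y hy
  have := real_inner_le_norm x y
  have := hK y hy
  have := norm_nonneg x
  nlinarith

lemma supp_smul {K : Set (EuclideanSpace ℝ (Fin n))} (r : ℝ) (hr : 0 ≤ r)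
    (x : EuclideanSpace ℝ (Fin n)) : suppFn K (r • x) = r * suppFn K x := by
  unfold suppFn
  rw [sSup_image', sSup_image', Real.mul_iSup_of_nonneg hr]
  simp only [real_inner_smul_left]

lemma gauge_polar {K : Set (EuclideanSpace ℝ (Fin n))} (hne : K.Nonempty) (hK : ∀ y ∈ K, ‖y‖ ≤ 1)
    (x : EuclideanSpace ℝ (Fin n)) (h0 : 0 ≤ suppFn K x) : gauge (polarSet K) x = suppFn K x := by
  rw [gauge_def']
  have : {r : ℝ | r ∈ Ioi (0:ℝ) ∧ r⁻¹ • x ∈ polarSet K} = {r : ℝ | 0 < r ∧ suppFn K x ≤ r} := by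
    ext r
    simp only [mem_setOf_eq, mem_Ioi, polarSet]
    refine and_congr_right fun hr => ?_
    constructor
    · intro h
      apply supp_le hne
      intro y hy
      have := h y hy
      rw [real_inner_smul_left, inv_mul_le_iff₀ hr] at this
      simpa using this
    · intro h y hy
      rw [real_inner_smul_left, inv_mul_le_iff₀ hr, mul_one]
      exact (le_supp hK x hy).trans h
  rw [this]
  apply le_antisymm
  · apply le_of_forall_pos_le_add
    intro e he
    have hb : ∀ b : ℝ, BddBelow {r : ℝ | 0 < r ∧ b ≤ r} := fun b => ⟨0, fun r hr => hr.1.le⟩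
    apply csInf_le (hb _)
    show 0 < _ ∧ _ ≤ _
    exact ⟨by linarith, by linarith⟩
  · apply le_csInf ⟨suppFn K x + 1, by rw [mem_setOf_eq]; constructor <;> linarith⟩
    exact fun r hr => hr.2

lemma supp_polar {K : Set (EuclideanSpace ℝ (Fin n))} (hc : Convex ℝ K) (h0 : K ∈ nhds 0)
    (x : EuclideanSpace ℝ (Fin n)) : suppFn (polarSet K) x = gauge K x := by
  have habs : Absorbent ℝ K := absorbent_nhds_zero h0
  have hup : ∀ y ∈ polarSet K, ⟪x, y⟫ ≤ gauge K x := by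
    intro y hy
    apply le_of_forall_pos_le_add
    intro e he
    obtain ⟨b, hb, hb2, hb3⟩ := exists_lt_of_gauge_lt habs (show gauge K x < gauge K x + e by linarith)
    obtain ⟨z, hz, rfl⟩ := hb3
    have := hy z hz
    simp only
    rw [real_inner_smul_left, real_inner_comm]
    nlinarith
  have hne : (polarSet K).Nonempty := ⟨0, fun y _ => by simp⟩
  apply le_antisymm (supp_le hne hup)
  have hbdd : BddAbove ((fun y => ⟪x, y⟫) '' polarSet K) := by
    refine ⟨gauge K x, ?_⟩
    rintro _ ⟨y, hy, rfl⟩; exact hup y hy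
  by_contra hcon
  push Not at hcon
  have h00 : 0 ≤ suppFn (polarSet K) x := by
    have : ⟪x, (0 : EuclideanSpace ℝ (Fin n))⟫ ≤ suppFn (polarSet K) x :=
      le_csSup hbdd ⟨0, (fun y _ => by simp : (0 : EuclideanSpace ℝ (Fin n)) ∈ polarSet K), rfl⟩
    rwa [inner_zero_right] at this
  obtain ⟨s, hs1, hs2⟩ := exists_between hcon
  have hs0 : 0 < s := by linarith
  have hnot : s⁻¹ • x ∉ interior K := by
    intro h
    have h1 := gauge_le_one_of_mem (interior_subset h)
    rw [gauge_smul_of_nonneg (by positivity), smul_eq_mul, inv_mul_le_iff₀ hs0] at h1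
    linarith
  obtain ⟨f, hf⟩ := geometric_hahn_banach_open_point hc.interior isOpen_interior hnot
  have hzero : (0 : EuclideanSpace ℝ (Fin n)) ∈ interior K := mem_interior_iff_mem_nhds.2 h0
  have hfp : 0 < f (s⁻¹ • x) := by simpa using hf 0 hzero
  set y := (f (s⁻¹ • x))⁻¹ • (InnerProductSpace.toDual ℝ (EuclideanSpace ℝ (Fin n))).symm f with hy
  have hyi : ∀ z, ⟪y, z⟫ = (f (s⁻¹ • x))⁻¹ * f z := fun z => by
    rw [hy, real_inner_smul_left, InnerProductSpace.toDual_symm_apply]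
  have hyp : y ∈ polarSet K := by
    intro z hz
    have hz2 : z ∈ closure (interior K) := by
      rw [hc.closure_interior_eq_closure_of_nonempty_interior ⟨0, hzero⟩]
      exact subset_closure hz
    have hcl : IsClosed {z : EuclideanSpace ℝ (Fin n) | ⟪y, z⟫ ≤ 1} :=
      isClosed_le (by fun_prop) continuous_const
    refine (closure_minimal ?_ hcl) hz2
    intro z hz
    show ⟪y, z⟫ ≤ 1
    rw [hyi, inv_mul_le_iff₀ hfp, mul_one]
    exact (hf z hz).le
  have h3 : ⟪x, y⟫ = s := by
    have h4 : f (s⁻¹ • x) = s⁻¹ * f x := by simp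
    rw [real_inner_comm, hyi, h4]
    rw [h4] at hfp
    have : f x ≠ 0 := by rintro h; rw [h] at hfp; simp at hfp
    field_simp
  have h5 : ⟪x, y⟫ ≤ suppFn (polarSet K) x := le_csSup hbdd ⟨y, hyp, rfl⟩
  linarith

/-- simplex description -/
lemma simplex_mem (hn : 1 ≤ n) {w : Fin (n + 1) → EuclideanSpace ℝ (Fin n)} (hw : IsRegVerts w)
    (x : EuclideanSpace ℝ (Fin n)) : x ∈ convexHull ℝ (range w) ↔ ∀ j, -(1 / (n:ℝ)) ≤ ⟪w j, x⟫ := by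
  have hn' : (n:ℝ) ≠ 0 := by positivity
  constructor
  · intro hx j
    have := hull_inner_le (A := range w) (x := - w j) (c := 1 / n) (by
      rintro _ ⟨i, rfl⟩
      rw [inner_neg_left, reg_gram hn hw]
      split_ifs
      · have : (0:ℝ) < n := by positivity
        have : 0 < 1 / (n:ℝ) := by positivity
        linarith
      · simp) x hx
    rw [inner_neg_left] at this; linarith
  · intro h
    set l : Fin (n + 1) → ℝ := fun j => (n / (n + 1)) * (⟪w j, x⟫ + 1 / n) with hl
    have hl0 : ∀ j, 0 ≤ l j := fun j => mul_nonneg (by positivity) (by linarith [h j])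
    have hs : ∑ j, ⟪w j, x⟫ = 0 := by rw [← sum_inner, reg_sum hn hw, inner_zero_left]
    have hl1 : ∑ j, l j = 1 := by
      simp only [hl, ← Finset.mul_sum, Finset.sum_add_distrib, hs]
      simp; field_simp
    have hx : ∑ j, l j • w j = x := by
      simp only [hl, mul_smul, add_smul, ← Finset.smul_sum, Finset.sum_add_distrib, reg_sum hn hw, smul_zero, add_zero]
      rw [reg_frame hn hw, smul_smul]
      have : (n:ℝ) / (n + 1) * ((n + 1) / n) = 1 := by field_simp
      rw [this, one_smul]
    rw [← hx]
    exact (convex_convexHull ℝ (range w)).sum_mem (fun j _ => hl0 j) hl1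
      (fun j _ => subset_convexHull ℝ _ (mem_range_self j))

lemma reg_unit {w : Fin (n + 1) → EuclideanSpace ℝ (Fin n)} (hw : IsRegVerts w) :
    ∀ y ∈ range w, ‖y‖ ≤ 1 := by
  rintro _ ⟨i, rfl⟩; rw [hw.1]

lemma reg_exists_ge (hn : 1 ≤ n) {w : Fin (n + 1) → EuclideanSpace ℝ (Fin n)} (hw : IsRegVerts w)
    (x : EuclideanSpace ℝ (Fin n)) : ∃ j, 0 ≤ ⟪w j, x⟫ := by
  by_contra h
  push Not at h
  have hs : ∑ j, ⟪w j, x⟫ = 0 := by rw [← sum_inner, reg_sum hn hw, inner_zero_left]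
  have := Finset.sum_lt_sum_of_nonempty (s := Finset.univ) ⟨0, Finset.mem_univ _⟩ fun j _ => h j
  rw [hs] at this
  simp at this

lemma reg_supp_ge {w : Fin (n + 1) → EuclideanSpace ℝ (Fin n)} (hw : IsRegVerts w)
    (x : EuclideanSpace ℝ (Fin n)) (j : Fin (n + 1)) : ⟪w j, x⟫ ≤ suppFn (convexHull ℝ (range w)) x := by
  rw [real_inner_comm]
  exact le_supp (hull_norm_le (reg_unit hw)) x (subset_convexHull ℝ _ (mem_range_self j))

lemma reg_supp_le {w : Fin (n + 1) → EuclideanSpace ℝ (Fin n)}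
    (x : EuclideanSpace ℝ (Fin n)) (c : ℝ) (h : ∀ j, ⟪w j, x⟫ ≤ c) :
    suppFn (convexHull ℝ (range w)) x ≤ c := by
  apply supp_hull_le (range_nonempty w)
  rintro _ ⟨j, rfl⟩
  rw [real_inner_comm]; exact h j

lemma reg_supp_nonneg (hn : 1 ≤ n) {w : Fin (n + 1) → EuclideanSpace ℝ (Fin n)} (hw : IsRegVerts w)
    (x : EuclideanSpace ℝ (Fin n)) : 0 ≤ suppFn (convexHull ℝ (range w)) x := by
  obtain ⟨j, hj⟩ := reg_exists_ge hn hw x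
  exact hj.trans (reg_supp_ge hw x j)

lemma reg_gauge (hn : 1 ≤ n) {w : Fin (n + 1) → EuclideanSpace ℝ (Fin n)} (hw : IsRegVerts w)
    (x : EuclideanSpace ℝ (Fin n)) :
    gauge (convexHull ℝ (range w)) x = n * suppFn (convexHull ℝ (range w)) (-x) := by
  have hn0 : (0:ℝ) < n := by positivity
  rw [gauge_def']
  have : {r : ℝ | r ∈ Ioi (0:ℝ) ∧ r⁻¹ • x ∈ convexHull ℝ (range w)} =
      {r : ℝ | 0 < r ∧ n * suppFn (convexHull ℝ (range w)) (-x) ≤ r} := by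
    ext r
    simp only [mem_setOf_eq, mem_Ioi, simplex_mem hn hw]
    refine and_congr_right fun hr => ?_
    rw [← le_div_iff₀' hn0]
    constructor
    · intro h
      apply reg_supp_le
      intro j
      have := h j
      rw [real_inner_smul_right, le_inv_mul_iff₀ hr] at this
      rw [inner_neg_right]
      have e : r * -(1 / (n:ℝ)) = - (r / n) := by ring
      rw [e] at this; linarith
    · intro h j
      have := (reg_supp_ge hw (-x) j).trans h
      rw [real_inner_smul_right, le_inv_mul_iff₀ hr]
      rw [inner_neg_right] at this
      have e : r * -(1 / (n:ℝ)) = - (r / n) := by ring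
      rw [e]; linarith
  rw [this]
  have h0 := mul_nonneg hn0.le (reg_supp_nonneg hn hw (-x))
  apply le_antisymm
  · apply le_of_forall_pos_le_add
    intro e he
    have hb : ∀ b : ℝ, BddBelow {r : ℝ | 0 < r ∧ b ≤ r} := fun b => ⟨0, fun r hr => hr.1.le⟩
    apply csInf_le (hb _)
    show 0 < _ ∧ _ ≤ _
    exact ⟨by linarith, by linarith⟩
  · apply le_csInf ⟨n * suppFn (convexHull ℝ (range w)) (-x) + 1, by rw [mem_setOf_eq]; constructor <;> linarith⟩
    exact fun r hr => hr.2
end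

section
variable {n : ℕ} {ι : Type*} [Fintype ι]

/-- a centred finite frame contains the ball of radius `1/n` in its convex hull -/
lemma frame_ball (hn : 1 ≤ n) (c : ι → ℝ) (u : ι → EuclideanSpace ℝ (Fin n)) (hc : ∀ i, 0 ≤ c i)
    (hu : ∀ i, ‖u i‖ = 1) (hsum : ∑ i, c i = n) (hfr : ∀ x, ∑ i, (c i * ⟪u i, x⟫) • u i = x)
    (hcen : ∑ i, c i • u i = 0) (y : EuclideanSpace ℝ (Fin n)) (hy : ‖y‖ ≤ 1 / n) :
    y ∈ convexHull ℝ (range u) := by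
  have hn0 : (0:ℝ) < n := by positivity
  set l : ι → ℝ := fun i => c i * (1 / n + ⟪u i, y⟫) with hl
  have hl0 : ∀ i, 0 ≤ l i := fun i => by
    refine mul_nonneg (hc i) ?_
    have := (abs_le.1 (abs_real_inner_le_norm (u i) y)).1
    rw [hu, one_mul] at this
    linarith
  have hl1 : ∑ i, l i = 1 := by
    simp only [hl, mul_add, Finset.sum_add_distrib, ← Finset.sum_mul, hsum]
    have : ∑ i, c i * ⟪u i, y⟫ = 0 := by
      have := congrArg (fun z => ⟪z, y⟫) hcen
      simpa [sum_inner, real_inner_smul_left] using this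
    rw [this]; field_simp; ring
  have hx : ∑ i, l i • u i = y := by
    simp only [hl, mul_add, add_smul, Finset.sum_add_distrib, hfr]
    have : ∑ i, (c i * (1 / (n:ℝ))) • u i = (1 / (n:ℝ)) • ∑ i, c i • u i := by
      rw [Finset.smul_sum]
      exact Finset.sum_congr rfl fun i _ => by rw [smul_smul, mul_comm]
    rw [this, hcen]; simp
  rw [← hx]
  exact (convex_convexHull ℝ (range u)).sum_mem (fun j _ => hl0 j) hl1
    (fun j _ => subset_convexHull ℝ _ (mem_range_self j))

/-- polarization of the frame identity -/
lemma frame_of_sq (c : ι → ℝ) (u : ι → EuclideanSpace ℝ (Fin n))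
    (hiso : ∀ x, ∑ i, c i * ⟪u i, x⟫ ^ 2 = ‖x‖ ^ 2) (x : EuclideanSpace ℝ (Fin n)) :
    ∑ i, (c i * ⟪u i, x⟫) • u i = x := by
  have h : ∀ x y, ∑ i, c i * (⟪u i, x⟫ * ⟪u i, y⟫) = ⟪x, y⟫ := by
    intro x y
    have h1 := hiso (x + y)
    rw [norm_add_sq_real, ← hiso x, ← hiso y] at h1
    have h2 : ∑ i, c i * ⟪u i, x + y⟫ ^ 2 = ∑ i, c i * ⟪u i, x⟫ ^ 2 +
        2 * ∑ i, c i * (⟪u i, x⟫ * ⟪u i, y⟫) + ∑ i, c i * ⟪u i, y⟫ ^ 2 := by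
      rw [Finset.mul_sum, ← Finset.sum_add_distrib, ← Finset.sum_add_distrib]
      exact Finset.sum_congr rfl fun i _ => by rw [inner_add_right]; ring
    linarith
  apply ext_inner_right ℝ
  intro y
  rw [sum_inner, ← h x y]
  exact Finset.sum_congr rfl fun i _ => by rw [real_inner_smul_left]; ring
end

section
variable {m : ℕ} {ι : Type*} [Fintype ι]

def kap : ℝ := (1/600) ^ 2 / (4 * 14 ^ 2)

lemma ball_slab (u : ι → EuclideanSpace ℝ (Fin m)) (hu : ∀ i, ‖u i‖ = 1)
    (x0 : EuclideanSpace ℝ (Fin m)) (h0 : ∀ i, ⟪u i, x0⟫ = 1/2) :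
    ∀ x ∈ ball x0 (1/4), ∀ i, ⟪u i, x⟫ ∈ Icc (1/4 : ℝ) (3/4) := by
  intro x hx i
  rw [mem_ball, dist_eq_norm] at hx
  have h1 := abs_real_inner_le_norm (u i) (x - x0)
  rw [hu, one_mul, inner_sub_right, h0, abs_le] at h1
  constructor <;> linarith [h1.1, h1.2]

lemma coreC_plain (c : ι → ℝ) (u : ι → EuclideanSpace ℝ (Fin m)) (hc : ∀ i, 0 ≤ c i)
    (hu : ∀ i, ‖u i‖ = 1) (hiso : ∀ x, ∑ i, c i * ⟪u i, x⟫ ^ 2 = ‖x‖ ^ 2) (t : ℝ) :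
    (gaussianM m).real {x | ∀ i, ⟪u i, x⟫ < t} ≤ Phi t ^ m := by
  have hPt := Phi_pos t
  have hlt : ∀ s ∈ Iio t, 1 / Phi t * Phi s < 1 := fun s hs => by
    rw [one_div_mul_eq_div, div_lt_one hPt]; exact Phi_strictMono hs
  obtain ⟨h1, h2⟩ := trans_gen (1 / Phi t) (by positivity) (Iio t) hlt
  have h := core_transport c u hc hu hiso _ _ (Iio t) ∅ isOpen_Iio (1 / Phi t) 0 1 (by positivity)
    h1 le_rfl one_pos h2 (fun _ _ => rfl) (empty_subset _) (by simp) (by simp) ∅ MeasurableSet.empty (by simp)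
  have h3 := h.trans measureReal_le_one
  simp only [mem_Iio, ne_eq, OfNat.ofNat_ne_zero, not_false_eq_true, zero_pow, zero_div, zero_mul, add_zero,
    one_div, inv_pow] at h3
  rwa [inv_mul_le_iff₀ (by positivity), mul_one] at h3

lemma coreC (c : ι → ℝ) (u : ι → EuclideanSpace ℝ (Fin m)) (hc : ∀ i, 0 ≤ c i)
    (hu : ∀ i, ‖u i‖ = 1) (hiso : ∀ x, ∑ i, c i * ⟪u i, x⟫ ^ 2 = ‖x‖ ^ 2)
    (x0 : EuclideanSpace ℝ (Fin m)) (h0 : ∀ i, ⟪u i, x0⟫ = 1/2) (t : ℝ) (ht1 : 1 ≤ t) (ht2 : t ≤ 2) :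
    (gaussianM m).real {x | ∀ i, ⟪u i, x⟫ < t} + kap * ∫ x in ball x0 (1/4), qForm c u x ∂(gaussianM m)
      ≤ Phi t ^ m := by
  have hPt := Phi_pos t
  obtain ⟨T, T', h1, h2, h3, h4, h5⟩ := transC t ht1 ht2
  have h := core_transport c u hc hu hiso T T' (Iio t) (Icc (1/4) (3/4)) isOpen_Iio (1 / Phi t) (1/600) 14
    (by positivity) h1 (by norm_num) (by norm_num) h2 h3 (fun s hs => by rw [mem_Iio]; linarith [hs.2])
    h4 h5 (ball x0 (1/4)) measurableSet_ball (ball_slab u hu x0 h0)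
  have h3 := h.trans measureReal_le_one
  simp only [mem_Iio] at h3
  rw [one_div (Phi t), inv_pow, inv_mul_le_iff₀ (by positivity), mul_one] at h3
  exact h3

lemma coreA_plain (c : ι → ℝ) (u : ι → EuclideanSpace ℝ (Fin m)) (hc : ∀ i, 0 ≤ c i)
    (hu : ∀ i, ‖u i‖ = 1) (hiso : ∀ x, ∑ i, c i * ⟪u i, x⟫ ^ 2 = ‖x‖ ^ 2) (t : ℝ)
    (G : Set (EuclideanSpace ℝ (Fin m)))
    (hG : ∀ T : ℝ → ℝ, (∀ s, T s ≤ t) → ∀ x, thMap c u T x ∈ G) :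
    Phi t ^ m ≤ (gaussianM m).real G := by
  have hPt := Phi_pos t
  have hPt1 := Phi_lt_one t
  have hlt : ∀ s ∈ (univ : Set ℝ), Phi t * Phi s < 1 := fun s hs => by
    have := Phi_lt_one s; have := Phi_pos s; nlinarith
  obtain ⟨h1, h2⟩ := trans_gen (Phi t) hPt univ hlt
  have h := core_transport c u hc hu hiso _ _ univ ∅ isOpen_univ (Phi t) 0 1 hPt
    h1 le_rfl one_pos h2 (fun _ _ => rfl) (empty_subset _) (by simp) (by simp) ∅ MeasurableSet.empty (by simp)
  simp only [mem_univ, implies_true, setOf_true, probReal_univ, ne_eq, OfNat.ofNat_ne_zero, not_false_eq_true, zero_pow, zero_div, zero_mul, add_zero, mul_one] at h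
  refine h.trans (measureReal_mono ?_)
  rintro _ ⟨x, -, rfl⟩
  refine hG _ (fun s => ?_) x
  rw [← Phi_strictMono.le_iff_le, Phi_PhiInv (mul_pos hPt (Phi_pos s)) (hlt s trivial)]
  have := Phi_lt_one s
  nlinarith

lemma coreA (c : ι → ℝ) (u : ι → EuclideanSpace ℝ (Fin m)) (hc : ∀ i, 0 ≤ c i)
    (hu : ∀ i, ‖u i‖ = 1) (hiso : ∀ x, ∑ i, c i * ⟪u i, x⟫ ^ 2 = ‖x‖ ^ 2)
    (x0 : EuclideanSpace ℝ (Fin m)) (h0 : ∀ i, ⟪u i, x0⟫ = 1/2) (t : ℝ) (ht1 : 1 ≤ t) (ht2 : t ≤ 2)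
    (G : Set (EuclideanSpace ℝ (Fin m)))
    (hG : ∀ T : ℝ → ℝ, (∀ s, T s ≤ t) → ∀ x, thMap c u T x ∈ G) :
    Phi t ^ m + (1/2) ^ m * (kap * ∫ x in ball x0 (1/4), qForm c u x ∂(gaussianM m))
      ≤ (gaussianM m).real G := by
  have hPt := Phi_pos t
  obtain ⟨T, T', h1, h2, h3, h4, h5, h6⟩ := transA t ht1 ht2
  have h := core_transport c u hc hu hiso T T' univ (Icc (1/4) (3/4)) isOpen_univ (Phi t) (1/600) 14
    (by positivity) (h1.strictMonoOn _) (by norm_num) (by norm_num) (fun s _ => h2 s) (fun s _ => h3 s) (subset_univ _)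
    h4 h5 (ball x0 (1/4)) measurableSet_ball (ball_slab u hu x0 h0)
  simp only [mem_univ, implies_true, setOf_true, probReal_univ] at h
  have h7 : (gaussianM m).real (thMap c u T '' univ) ≤ (gaussianM m).real G := by
    refine (measureReal_mono ?_)
    rintro _ ⟨x, -, rfl⟩
    exact hG T h6 x
  refine le_trans ?_ (h.trans h7)
  change _ ≤ Phi t ^ m * (1 + kap * _)
  rw [mul_add, mul_one]
  have hq : 0 ≤ kap * ∫ x in ball x0 (1/4), qForm c u x ∂(gaussianM m) :=
    mul_nonneg (by unfold kap; positivity) (integral_nonneg fun x => qForm_nonneg c u hc x)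
  have : (1/2:ℝ)^m ≤ Phi t ^ m := pow_le_pow_left₀ (by norm_num) (Phi_half (by linarith)) m
  nlinarith
end

section
variable {Ω : Type*} [MeasurableSpace Ω] {P : Measure Ω} [IsProbabilityMeasure P]

lemma lay_pos (f : Ω → ℝ) (hf : Measurable f) (h : Integrable f P) :
    ENNReal.ofReal (∫ x, max (f x) 0 ∂P) = ∫⁻ t in Ioi (0:ℝ), P {x | t ≤ f x} := by
  rw [ofReal_integral_eq_lintegral_ofReal h.pos_part (Filter.Eventually.of_forall fun x => le_max_right (f x) (0:ℝ)),
    lintegral_eq_lintegral_meas_le P (Filter.Eventually.of_forall fun x => le_max_right (f x) (0:ℝ)) (hf.max measurable_const).aemeasurable]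
  refine setLIntegral_congr_fun measurableSet_Ioi fun t ht => ?_
  congr 1
  ext x
  simp only [mem_setOf_eq, le_max_iff]
  rw [mem_Ioi] at ht
  constructor
  · rintro (h | h)
    · exact h
    · linarith
  · exact fun h => Or.inl h

lemma lay_pos' (f : Ω → ℝ) (hf : Measurable f) (h : Integrable f P) :
    ENNReal.ofReal (∫ x, max (f x) 0 ∂P) = ∫⁻ t in Ioi (0:ℝ), P {x | t < f x} := by
  rw [ofReal_integral_eq_lintegral_ofReal h.pos_part (Filter.Eventually.of_forall fun x => le_max_right (f x) (0:ℝ)),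
    lintegral_eq_lintegral_meas_lt P (Filter.Eventually.of_forall fun x => le_max_right (f x) (0:ℝ)) (hf.max measurable_const).aemeasurable]
  refine setLIntegral_congr_fun measurableSet_Ioi fun t ht => ?_
  congr 1
  ext x
  simp only [mem_setOf_eq, lt_max_iff]
  rw [mem_Ioi] at ht
  constructor
  · rintro (h | h)
    · exact h
    · linarith
  · exact fun h => Or.inl h

lemma int_parts (f : Ω → ℝ) (h : Integrable f P) :
    ∫ x, f x ∂P = ∫ x, max (f x) 0 ∂P - ∫ x, max (- f x) 0 ∂P := by
  rw [← integral_sub h.pos_part h.neg_part]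
  refine integral_congr_ae (Filter.Eventually.of_forall fun x => ?_)
  simp only
  rcases le_total (f x) 0 with h | h
  · rw [max_eq_right h, max_eq_left (by linarith)]; ring
  · rw [max_eq_left h, max_eq_right (by linarith)]; ring

lemma lay_aux (δ : ℝ) (a b : ℝ → ℝ≥0∞) (hm : AEMeasurable b (volume.restrict (Ioi (0:ℝ))))
    (h1 : ∀ t, b t ≤ a t) (h2 : ∀ t ∈ Icc (1:ℝ) 2, b t + ENNReal.ofReal δ ≤ a t) :
    (∫⁻ t in Ioi (0:ℝ), b t) + ENNReal.ofReal δ ≤ ∫⁻ t in Ioi (0:ℝ), a t := by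
  have e : ENNReal.ofReal δ = ∫⁻ t in Ioi (0:ℝ), (Icc (1:ℝ) 2).indicator (fun _ => ENNReal.ofReal δ) t := by
    rw [lintegral_indicator measurableSet_Icc, Measure.restrict_restrict measurableSet_Icc,
      inter_eq_left.2 (show Icc (1:ℝ) 2 ⊆ Ioi 0 from fun x hx => lt_of_lt_of_le one_pos hx.1)]
    simp
    norm_num
  rw [e, ← lintegral_add_left' hm]
  refine lintegral_mono fun t => ?_
  simp only
  by_cases ht : t ∈ Icc (1:ℝ) 2
  · rw [indicator_of_mem ht]; exact h2 t ht
  · rw [indicator_of_notMem ht, add_zero]; exact h1 t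

/-- layer-cake comparison with strict sublevel sets -/
lemma layer_lt (f g : Ω → ℝ) (hf : Measurable f) (hg : Measurable g) (hfi : Integrable f P) (hgi : Integrable g P)
    (δ : ℝ) (hδ : 0 ≤ δ) (h1 : ∀ t, P.real {x | f x < t} ≤ P.real {x | g x < t})
    (h2 : ∀ t, 1 ≤ t → t ≤ 2 → P.real {x | f x < t} + δ ≤ P.real {x | g x < t}) :
    ∫ x, g x ∂P + δ ≤ ∫ x, f x ∂P := by
  have hmx : ∀ h : Ω → ℝ, 0 ≤ ∫ x, max (h x) 0 ∂P := fun h => integral_nonneg fun x => le_max_right (h x) (0:ℝ)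
  have hcm : ∀ (h : Ω → ℝ), Measurable h → ∀ t, P.real {x | t ≤ h x} = 1 - P.real {x | h x < t} := by
    intro h hh t
    rw [← probReal_compl_eq_one_sub (by measurability)]
    congr 1; ext x; simp
  have hpos : ∫ x, max (g x) 0 ∂P + δ ≤ ∫ x, max (f x) 0 ∂P := by
    rw [← ENNReal.ofReal_le_ofReal_iff (hmx _),
      ENNReal.ofReal_add (hmx _) hδ, lay_pos f hf hfi, lay_pos g hg hgi]
    apply lay_aux
    · refine Antitone.measurable (fun s t hst => measure_mono fun x hx => ?_) |>.aemeasurable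
      simp only [mem_setOf_eq] at hx ⊢
      linarith
    · intro t
      rw [← ofReal_measureReal, ← ofReal_measureReal, hcm f hf, hcm g hg]
      exact ENNReal.ofReal_le_ofReal (by linarith [h1 t])
    · intro t ht
      rw [← ofReal_measureReal, ← ofReal_measureReal, ← ENNReal.ofReal_add (by positivity) hδ, hcm f hf, hcm g hg]
      exact ENNReal.ofReal_le_ofReal (by linarith [h2 t ht.1 ht.2])
  have hneg : ∫ x, max (- f x) 0 ∂P ≤ ∫ x, max (- g x) 0 ∂P := by
    rw [← ENNReal.ofReal_le_ofReal_iff (hmx _),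
      lay_pos' (fun x => - f x) hf.neg hfi.neg, lay_pos' (fun x => - g x) hg.neg hgi.neg]
    refine lintegral_mono fun t => ?_
    have e : ∀ h : Ω → ℝ, {x | t < - h x} = {x | h x < - t} := by
      intro h; ext x; simp only [mem_setOf_eq]; constructor <;> intro h <;> linarith
    rw [e f, e g, ← ofReal_measureReal, ← ofReal_measureReal]
    exact ENNReal.ofReal_le_ofReal (h1 _)
  rw [int_parts f hfi, int_parts g hgi]
  linarith

lemma layer_le (f g : Ω → ℝ) (hf : Measurable f) (hg : Measurable g) (hfi : Integrable f P) (hgi : Integrable g P)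
    (δ : ℝ) (hδ : 0 ≤ δ) (h1 : ∀ t, P.real {x | f x ≤ t} ≤ P.real {x | g x ≤ t})
    (h2 : ∀ t, 1 ≤ t → t ≤ 2 → P.real {x | f x ≤ t} + δ ≤ P.real {x | g x ≤ t}) :
    ∫ x, g x ∂P + δ ≤ ∫ x, f x ∂P := by
  have hmx : ∀ h : Ω → ℝ, 0 ≤ ∫ x, max (h x) 0 ∂P := fun h => integral_nonneg fun x => le_max_right (h x) (0:ℝ)
  have hcm : ∀ (h : Ω → ℝ), Measurable h → ∀ t, P.real {x | t < h x} = 1 - P.real {x | h x ≤ t} := by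
    intro h hh t
    rw [← probReal_compl_eq_one_sub (by measurability)]
    congr 1; ext x; simp
  have hpos : ∫ x, max (g x) 0 ∂P + δ ≤ ∫ x, max (f x) 0 ∂P := by
    rw [← ENNReal.ofReal_le_ofReal_iff (hmx _),
      ENNReal.ofReal_add (hmx _) hδ, lay_pos' f hf hfi, lay_pos' g hg hgi]
    apply lay_aux
    · refine Antitone.measurable (fun s t hst => measure_mono fun x hx => ?_) |>.aemeasurable
      simp only [mem_setOf_eq] at hx ⊢
      linarith
    · intro t
      rw [← ofReal_measureReal, ← ofReal_measureReal, hcm f hf, hcm g hg]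
      exact ENNReal.ofReal_le_ofReal (by linarith [h1 t])
    · intro t ht
      rw [← ofReal_measureReal, ← ofReal_measureReal, ← ENNReal.ofReal_add (by positivity) hδ, hcm f hf, hcm g hg]
      exact ENNReal.ofReal_le_ofReal (by linarith [h2 t ht.1 ht.2])
  have hneg : ∫ x, max (- f x) 0 ∂P ≤ ∫ x, max (- g x) 0 ∂P := by
    rw [← ENNReal.ofReal_le_ofReal_iff (hmx _),
      lay_pos (fun x => - f x) hf.neg hfi.neg, lay_pos (fun x => - g x) hg.neg hgi.neg]
    refine lintegral_mono fun t => ?_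
    have e : ∀ h : Ω → ℝ, {x | t ≤ - h x} = {x | h x ≤ - t} := by
      intro h; ext x; simp only [mem_setOf_eq]; constructor <;> intro h <;> linarith
    rw [e f, e g, ← ofReal_measureReal, ← ofReal_measureReal]
    exact ENNReal.ofReal_le_ofReal (h1 _)
  rw [int_parts f hfi, int_parts g hgi]
  linarith

end

section
variable {n : ℕ}

/-- convex sets between the ball of radius `1/n` and the unit ball -/
def GoodBody (Z : Set (EuclideanSpace ℝ (Fin n))) : Prop :=
  Convex ℝ Z ∧ closedBall 0 (1 / (n:ℝ)) ⊆ Z ∧ ∀ y ∈ Z, ‖y‖ ≤ 1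

lemma GoodBody.nhds {Z : Set (EuclideanSpace ℝ (Fin n))} (hn : 1 ≤ n) (h : GoodBody Z) : Z ∈ nhds 0 :=
  Filter.mem_of_superset (closedBall_mem_nhds _ (by positivity)) h.2.1

lemma GoodBody.zero {Z : Set (EuclideanSpace ℝ (Fin n))} (h : GoodBody Z) : (0 : EuclideanSpace ℝ (Fin n)) ∈ Z :=
  h.2.1 (by simp)

lemma GoodBody.ne {Z : Set (EuclideanSpace ℝ (Fin n))} (h : GoodBody Z) : Z.Nonempty := ⟨0, h.zero⟩

lemma GoodBody.supp_nonneg {Z : Set (EuclideanSpace ℝ (Fin n))} (h : GoodBody Z) (x : EuclideanSpace ℝ (Fin n)) :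
    0 ≤ suppFn Z x := by
  have := le_supp h.2.2 x h.zero
  rwa [inner_zero_right] at this

lemma GoodBody.gauge_cont {Z : Set (EuclideanSpace ℝ (Fin n))} (hn : 1 ≤ n) (h : GoodBody Z) :
    Continuous (gauge Z) := continuous_gauge h.1 (h.nhds hn)

lemma GoodBody.gauge_le {Z : Set (EuclideanSpace ℝ (Fin n))} (hn : 1 ≤ n) (h : GoodBody Z)
    (x : EuclideanSpace ℝ (Fin n)) : gauge Z x ≤ n * ‖x‖ := by
  have h1 : gauge Z x ≤ gauge (closedBall 0 (1 / (n:ℝ))) x :=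
    gauge_mono (absorbent_nhds_zero (closedBall_mem_nhds _ (by positivity))) h.2.1 x
  rw [gauge_closedBall (by positivity)] at h1
  refine h1.trans (le_of_eq ?_)
  field_simp

lemma GoodBody.supp_int {Z : Set (EuclideanSpace ℝ (Fin n))} (h : GoodBody Z) :
    Integrable (suppFn Z) (gaussianM n) := by
  refine (gauss_int_norm n).mono' (supp_cont h.ne h.2.2).aestronglyMeasurable (Filter.Eventually.of_forall fun x => ?_)
  rw [Real.norm_of_nonneg (h.supp_nonneg x)]
  exact supp_le_norm h.ne h.2.2 x

lemma GoodBody.gauge_int {Z : Set (EuclideanSpace ℝ (Fin n))} (hn : 1 ≤ n) (h : GoodBody Z) :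
    Integrable (gauge Z) (gaussianM n) := by
  refine ((gauss_int_norm n).const_mul n).mono' (h.gauge_cont hn).aestronglyMeasurable (Filter.Eventually.of_forall fun x => ?_)
  rw [Real.norm_of_nonneg (gauge_nonneg x)]
  exact h.gauge_le hn x

lemma GoodBody.mono_hull {A B : Set (EuclideanSpace ℝ (Fin n))} (hA : GoodBody (convexHull ℝ A)) (hAB : A ⊆ B)
    (hB : ∀ y ∈ B, ‖y‖ ≤ 1) : GoodBody (convexHull ℝ B) :=
  ⟨convex_convexHull _ _, hA.2.1.trans (convexHull_mono hAB), hull_norm_le hB⟩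

lemma GoodBody.supp_mono {Z W : Set (EuclideanSpace ℝ (Fin n))} (h : GoodBody Z) (hW : GoodBody W) (hZW : Z ⊆ W)
    (x : EuclideanSpace ℝ (Fin n)) : suppFn Z x ≤ suppFn W x :=
  supp_le h.ne fun _ hy => le_supp hW.2.2 x (hZW hy)

/-- lift of a vector to `ℝ^(n+1)` -/
def liftV (w : Fin (n + 1) → EuclideanSpace ℝ (Fin n)) (u : EuclideanSpace ℝ (Fin n)) :
    EuclideanSpace ℝ (Fin (n + 1)) := WithLp.toLp 2 fun k => (n * ⟪w k, u⟫ + 1) / (n + 1)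

def sqn (n : ℕ) : ℝ := √((n:ℝ) / (n + 1))

lemma sqn_sq (n : ℕ) : sqn n * sqn n = n / (n + 1) := Real.mul_self_sqrt (by positivity)
lemma sqn_nonneg (n : ℕ) : 0 ≤ sqn n := Real.sqrt_nonneg _
lemma sqn_pos (hn : 1 ≤ n) : 0 < sqn n := Real.sqrt_pos.2 (by positivity)
lemma sqn_le_one (n : ℕ) : sqn n ≤ 1 := by
  unfold sqn
  rw [Real.sqrt_le_one, div_le_one (by positivity)]
  linarith

def projW (w : Fin (n + 1) → EuclideanSpace ℝ (Fin n)) :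
    EuclideanSpace ℝ (Fin (n + 1)) →L[ℝ] EuclideanSpace ℝ (Fin n) :=
  sqn n • ∑ k, (EuclideanSpace.proj k : EuclideanSpace ℝ (Fin (n + 1)) →L[ℝ] ℝ).smulRight (w k)

lemma projW_apply (w : Fin (n + 1) → EuclideanSpace ℝ (Fin n)) (x : EuclideanSpace ℝ (Fin (n + 1))) :
    projW w x = sqn n • ∑ k, x k • w k := by
  simp [projW]

lemma projW_inner (w : Fin (n + 1) → EuclideanSpace ℝ (Fin n)) (x : EuclideanSpace ℝ (Fin (n + 1)))
    (y : EuclideanSpace ℝ (Fin n)) : ⟪projW w x, y⟫ = sqn n * ∑ k, x k * ⟪w k, y⟫ := by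
  rw [projW_apply, real_inner_smul_left, sum_inner]
  simp only [real_inner_smul_left]

lemma inner_coord {m : ℕ} (x y : EuclideanSpace ℝ (Fin m)) : ⟪x, y⟫ = ∑ k, x k * y k := by
  rw [PiLp.inner_apply]
  exact Finset.sum_congr rfl fun k _ => by simp [mul_comm]

lemma lift_inner_x (w : Fin (n + 1) → EuclideanSpace ℝ (Fin n)) (u : EuclideanSpace ℝ (Fin n))
    (x : EuclideanSpace ℝ (Fin (n + 1))) :
    ⟪liftV w u, x⟫ = (∑ k, x k) / (n + 1) + sqn n * ⟪projW w x, u⟫ := by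
  rw [projW_inner, ← mul_assoc, sqn_sq, inner_coord, Finset.sum_div, Finset.mul_sum, ← Finset.sum_add_distrib]
  refine Finset.sum_congr rfl fun k _ => ?_
  simp only [liftV]
  field_simp
  ring

lemma reg_inner_sum (hn : 1 ≤ n) {w : Fin (n + 1) → EuclideanSpace ℝ (Fin n)} (hw : IsRegVerts w)
    (u : EuclideanSpace ℝ (Fin n)) : ∑ k, ⟪w k, u⟫ = 0 := by
  rw [← sum_inner, reg_sum hn hw, inner_zero_left]

lemma lift_sum (hn : 1 ≤ n) {w : Fin (n + 1) → EuclideanSpace ℝ (Fin n)} (hw : IsRegVerts w)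
    (u : EuclideanSpace ℝ (Fin n)) : ∑ k, liftV w u k = 1 := by
  simp only [liftV, ← Finset.sum_div, Finset.sum_add_distrib, ← Finset.mul_sum, reg_inner_sum hn hw]
  have : (n:ℝ) + 1 ≠ 0 := by positivity
  simp [this]

lemma projW_lift (hn : 1 ≤ n) {w : Fin (n + 1) → EuclideanSpace ℝ (Fin n)} (hw : IsRegVerts w)
    (u : EuclideanSpace ℝ (Fin n)) : projW w (liftV w u) = sqn n • u := by
  rw [projW_apply]
  congr 1
  have : ∀ k, liftV w u k • w k = (n / (n + 1) : ℝ) • (⟪w k, u⟫ • w k) + (1 / (n + 1) : ℝ) • w k := by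
    intro k
    rw [smul_smul, ← add_smul]
    congr 1
    simp only [liftV]; field_simp
  simp only [this, Finset.sum_add_distrib, ← Finset.smul_sum, reg_sum hn hw, reg_frame hn hw]
  rw [smul_zero, add_zero, smul_smul]
  have : (n:ℝ) / (n + 1) * ((n + 1) / n) = 1 := by field_simp
  rw [this, one_smul]

lemma lift_inner (hn : 1 ≤ n) {w : Fin (n + 1) → EuclideanSpace ℝ (Fin n)} (hw : IsRegVerts w)
    (u v : EuclideanSpace ℝ (Fin n)) : ⟪liftV w u, liftV w v⟫ = (n * ⟪u, v⟫ + 1) / (n + 1) := by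
  rw [lift_inner_x, lift_sum hn hw, projW_lift hn hw, real_inner_smul_left, ← mul_assoc, sqn_sq, real_inner_comm]
  ring

lemma lift_norm (hn : 1 ≤ n) {w : Fin (n + 1) → EuclideanSpace ℝ (Fin n)} (hw : IsRegVerts w)
    (u : EuclideanSpace ℝ (Fin n)) (hu : ‖u‖ = 1) : ‖liftV w u‖ = 1 := by
  have h := lift_inner hn hw u u
  rw [real_inner_self_eq_norm_sq, real_inner_self_eq_norm_sq, hu] at h
  have h2 : ‖liftV w u‖ ^ 2 = 1 := by rw [h]; field_simp
  nlinarith [norm_nonneg (liftV w u)]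

lemma projW_norm (hn : 1 ≤ n) {w : Fin (n + 1) → EuclideanSpace ℝ (Fin n)} (hw : IsRegVerts w)
    (x : EuclideanSpace ℝ (Fin (n + 1))) : ‖projW w x‖ ^ 2 = ‖x‖ ^ 2 - (∑ k, x k) ^ 2 / (n + 1) := by
  have h0 : ∀ k, ⟪w k, projW w x⟫ = sqn n * ((1 + 1 / n) * x k - (∑ j, x j) / n) := by
    intro k
    rw [real_inner_comm, projW_inner]
    congr 1
    simp only [reg_gram hn hw, mul_sub, Finset.sum_sub_distrib, mul_ite, mul_zero]
    simp [Finset.sum_div]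
    simp only [div_eq_mul_inv]
    ring
  rw [← real_inner_self_eq_norm_sq, projW_inner]
  simp only [h0]
  have : ∑ k, x k * (sqn n * ((1 + 1 / n) * x k - (∑ j, x j) / n)) =
      sqn n * ((1 + 1 / n) * ∑ k, x k * x k - (∑ j, x j) / n * ∑ k, x k) := by
    rw [Finset.mul_sum, Finset.mul_sum, ← Finset.sum_sub_distrib, Finset.mul_sum]
    exact Finset.sum_congr rfl fun k _ => by ring
  rw [this, ← mul_assoc, sqn_sq, ← real_inner_self_eq_norm_sq, inner_coord x x]
  have hn' : (n:ℝ) ≠ 0 := by positivity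
  field_simp

lemma projW_map (hn : 1 ≤ n) {w : Fin (n + 1) → EuclideanSpace ℝ (Fin n)} (hw : IsRegVerts w) :
    (gaussianM (n + 1)).map (projW w) = gaussianM n := by
  refine gauss_map n (n + 1) (projW w) (fun y => WithLp.toLp 2 fun k => sqn n * ⟪w k, y⟫) (fun x y => ?_) (fun y => ?_)
  · rw [projW_inner, inner_coord, Finset.mul_sum]
    exact Finset.sum_congr rfl fun k _ => by simp only []; ring
  · have h : ‖(WithLp.toLp 2 fun k => sqn n * ⟪w k, y⟫ : EuclideanSpace ℝ (Fin (n+1)))‖ ^ 2 = ‖y‖ ^ 2 := by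
      rw [← real_inner_self_eq_norm_sq, inner_coord]
      simp only
      have := congrArg (fun z => ⟪z, y⟫) (reg_frame hn hw y)
      simp only [sum_inner, real_inner_smul_left, real_inner_self_eq_norm_sq] at this
      have e : ∑ k, sqn n * ⟪w k, y⟫ * (sqn n * ⟪w k, y⟫) = (sqn n * sqn n) * ∑ k, ⟪w k, y⟫ * ⟪w k, y⟫ := by
        rw [Finset.mul_sum]; exact Finset.sum_congr rfl fun k _ => by ring
      rw [e, this, sqn_sq]
      field_simp
    have h1 := norm_nonneg y
    have h2 := norm_nonneg (WithLp.toLp 2 fun k => sqn n * ⟪w k, y⟫ : EuclideanSpace ℝ (Fin (n+1)))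
    exact (sq_eq_sq₀ h2 h1).1 h

variable {ι : Type*} [Fintype ι]

lemma lift_iso (hn : 1 ≤ n) {w : Fin (n + 1) → EuclideanSpace ℝ (Fin n)} (hw : IsRegVerts w)
    (c : ι → ℝ) (u : ι → EuclideanSpace ℝ (Fin n)) (hsum : ∑ i, c i = n)
    (hiso : ∀ x, ∑ i, c i * ⟪u i, x⟫ ^ 2 = ‖x‖ ^ 2) (hcen : ∑ i, c i • u i = 0)
    (x : EuclideanSpace ℝ (Fin (n + 1))) :
    ∑ i, ((n + 1) / n * c i) * ⟪liftV w (u i), x⟫ ^ 2 = ‖x‖ ^ 2 := by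
  have hc0 : ∑ i, c i * ⟪u i, projW w x⟫ = 0 := by
    have := congrArg (fun z => ⟪z, projW w x⟫) hcen
    simpa [sum_inner, real_inner_smul_left] using this
  set s := (∑ k, x k) / ((n:ℝ) + 1) with hs
  have e : ∑ i, ((n + 1) / n * c i) * ⟪liftV w (u i), x⟫ ^ 2 =
      (n + 1) / n * (s ^ 2 * ∑ i, c i + 2 * s * sqn n * ∑ i, c i * ⟪u i, projW w x⟫ +
        (sqn n * sqn n) * ∑ i, c i * ⟪u i, projW w x⟫ ^ 2) := by
    simp only [Finset.mul_sum, ← Finset.sum_add_distrib]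
    refine Finset.sum_congr rfl fun i _ => ?_
    rw [lift_inner_x, real_inner_comm (u i)]
    ring
  rw [e, hsum, hc0, hiso, sqn_sq, projW_norm hn hw, hs]
  have hn' : (n:ℝ) ≠ 0 := by positivity
  field_simp
  ring
end

section
variable {n : ℕ} {ι : Type*} [Fintype ι]

/-- finite centred isotropic frames of unit vectors -/
def IsFrame (c : ι → ℝ) (u : ι → EuclideanSpace ℝ (Fin n)) : Prop :=
  (∀ i, 0 ≤ c i) ∧ (∀ i, ‖u i‖ = 1) ∧ (∀ x, ∑ i, c i * ⟪u i, x⟫ ^ 2 = ‖x‖ ^ 2) ∧ ∑ i, c i • u i = 0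

lemma IsFrame.sum {c : ι → ℝ} {u : ι → EuclideanSpace ℝ (Fin n)} (h : IsFrame c u) : ∑ i, c i = n :=
  frame_sum_c c u h.2.1 h.2.2.1

lemma IsFrame.good {c : ι → ℝ} {u : ι → EuclideanSpace ℝ (Fin n)} (h : IsFrame c u) (hn : 1 ≤ n) :
    GoodBody (convexHull ℝ (range u)) := by
  refine ⟨convex_convexHull _ _, fun y hy => ?_, hull_norm_le ?_⟩
  · exact frame_ball hn c u h.1 h.2.1 h.sum (frame_of_sq c u h.2.2.1) h.2.2.2 y (by simpa using hy)
  · rintro _ ⟨i, rfl⟩; exact (h.2.1 i).le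

lemma IsFrame.nonempty {c : ι → ℝ} {u : ι → EuclideanSpace ℝ (Fin n)} (h : IsFrame c u) (hn : 1 ≤ n) : Nonempty ι := by
  by_contra hc
  rw [not_nonempty_iff] at hc
  have := h.sum
  simp at this
  have h2 : (n:ℝ) ≠ 0 := by positivity
  exact h2 this.symm

lemma reg_isFrame (hn : 1 ≤ n) {w : Fin (n + 1) → EuclideanSpace ℝ (Fin n)} (hw : IsRegVerts w) :
    IsFrame (fun _ => (n / (n + 1) : ℝ)) w := by
  refine ⟨fun _ => by positivity, hw.1, fun x => ?_, ?_⟩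
  · have := congrArg (fun z => ⟪z, x⟫) (reg_frame hn hw x)
    simp only [sum_inner, real_inner_smul_left, real_inner_self_eq_norm_sq] at this
    simp only [sq] at this ⊢
    rw [← Finset.mul_sum, this]
    have hn' : (n:ℝ) ≠ 0 := by positivity
    field_simp
  · rw [← Finset.smul_sum, reg_sum hn hw, smul_zero]

lemma reg_good (hn : 1 ≤ n) {w : Fin (n + 1) → EuclideanSpace ℝ (Fin n)} (hw : IsRegVerts w) :
    GoodBody (convexHull ℝ (range w)) := (reg_isFrame hn hw).good hn

lemma gauss_neg (m : ℕ) : (gaussianM m).map (-(ContinuousLinearMap.id ℝ (EuclideanSpace ℝ (Fin m)))) = gaussianM m :=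
  gauss_map m m _ (fun y => -y) (fun x y => by simp) (fun y => by simp)

lemma gauss_int_neg (m : ℕ) (f : EuclideanSpace ℝ (Fin m) → ℝ) (hf : Continuous f) :
    ∫ x, f (-x) ∂(gaussianM m) = ∫ x, f x ∂(gaussianM m) := by
  conv_rhs => rw [← gauss_neg m]
  rw [integral_map (by fun_prop) hf.aestronglyMeasurable]
  simp

lemma coord_int (m : ℕ) : Integrable (fun x : EuclideanSpace ℝ (Fin m) => ∑ k, x k) (gaussianM m) := by
  refine integrable_finsetSum _ fun k _ => ?_
  refine (gauss_int_norm m).mono' (by fun_prop) (Filter.Eventually.of_forall fun x => ?_)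
  exact PiLp.norm_apply_le x k

lemma coord_zero (m : ℕ) : ∫ x : EuclideanSpace ℝ (Fin m), ∑ k, x k ∂(gaussianM m) = 0 := by
  have h := gauss_int_neg m (fun x => ∑ k, x k) (by fun_prop)
  simp only [PiLp.neg_apply, Finset.sum_neg_distrib, integral_neg] at h
  linarith

def Yf (Z : Set (EuclideanSpace ℝ (Fin n))) (w : Fin (n + 1) → EuclideanSpace ℝ (Fin n))
    (x : EuclideanSpace ℝ (Fin (n + 1))) : ℝ := (∑ k, x k) / (n + 1) + sqn n * suppFn Z (projW w x)

def Xf (Z : Set (EuclideanSpace ℝ (Fin n))) (w : Fin (n + 1) → EuclideanSpace ℝ (Fin n))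
    (x : EuclideanSpace ℝ (Fin (n + 1))) : ℝ := (∑ k, x k) / (n + 1) + sqn n / n * gauge Z (-projW w x)

lemma proj_int (hn : 1 ≤ n) {w : Fin (n + 1) → EuclideanSpace ℝ (Fin n)} (hw : IsRegVerts w)
    (f : EuclideanSpace ℝ (Fin n) → ℝ) (hf : Continuous f) (hi : Integrable f (gaussianM n)) :
    Integrable (fun x => f (projW w x)) (gaussianM (n + 1)) ∧
    ∫ x, f (projW w x) ∂(gaussianM (n + 1)) = ∫ x, f x ∂(gaussianM n) := by
  rw [← projW_map hn hw] at hi ⊢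
  constructor
  · exact hi.comp_measurable (projW w).continuous.measurable
  · rw [integral_map (projW w).continuous.aemeasurable hf.aestronglyMeasurable]

lemma Yf_facts (hn : 1 ≤ n) {w : Fin (n + 1) → EuclideanSpace ℝ (Fin n)} (hw : IsRegVerts w)
    {Z : Set (EuclideanSpace ℝ (Fin n))} (hZ : GoodBody Z) :
    Measurable (Yf Z w) ∧ Integrable (Yf Z w) (gaussianM (n + 1)) ∧
      ∫ x, Yf Z w x ∂(gaussianM (n + 1)) = sqn n * ∫ x, suppFn Z x ∂(gaussianM n) := by
  have hc := supp_cont hZ.ne hZ.2.2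
  obtain ⟨h1, h2⟩ := proj_int hn hw (suppFn Z) hc hZ.supp_int
  have h3 := (coord_int (n + 1)).div_const ((n:ℝ) + 1)
  refine ⟨?_, h3.add (h1.const_mul _), ?_⟩
  · have : Continuous (Yf Z w) := by unfold Yf; fun_prop
    exact this.measurable
  · unfold Yf
    rw [integral_add h3 (h1.const_mul _), integral_div, coord_zero, integral_const_mul, h2]
    simp

lemma Xf_facts (hn : 1 ≤ n) {w : Fin (n + 1) → EuclideanSpace ℝ (Fin n)} (hw : IsRegVerts w)
    {Z : Set (EuclideanSpace ℝ (Fin n))} (hZ : GoodBody Z) :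
    Measurable (Xf Z w) ∧ Integrable (Xf Z w) (gaussianM (n + 1)) ∧
      ∫ x, Xf Z w x ∂(gaussianM (n + 1)) = sqn n / n * ∫ x, gauge Z x ∂(gaussianM n) := by
  have hc := hZ.gauge_cont hn
  have hi : Integrable (fun x => gauge Z (-x)) (gaussianM n) := by
    have := hZ.gauge_int hn
    rw [← gauss_neg n] at this
    exact this.comp_measurable (ContinuousLinearMap.continuous _).measurable
  obtain ⟨h1, h2⟩ := proj_int hn hw (fun x => gauge Z (-x)) (by fun_prop) hi
  rw [gauss_int_neg n _ hc] at h2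
  have h3 := (coord_int (n + 1)).div_const ((n:ℝ) + 1)
  refine ⟨?_, h3.add (h1.const_mul _), ?_⟩
  · have : Continuous (Xf Z w) := by unfold Xf; fun_prop
    exact this.measurable
  · unfold Xf
    rw [integral_add h3 (h1.const_mul _), integral_div, coord_zero, integral_const_mul, h2]
    simp

lemma supp_attained [Nonempty ι] (u : ι → EuclideanSpace ℝ (Fin n)) (y : EuclideanSpace ℝ (Fin n)) :
    ∃ i, suppFn (convexHull ℝ (range u)) y ≤ ⟪y, u i⟫ := by
  obtain ⟨i, hi⟩ := Finite.exists_max fun i => ⟪y, u i⟫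
  refine ⟨i, supp_hull_le (range_nonempty u) ?_⟩
  rintro _ ⟨j, rfl⟩; exact hi j

lemma Yf_lt_iff (hn : 1 ≤ n) {c : ι → ℝ} {u : ι → EuclideanSpace ℝ (Fin n)} (h : IsFrame c u)
    (w : Fin (n + 1) → EuclideanSpace ℝ (Fin n)) (x : EuclideanSpace ℝ (Fin (n + 1))) (t : ℝ) :
    Yf (convexHull ℝ (range u)) w x < t ↔ ∀ i, ⟪liftV w (u i), x⟫ < t := by
  have := h.nonempty hn
  constructor
  · intro hY i
    refine lt_of_le_of_lt ?_ hY
    rw [lift_inner_x, Yf]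
    have := le_supp (h.good hn).2.2 (projW w x) (subset_convexHull ℝ _ (mem_range_self i))
    have := sqn_nonneg n
    gcongr
  · intro hi
    obtain ⟨i, hi'⟩ := supp_attained u (projW w x)
    refine lt_of_le_of_lt ?_ (hi i)
    rw [lift_inner_x, Yf]
    have := sqn_nonneg n
    gcongr

lemma Yf_le_iff (hn : 1 ≤ n) {c : ι → ℝ} {u : ι → EuclideanSpace ℝ (Fin n)} (h : IsFrame c u)
    (w : Fin (n + 1) → EuclideanSpace ℝ (Fin n)) (x : EuclideanSpace ℝ (Fin (n + 1))) (t : ℝ) :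
    Yf (convexHull ℝ (range u)) w x ≤ t ↔ ∀ i, ⟪liftV w (u i), x⟫ ≤ t := by
  have := h.nonempty hn
  constructor
  · intro hY i
    refine le_trans ?_ hY
    rw [lift_inner_x, Yf]
    have := le_supp (h.good hn).2.2 (projW w x) (subset_convexHull ℝ _ (mem_range_self i))
    have := sqn_nonneg n
    gcongr
  · intro hi
    obtain ⟨i, hi'⟩ := supp_attained u (projW w x)
    refine le_trans ?_ (hi i)
    rw [lift_inner_x, Yf]
    have := sqn_nonneg n
    gcongr

lemma lift_vert (hn : 1 ≤ n) {w : Fin (n + 1) → EuclideanSpace ℝ (Fin n)} (hw : IsRegVerts w) (j : Fin (n + 1))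
    (x : EuclideanSpace ℝ (Fin (n + 1))) : ⟪liftV w (w j), x⟫ = x j := by
  rw [inner_coord, Finset.sum_eq_single j]
  · simp only [liftV, reg_gram hn hw, if_true]
    have hn' : (n:ℝ) ≠ 0 := by positivity
    field_simp
    ring
  · intro k _ hk
    simp only [liftV, reg_gram hn hw, if_neg hk]
    have hn' : (n:ℝ) ≠ 0 := by positivity
    field_simp
    ring
  · simp

lemma Xf_reg (hn : 1 ≤ n) {w : Fin (n + 1) → EuclideanSpace ℝ (Fin n)} (hw : IsRegVerts w)
    (x : EuclideanSpace ℝ (Fin (n + 1))) :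
    Xf (convexHull ℝ (range w)) w x = Yf (convexHull ℝ (range w)) w x := by
  unfold Xf Yf
  rw [reg_gauge hn hw, neg_neg]
  have hn' : (n:ℝ) ≠ 0 := by positivity
  field_simp

lemma Yf_reg_lt (hn : 1 ≤ n) {w : Fin (n + 1) → EuclideanSpace ℝ (Fin n)} (hw : IsRegVerts w) (t : ℝ) :
    (gaussianM (n + 1)).real {x | Yf (convexHull ℝ (range w)) w x < t} = Phi t ^ (n + 1) := by
  rw [← gauss_prod_lt]
  simp only [Yf_lt_iff hn (reg_isFrame hn hw), lift_vert hn hw]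

lemma Xf_reg_le (hn : 1 ≤ n) {w : Fin (n + 1) → EuclideanSpace ℝ (Fin n)} (hw : IsRegVerts w) (t : ℝ) :
    (gaussianM (n + 1)).real {x | Xf (convexHull ℝ (range w)) w x ≤ t} = Phi t ^ (n + 1) := by
  rw [← gauss_prod]
  simp only [Xf_reg hn hw, Yf_le_iff hn (reg_isFrame hn hw), lift_vert hn hw]

def xhalf (n : ℕ) : EuclideanSpace ℝ (Fin (n + 1)) := WithLp.toLp 2 fun _ => 1 / 2

lemma lift_half (hn : 1 ≤ n) {w : Fin (n + 1) → EuclideanSpace ℝ (Fin n)} (hw : IsRegVerts w)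
    (u : EuclideanSpace ℝ (Fin n)) : ⟪liftV w u, xhalf n⟫ = 1 / 2 := by
  rw [inner_coord]
  simp only [xhalf]
  rw [← Finset.sum_mul, lift_sum hn hw, one_mul]

def defI (w : Fin (n + 1) → EuclideanSpace ℝ (Fin n)) (c : ι → ℝ) (u : ι → EuclideanSpace ℝ (Fin n)) : ℝ :=
  kap * ∫ x in ball (xhalf n) (1/4), qForm (fun i => (n + 1) / n * c i) (fun i => liftV w (u i)) x ∂(gaussianM (n + 1))

lemma kap_pos : 0 < kap := by unfold kap; positivity

lemma defI_nonneg (w : Fin (n + 1) → EuclideanSpace ℝ (Fin n)) {c : ι → ℝ} {u : ι → EuclideanSpace ℝ (Fin n)}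
    (h : IsFrame c u) : 0 ≤ defI w c u :=
  mul_nonneg kap_pos.le (integral_nonneg fun x => qForm_nonneg _ _ (fun i => mul_nonneg (by positivity) (h.1 i)) x)

lemma stage1C (hn : 1 ≤ n) {w : Fin (n + 1) → EuclideanSpace ℝ (Fin n)} (hw : IsRegVerts w)
    {c : ι → ℝ} {u : ι → EuclideanSpace ℝ (Fin n)} (h : IsFrame c u) :
    sqn n * ∫ x, suppFn (convexHull ℝ (range w)) x ∂(gaussianM n) + defI w c u ≤
      sqn n * ∫ x, suppFn (convexHull ℝ (range u)) x ∂(gaussianM n) := by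
  obtain ⟨a1, a2, a3⟩ := Yf_facts hn hw (reg_good hn hw)
  obtain ⟨b1, b2, b3⟩ := Yf_facts hn hw (h.good hn)
  rw [← a3, ← b3]
  have hc' : ∀ i, 0 ≤ (n + 1 : ℝ) / n * c i := fun i => mul_nonneg (by positivity) (h.1 i)
  have hu' : ∀ i, ‖liftV w (u i)‖ = 1 := fun i => lift_norm hn hw _ (h.2.1 i)
  have hi' := lift_iso hn hw c u h.sum h.2.2.1 h.2.2.2
  refine layer_lt _ _ b1 a1 b2 a2 _ (defI_nonneg w h) (fun t => ?_) (fun t ht1 ht2 => ?_)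
  · rw [Yf_reg_lt hn hw]
    simp only [Yf_lt_iff hn h]
    exact coreC_plain _ _ hc' hu' hi' t
  · rw [Yf_reg_lt hn hw]
    simp only [Yf_lt_iff hn h]
    exact coreC _ _ hc' hu' hi' (xhalf n) (fun i => lift_half hn hw _) t ht1 ht2

lemma gauge_frame_le (hn : 1 ≤ n) {c : ι → ℝ} {u : ι → EuclideanSpace ℝ (Fin n)} (h : IsFrame c u)
    (a : ι → ℝ) (ha : ∀ i, 0 ≤ a i) : gauge (convexHull ℝ (range u)) (∑ i, a i • u i) ≤ ∑ i, a i := by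
  have hg := h.good hn
  refine (Finset.le_sum_of_subadditive _ gauge_zero.le
    (gauge_add_le hg.1 (absorbent_nhds_zero (hg.nhds hn))) Finset.univ _).trans ?_
  refine Finset.sum_le_sum fun i _ => ?_
  rw [gauge_smul_of_nonneg (ha i), smul_eq_mul]
  have := gauge_le_one_of_mem (subset_convexHull ℝ _ (mem_range_self i) : u i ∈ convexHull ℝ (range u))
  have := ha i
  nlinarith

lemma thMap_mem (hn : 1 ≤ n) {w : Fin (n + 1) → EuclideanSpace ℝ (Fin n)} (hw : IsRegVerts w)
    {c : ι → ℝ} {u : ι → EuclideanSpace ℝ (Fin n)} (h : IsFrame c u) (t : ℝ) (T : ℝ → ℝ) (hT : ∀ s, T s ≤ t)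
    (x : EuclideanSpace ℝ (Fin (n + 1))) :
    Xf (convexHull ℝ (range u)) w (thMap (fun i => (n + 1) / n * c i) (fun i => liftV w (u i)) T x) ≤ t := by
  set S : ι → ℝ := fun i => T ⟪liftV w (u i), x⟫ with hS
  have hn0 : (0:ℝ) < n := by positivity
  have e1 : ∑ k, thMap (fun i => (n + 1) / n * c i) (fun i => liftV w (u i)) T x k = ∑ i, (n + 1) / n * c i * S i := by
    unfold thMap
    simp only [WithLp.ofLp_sum, Finset.sum_apply, PiLp.smul_apply, smul_eq_mul]
    rw [Finset.sum_comm]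
    refine Finset.sum_congr rfl fun i _ => ?_
    rw [← Finset.mul_sum, lift_sum hn hw, mul_one]
  have e2 : -projW w (thMap (fun i => (n + 1) / n * c i) (fun i => liftV w (u i)) T x) =
      sqn n • ∑ i, ((n + 1) / n * c i * (t - S i)) • u i := by
    unfold thMap
    rw [map_sum]
    simp only [map_smul, projW_lift hn hw]
    have h0 : ∑ i, ((n + 1) / n * c i * t) • u i = 0 := by
      have : ∑ i, ((n + 1) / n * c i * t) • u i = ((n + 1) / n * t) • ∑ i, c i • u i := by
        rw [Finset.smul_sum]
        exact Finset.sum_congr rfl fun i _ => by rw [smul_smul]; congr 1; ring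
      rw [this, h.2.2.2, smul_zero]
    simp only [mul_sub, sub_smul, Finset.sum_sub_distrib, h0, zero_sub, smul_neg, Finset.smul_sum]
    congr 1
    refine Finset.sum_congr rfl fun i _ => ?_
    rw [smul_comm]
  unfold Xf
  rw [e1, e2, gauge_smul_of_nonneg (sqn_nonneg n), smul_eq_mul]
  have hg := gauge_frame_le hn h (fun i => (n + 1) / n * c i * (t - S i)) (fun i =>
    mul_nonneg (mul_nonneg (by positivity) (h.1 i)) (by linarith [hT ⟪liftV w (u i), x⟫]))
  have e3 : ∑ i, (n + 1) / n * c i * (t - S i) = (n + 1) * t - ∑ i, (n + 1) / n * c i * S i := by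
    simp only [mul_sub, Finset.sum_sub_distrib]
    rw [← Finset.sum_mul, ← Finset.mul_sum, h.sum]
    field_simp
  rw [e3] at hg
  have h4 : sqn n / n * (sqn n * gauge (convexHull ℝ (range u)) (∑ i, ((n + 1) / n * c i * (t - S i)) • u i)) =
      (1 / (n + 1)) * gauge (convexHull ℝ (range u)) (∑ i, ((n + 1) / n * c i * (t - S i)) • u i) := by
    rw [← mul_assoc, div_mul_eq_mul_div, sqn_sq]
    field_simp
  rw [h4]
  have h5 := mul_le_mul_of_nonneg_left hg (show (0:ℝ) ≤ 1 / (n + 1) by positivity)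
  have h6 : 1 / ((n:ℝ) + 1) * ((n + 1) * t - ∑ i, (n + 1) / n * c i * S i) = t - (∑ i, (n + 1) / n * c i * S i) / (n + 1) := by
    field_simp
  linarith

lemma stage1A (hn : 1 ≤ n) {w : Fin (n + 1) → EuclideanSpace ℝ (Fin n)} (hw : IsRegVerts w)
    {c : ι → ℝ} {u : ι → EuclideanSpace ℝ (Fin n)} (h : IsFrame c u) :
    sqn n / n * ∫ x, gauge (convexHull ℝ (range u)) x ∂(gaussianM n) + (1/2)^(n+1) * defI w c u ≤
      sqn n / n * ∫ x, gauge (convexHull ℝ (range w)) x ∂(gaussianM n) := by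
  obtain ⟨a1, a2, a3⟩ := Xf_facts hn hw (reg_good hn hw)
  obtain ⟨b1, b2, b3⟩ := Xf_facts hn hw (h.good hn)
  rw [← a3, ← b3]
  have hc' : ∀ i, 0 ≤ (n + 1 : ℝ) / n * c i := fun i => mul_nonneg (by positivity) (h.1 i)
  have hu' : ∀ i, ‖liftV w (u i)‖ = 1 := fun i => lift_norm hn hw _ (h.2.1 i)
  have hi' := lift_iso hn hw c u h.sum h.2.2.1 h.2.2.2
  refine layer_le _ _ a1 b1 a2 b2 _ (mul_nonneg (by positivity) (defI_nonneg w h)) (fun t => ?_) (fun t ht1 ht2 => ?_)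
  · rw [Xf_reg_le hn hw]
    exact coreA_plain _ _ hc' hu' hi' t _ (fun T hT x => thMap_mem hn hw h t T hT x)
  · rw [Xf_reg_le hn hw]
    exact coreA _ _ hc' hu' hi' (xhalf n) (fun i => lift_half hn hw _) t ht1 ht2 _ (fun T hT x => thMap_mem hn hw h t T hT x)
end

section
lemma compact_hull {V : Type*} [NormedAddCommGroup V] [NormedSpace ℝ V] [FiniteDimensional ℝ V] {s : Set V}
    (hs : IsCompact s) : IsCompact (convexHull ℝ s) := by
  rcases s.eq_empty_or_nonempty with rfl | ⟨s0, hs0⟩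
  · simp
  set d := Module.finrank ℝ V
  set f : (Fin (d + 1) → ℝ) × (Fin (d + 1) → V) → V := fun p => ∑ i, p.1 i • p.2 i with hf
  have hfc : Continuous f := by fun_prop
  have hc : IsCompact ((stdSimplex ℝ (Fin (d + 1))) ×ˢ (Set.pi univ fun _ : Fin (d + 1) => s)) :=
    (isCompact_stdSimplex ℝ (Fin (d + 1))).prod (isCompact_univ_pi fun _ => hs)
  convert hc.image hfc using 1
  apply Subset.antisymm
  · intro x hx
    obtain ⟨ι, hι, z, w, hz, hai, hw, hw1, hx⟩ := eq_pos_convex_span_of_mem_convexHull hx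
    have hcard := hai.card_le_finrank_succ
    have hcard2 : Fintype.card ι ≤ Fintype.card (Fin (d + 1)) := by
      rw [Fintype.card_fin]
      exact hcard.trans (Nat.succ_le_succ (Submodule.finrank_le _))
    obtain ⟨e⟩ := Function.Embedding.nonempty_of_card_le hcard2
    refine ⟨(Function.extend e w 0, Function.extend e z fun _ => s0), ⟨⟨fun j => ?_, ?_⟩, fun j _ => ?_⟩, ?_⟩
    · by_cases h : ∃ i, e i = j
      · obtain ⟨i, rfl⟩ := h
        simp only [e.injective.extend_apply]; exact (hw i).le
      · simp only [Function.extend_apply' _ _ _ h]; exact le_rfl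
    · rw [← hw1]
      symm
      apply Fintype.sum_of_injective e e.injective
      · intro j hj
        exact Function.extend_apply' _ _ _ (by simpa using hj)
      · intro i; simp only [e.injective.extend_apply]
    · by_cases h : ∃ i, e i = j
      · obtain ⟨i, rfl⟩ := h
        simp only [e.injective.extend_apply]; exact hz (mem_range_self i)
      · simp only [Function.extend_apply' _ _ _ h]; exact hs0
    · rw [← hx, hf]
      symm
      apply Fintype.sum_of_injective e e.injective
      · intro j hj
        simp only
        have : Function.extend e w (0 : Fin (d + 1) → ℝ) j = (0:ℝ) := Function.extend_apply' _ _ _ (by simpa using hj)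
        rw [this, zero_smul]
      · intro i
        simp only
        rw [e.injective.extend_apply, e.injective.extend_apply]
  · rintro _ ⟨⟨a, z⟩, ⟨ha, hz⟩, rfl⟩
    exact (convex_convexHull ℝ s).sum_mem (fun i _ => ha.1 i) ha.2
      (fun i _ => subset_convexHull ℝ _ (hz i trivial))

variable {n : ℕ}

lemma msupp_closed (μ : Measure (EuclideanSpace ℝ (Fin n))) : IsClosed (msupp μ) := by
  rw [← isOpen_compl_iff, isOpen_iff_mem_nhds]
  intro x hx
  simp only [msupp, mem_compl_iff, mem_setOf_eq, not_forall, not_not] at hx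
  obtain ⟨U, hU, hxU, h0⟩ := hx
  refine Filter.mem_of_superset (hU.mem_nhds hxU) fun y hy hy2 => hy2 U hU hy h0

lemma msupp_compl (μ : Measure (EuclideanSpace ℝ (Fin n))) : μ (msupp μ)ᶜ = 0 := by
  apply measure_null_of_locally_null
  intro x hx
  simp only [msupp, mem_compl_iff, mem_setOf_eq, not_forall, not_not] at hx
  obtain ⟨U, hU, hxU, h0⟩ := hx
  exact ⟨U, mem_nhdsWithin_of_mem_nhds (hU.mem_nhds hxU), h0⟩

lemma msupp_compact {μ : Measure (EuclideanSpace ℝ (Fin n))} (hμ : IsCenteredIsotropic μ) : IsCompact (msupp μ) :=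
  (isCompact_sphere 0 1).of_isClosed_subset (msupp_closed μ) hμ.1

lemma norm_sq_coord (u : EuclideanSpace ℝ (Fin n)) :
    ∑ k, ⟪u, EuclideanSpace.basisFun (Fin n) ℝ k⟫ ^ 2 = ‖u‖ ^ 2 := by
  rw [EuclideanSpace.norm_sq_eq]
  refine Finset.sum_congr rfl fun k _ => ?_
  simp [EuclideanSpace.inner_single_right]

lemma iso_mass {μ : Measure (EuclideanSpace ℝ (Fin n))} (hμ : IsCenteredIsotropic μ) :
    IsFiniteMeasure μ ∧ μ.real univ = n := by
  have hae : ∀ᵐ u ∂μ, ‖u‖ = 1 := by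
    have : ∀ᵐ u ∂μ, u ∈ msupp μ := by
      rw [ae_iff]; exact msupp_compl μ
    filter_upwards [this] with u hu
    simpa using hμ.1 hu
  set e := EuclideanSpace.basisFun (Fin n) ℝ with he
  have h1 : ∀ k, ∫ u, ⟪u, e k⟫ ^ 2 ∂μ = 1 := fun k => by
    rw [hμ.2.1, e.orthonormal.1 k]; norm_num
  have hi : ∀ k, Integrable (fun u => ⟪u, e k⟫ ^ 2) μ := by
    intro k
    by_contra h
    have := h1 k
    rw [integral_undef h] at this
    norm_num at this
  have hs : Integrable (fun u : EuclideanSpace ℝ (Fin n) => ∑ k, ⟪u, e k⟫ ^ 2) μ := integrable_finsetSum _ fun k _ => hi k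
  have hc : (fun u : EuclideanSpace ℝ (Fin n) => ∑ k, ⟪u, e k⟫ ^ 2) =ᵐ[μ] fun _ => (1:ℝ) := by
    filter_upwards [hae] with u hu
    rw [norm_sq_coord, hu]; norm_num
  have hone : Integrable (fun _ => (1:ℝ)) μ := hs.congr hc
  have hfin : IsFiniteMeasure μ := by
    rcases integrable_const_iff.1 hone with h | h
    · norm_num at h
    · exact h
  refine ⟨hfin, ?_⟩
  have h2 := integral_congr_ae hc
  rw [integral_finsetSum _ fun k _ => hi k] at h2
  simp only [h1] at h2
  simp at h2
  exact h2.symm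

lemma exists_frame (hn : 1 ≤ n) {μ : Measure (EuclideanSpace ℝ (Fin n))} (hμ : IsCenteredIsotropic μ) :
    ∃ (ι : Type) (_ : Fintype ι) (c : ι → ℝ) (u : ι → EuclideanSpace ℝ (Fin n)),
      IsFrame c u ∧ ∀ i, u i ∈ msupp μ := by
  obtain ⟨hfin, hmass⟩ := iso_mass hμ
  have hn0 : (0:ℝ) < n := by positivity
  have hne : NeZero μ := ⟨by rintro rfl; simp at hmass; linarith⟩
  have hA := msupp_compact hμ
  set A := msupp μ with hAdef
  set F : EuclideanSpace ℝ (Fin n) → (Fin n → Fin n → ℝ) × EuclideanSpace ℝ (Fin n) :=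
    fun u => (fun a b => u a * u b, u) with hF
  have hFc : Continuous F := by fun_prop
  have hAae : ∀ᵐ u ∂μ, u ∈ A := by rw [ae_iff]; exact msupp_compl μ
  have hae : ∀ᵐ u ∂μ, F u ∈ convexHull ℝ (F '' A) := by
    filter_upwards [hAae] with u hu
    exact subset_convexHull ℝ _ (mem_image_of_mem _ hu)
  have hK := compact_hull (hA.image hFc)
  have hFi : Integrable F μ := by
    obtain ⟨C, hC⟩ := (hA.image hFc).isBounded.exists_norm_le
    refine Integrable.of_bound hFc.aestronglyMeasurable C ?_
    filter_upwards [hAae] with u hu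
    exact hC _ (mem_image_of_mem _ hu)
  have hav := (convex_convexHull ℝ (F '' A)).average_mem hK.isClosed hae hFi
  obtain ⟨ι, hι, l, z, hl0, hl1, hz, hsum⟩ := mem_convexHull_iff_exists_fintype.1 hav
  choose u huA hu using hz
  rw [average_eq, hmass] at hsum
  refine ⟨ι, hι, fun i => n * l i, u, ⟨fun i => mul_nonneg hn0.le (hl0 i), fun i => by simpa using hμ.1 (huA i), fun x => ?_, ?_⟩, huA⟩
  · set Λ : ((Fin n → Fin n → ℝ) × EuclideanSpace ℝ (Fin n)) →L[ℝ] ℝ :=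
      LinearMap.toContinuousLinearMap
        { toFun := fun p => ∑ a, ∑ b, x a * x b * p.1 a b
          map_add' := fun p q => by
            simp only [Prod.fst_add, Pi.add_apply, mul_add, Finset.sum_add_distrib]
          map_smul' := fun r p => by
            simp only [Prod.smul_fst, Pi.smul_apply, smul_eq_mul, RingHom.id_apply, Finset.mul_sum]
            exact Finset.sum_congr rfl fun a _ => Finset.sum_congr rfl fun b _ => by ring } with hΛ
    have hΛF : ∀ v, Λ (F v) = ⟪v, x⟫ ^ 2 := by
      intro v
      rw [inner_coord, sq, Finset.sum_mul_sum]
      show ∑ a, ∑ b, x a * x b * (v a * v b) = _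
      exact Finset.sum_congr rfl fun a _ => Finset.sum_congr rfl fun b _ => by ring
    have h := congrArg Λ hsum
    rw [map_sum, map_smul, ← Λ.integral_comp_comm hFi] at h
    simp only [map_smul, ← hu, hΛF, smul_eq_mul, hμ.2.1] at h
    simp only [mul_assoc]
    rw [← Finset.mul_sum, h]
    field_simp
  · have h := congrArg Prod.snd hsum
    rw [Prod.smul_snd, Prod.snd_sum] at h
    have e : (∫ x, F x ∂μ).2 = ∫ x, x ∂μ := by
      have := (ContinuousLinearMap.snd ℝ (Fin n → Fin n → ℝ) (EuclideanSpace ℝ (Fin n))).integral_comp_comm hFi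
      simpa [hF] using this.symm
    rw [e, hμ.2.2, smul_zero] at h
    have e2 : ∀ i, (l i • z i).2 = l i • u i := fun i => by rw [← hu i]; rfl
    simp only [e2] at h
    simp only [mul_smul]
    rw [← Finset.smul_sum, h, smul_zero]
end

section
variable {n : ℕ}

lemma inv_prop (σ ν : Measure (EuclideanSpace ℝ (Fin n))) [IsFiniteMeasure σ] [IsFiniteMeasure ν]
    (hσ : ∀ᵐ x ∂σ, ‖x‖ = 1) (hν : ∀ᵐ x ∂ν, ‖x‖ = 1)
    (hσi : ∀ s t, ‖s‖ = ‖t‖ → charFun σ s = charFun σ t)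
    (hνi : ∀ s t, ‖s‖ = ‖t‖ → charFun ν s = charFun ν t) :
    (ν univ) • σ = (σ univ) • ν := by
  have hfin1 : IsFiniteMeasure (ν univ • σ) := Measure.smul_finite _ (measure_ne_top _ _)
  have hfin2 : IsFiniteMeasure (σ univ • ν) := Measure.smul_finite _ (measure_ne_top _ _)
  apply Measure.ext_of_charFun
  ext t
  have h1 : ∫ v, charFun σ (‖t‖ • v) ∂ν = ∫ v, charFun σ t ∂ν := by
    apply integral_congr_ae
    filter_upwards [hν] with v hv
    exact hσi _ _ (by simp [norm_smul, hv])
  have h2 : ∫ v, charFun ν (‖t‖ • v) ∂σ = ∫ v, charFun ν t ∂σ := by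
    apply integral_congr_ae
    filter_upwards [hσ] with v hv
    exact hνi _ _ (by simp [norm_smul, hv])
  have h3 : ∫ v, charFun σ (‖t‖ • v) ∂ν = ∫ v, charFun ν (‖t‖ • v) ∂σ := by
    simp only [charFun_apply]
    rw [integral_integral_swap]
    · congr 1; ext u; congr 1; ext v
      rw [real_inner_smul_right, real_inner_smul_right, real_inner_comm]
    · refine (integrable_const (1:ℝ)).mono' ?_ (Filter.Eventually.of_forall fun x => ?_)
      · apply Continuous.aestronglyMeasurable
        unfold Function.uncurry
        fun_prop
      · simp only [Function.uncurry]
        rw [Complex.norm_exp_ofReal_mul_I]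
  rw [h1, h2] at h3
  simp only [integral_const, charFun_apply, integral_smul_measure] at h3 ⊢
  exact h3

lemma refl_exists {s t : EuclideanSpace ℝ (Fin n)} (h : ‖s‖ = ‖t‖) :
    ∃ L : EuclideanSpace ℝ (Fin n) ≃ₗᵢ[ℝ] EuclideanSpace ℝ (Fin n), L s = t :=
  ⟨_, Submodule.reflection_sub h⟩

lemma sphere_charFun (d : ℝ) (s t : EuclideanSpace ℝ (Fin n)) (h : ‖s‖ = ‖t‖) :
    charFun ((Measure.hausdorffMeasure d).restrict (sphere (0 : EuclideanSpace ℝ (Fin n)) 1)) s =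
    charFun ((Measure.hausdorffMeasure d).restrict (sphere (0 : EuclideanSpace ℝ (Fin n)) 1)) t := by
  obtain ⟨L, rfl⟩ := refl_exists h
  rw [charFun_apply, charFun_apply]
  have hp := (L.toIsometryEquiv.measurePreserving_hausdorffMeasure d)
  have := hp.setIntegral_preimage_emb L.toIsometryEquiv.toHomeomorph.measurableEmbedding
    (fun x => Complex.exp (↑⟪x, L s⟫ * Complex.I)) (sphere 0 1)
  rw [← this]
  have h1 : (L.toIsometryEquiv : _ → _) ⁻¹' (sphere (0 : EuclideanSpace ℝ (Fin n)) 1) = sphere 0 1 := by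
    ext x; simp
  rw [h1]
  congr 1; ext x
  simp [L.inner_map_map]

def nuM (n : ℕ) : Measure (EuclideanSpace ℝ (Fin n)) :=
  ((gaussianM n).withDensity fun x => (‖x‖₊ : ℝ≥0∞)).map fun x => (‖x‖)⁻¹ • x

lemma nuM_meas : Measurable fun x : EuclideanSpace ℝ (Fin n) => (‖x‖)⁻¹ • x := by fun_prop

lemma nuM_int {F : Type*} [NormedAddCommGroup F] [NormedSpace ℝ F] (f : EuclideanSpace ℝ (Fin n) → F) (hf : Continuous f) [SecondCountableTopology F] :
    ∫ x, f x ∂(nuM n) = ∫ x, ‖x‖ • f ((‖x‖)⁻¹ • x) ∂(gaussianM n) := by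
  rw [nuM, integral_map nuM_meas.aemeasurable hf.aestronglyMeasurable,
    integral_withDensity_eq_integral_smul (by fun_prop)]
  rfl

instance nuM_fin : IsFiniteMeasure (nuM n) := by
  have : IsFiniteMeasure ((gaussianM n).withDensity fun x => (‖x‖₊ : ℝ≥0∞)) :=
    by
    apply isFiniteMeasure_withDensity
    have := (gauss_int_norm n).2.ne
    simp only [enorm_norm] at this
    exact this
  exact Measure.isFiniteMeasure_map _ _

lemma nuM_charFun (s t : EuclideanSpace ℝ (Fin n)) (h : ‖s‖ = ‖t‖) :
    charFun (nuM n) s = charFun (nuM n) t := by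
  obtain ⟨L, rfl⟩ := refl_exists h
  rw [charFun_apply, charFun_apply, nuM_int _ (by fun_prop), nuM_int _ (by fun_prop)]
  have hg := gauss_map n n (L : EuclideanSpace ℝ (Fin n) →L[ℝ] EuclideanSpace ℝ (Fin n)) L.symm
    (fun x y => by simpa using L.inner_map_eq_flip x y) (by simp)
  conv_rhs => rw [← hg]
  rw [integral_map (by fun_prop)]
  · congr 1; ext x
    have : ⟪(‖x‖)⁻¹ • L x, L s⟫ = ⟪(‖x‖)⁻¹ • x, s⟫ := by
      rw [inner_smul_left, inner_smul_left, L.inner_map_map]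
    simp [this]
  · apply Measurable.aestronglyMeasurable
    fun_prop

lemma gauss_ne_zero (hn : 1 ≤ n) : ∀ᵐ x ∂(gaussianM n), x ≠ 0 := by
  have : Nonempty (Fin n) := ⟨⟨0, hn⟩⟩
  have h0 : gaussianM n {0} = 0 := (withDensity_absolutelyContinuous _ _) (measure_singleton 0)
  rw [ae_iff]; simpa using h0

lemma nuM_ae (hn : 1 ≤ n) : ∀ᵐ x ∂(nuM n), ‖x‖ = 1 := by
  rw [nuM, ae_map_iff nuM_meas.aemeasurable (measurableSet_eq_fun (by fun_prop) (by fun_prop))]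
  refine (withDensity_absolutelyContinuous _ _).ae_le ?_
  filter_upwards [gauss_ne_zero hn] with x hx
  rw [norm_smul, norm_inv, norm_norm, inv_mul_cancel₀ (norm_ne_zero_iff.2 hx)]

lemma nuM_pos (hn : 1 ≤ n) : nuM n univ ≠ 0 := by
  intro h
  rw [Measure.measure_univ_eq_zero] at h
  have h1 := nuM_int (n := n) (fun _ => (1:ℝ)) continuous_const
  rw [h] at h1
  simp only [integral_zero_measure, smul_eq_mul, mul_one] at h1
  have h2 := (integral_eq_zero_iff_of_nonneg (fun x => norm_nonneg x) (gauss_int_norm n)).1 h1.symm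
  have h3 : ∀ᵐ x ∂(gaussianM n), False := by
    filter_upwards [gauss_ne_zero hn, h2] with x hx hx2
    exact hx (norm_eq_zero.1 hx2)
  simp at h3
  exact (IsProbabilityMeasure.ne_zero (gaussianM n)) h3

lemma nuM_hom (hn : 1 ≤ n) (f : EuclideanSpace ℝ (Fin n) → ℝ) (hf : Continuous f)
    (hh : ∀ r x, 0 ≤ r → f (r • x) = r * f x) : ∫ x, f x ∂(nuM n) = ∫ x, f x ∂(gaussianM n) := by
  rw [nuM_int f hf]
  apply integral_congr_ae
  filter_upwards [gauss_ne_zero hn] with x hx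
  rw [hh _ _ (by positivity), smul_eq_mul, ← mul_assoc, mul_inv_cancel₀ (norm_ne_zero_iff.2 hx), one_mul]

lemma normalize_lip {V : Type*} [NormedAddCommGroup V] [NormedSpace ℝ V] {x y : V}
    (hx : 1 ≤ ‖x‖) (hy : 1 ≤ ‖y‖) : ‖(‖x‖)⁻¹ • x - (‖y‖)⁻¹ • y‖ ≤ 2 * ‖x - y‖ := by
  have hx0 : 0 < ‖x‖ := by linarith
  have hy0 : 0 < ‖y‖ := by linarith
  have e : (‖x‖)⁻¹ • x - (‖y‖)⁻¹ • y = (‖x‖)⁻¹ • (x - y) + ((‖x‖)⁻¹ * (‖y‖ - ‖x‖) * (‖y‖)⁻¹) • y := by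
    have : (‖x‖)⁻¹ * (‖y‖ - ‖x‖) * (‖y‖)⁻¹ = (‖x‖)⁻¹ - (‖y‖)⁻¹ := by field_simp
    rw [this]; module
  have h1 : |‖y‖ - ‖x‖| ≤ ‖x - y‖ := by
    rw [abs_sub_comm]; exact abs_norm_sub_norm_le x y
  have hi : (‖x‖)⁻¹ ≤ 1 := inv_le_one_of_one_le₀ hx
  rw [e]
  calc _ ≤ ‖(‖x‖)⁻¹ • (x - y)‖ + ‖((‖x‖)⁻¹ * (‖y‖ - ‖x‖) * (‖y‖)⁻¹) • y‖ := norm_add_le _ _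
    _ = (‖x‖)⁻¹ * ‖x - y‖ + (‖x‖)⁻¹ * |‖y‖ - ‖x‖| := by
      rw [norm_smul, norm_smul, norm_mul, norm_mul, norm_inv, norm_inv, norm_norm, norm_norm, Real.norm_eq_abs]
      field_simp
    _ ≤ 1 * ‖x - y‖ + 1 * ‖x - y‖ := by gcongr
    _ = _ := by ring

def faceMap (k : ℕ) (i : Fin (k + 1)) (s : ℝ) (y : Fin k → ℝ) : EuclideanSpace ℝ (Fin (k + 1)) :=
  WithLp.toLp 2 (i.insertNth s y)

lemma face_lip (k : ℕ) (i : Fin (k + 1)) (s : ℝ) : ∃ K, LipschitzWith K (faceMap k i s) := by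
  have h := PiLp.lipschitzWith_toLp 2 (fun _ : Fin (k + 1) => ℝ)
  refine ⟨_ * 1, h.comp (LipschitzWith.of_dist_le_mul fun x y => ?_)⟩
  rw [NNReal.coe_one, one_mul, dist_pi_le_iff dist_nonneg]
  intro j
  refine Fin.succAboveCases i ?_ (fun l => ?_) j
  · simp
  · simp only [Fin.insertNth_apply_succAbove]
    exact dist_le_pi_dist x y l

lemma face_norm (k : ℕ) (i : Fin (k + 1)) (s : ℝ) (hs : |s| = 1) (y : Fin k → ℝ) : 1 ≤ ‖faceMap k i s y‖ := by
  have := PiLp.norm_apply_le (faceMap k i s y) i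
  simpa [faceMap, hs] using this

lemma sphere_fin (k : ℕ) : μH[(k:ℝ)] (sphere (0 : EuclideanSpace ℝ (Fin (k + 1))) 1) < ∞ := by
  have hcov : sphere (0 : EuclideanSpace ℝ (Fin (k + 1))) 1 ⊆ ⋃ i : Fin (k + 1), ⋃ b : Bool,
      (fun y => (‖faceMap k i (if b then 1 else -1) y‖)⁻¹ • faceMap k i (if b then 1 else -1) y) ''
        closedBall 0 1 := by
    intro x hx
    have hx1 : ‖x‖ = 1 := by simpa using hx
    obtain ⟨i, hi⟩ := Finite.exists_max fun i => |x i|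
    have hxi : 0 < |x i| := by
      rw [abs_pos]; intro h0
      have : x = 0 := by
        ext j
        have := hi j
        rw [h0, abs_zero] at this
        simpa using abs_nonpos_iff.1 this
      rw [this] at hx1; simp at hx1
    simp only [mem_iUnion]
    refine ⟨i, decide (0 < x i), fun l => (|x i|)⁻¹ * x (i.succAbove l), ?_, ?_⟩
    · rw [mem_closedBall_zero_iff, pi_norm_le_iff_of_nonneg zero_le_one]
      intro l
      rw [norm_mul, norm_inv, Real.norm_eq_abs, Real.norm_eq_abs, abs_abs, inv_mul_le_iff₀ hxi, mul_one]
      exact hi _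
    · have e : faceMap k i (if decide (0 < x i) = true then 1 else -1) (fun l => (|x i|)⁻¹ * x (i.succAbove l))
          = (|x i|)⁻¹ • x := by
        ext j
        refine Fin.succAboveCases i ?_ (fun l => ?_) j
        · simp only [faceMap, Fin.insertNth_apply_same, PiLp.smul_apply, smul_eq_mul, decide_eq_true_eq]
          split_ifs with h
          · rw [abs_of_pos h, inv_mul_cancel₀ h.ne']
          · have h' : x i < 0 := lt_of_le_of_ne (not_lt.1 h) (abs_pos.1 hxi)
            rw [abs_of_neg h', inv_neg, neg_mul, inv_mul_cancel₀ h'.ne]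
        · simp [faceMap]
      simp only
      rw [e, norm_smul, hx1, norm_inv, Real.norm_eq_abs, abs_abs, mul_one, inv_inv, smul_smul,
        mul_inv_cancel₀ hxi.ne', one_smul]
  refine (measure_mono hcov).trans_lt ?_
  refine (measure_iUnion_le _).trans_lt ?_
  rw [tsum_fintype]
  refine ENNReal.sum_lt_top.2 fun i _ => ?_
  refine (measure_iUnion_le _).trans_lt ?_
  rw [tsum_fintype]
  refine ENNReal.sum_lt_top.2 fun b _ => ?_
  obtain ⟨K, hK⟩ := face_lip k i (if b then 1 else -1)
  have hl : LipschitzWith (2 * K) (fun y => (‖faceMap k i (if b then 1 else -1) y‖)⁻¹ • faceMap k i (if b then 1 else -1) y) := by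
    refine LipschitzWith.of_dist_le_mul fun x y => ?_
    have hs : |(if b then 1 else -1 : ℝ)| = 1 := by split_ifs <;> simp
    rw [dist_eq_norm]
    refine (normalize_lip (face_norm k i _ hs x) (face_norm k i _ hs y)).trans ?_
    have := hK.dist_le_mul x y
    rw [dist_eq_norm] at this
    push_cast; linarith
  refine (hl.hausdorffMeasure_image_le (Nat.cast_nonneg k) _).trans_lt ?_
  have hv := hausdorffMeasure_pi_real (ι := Fin k)
  rw [Fintype.card_fin] at hv
  rw [hv]
  exact ENNReal.mul_lt_top (ENNReal.rpow_lt_top_of_nonneg (Nat.cast_nonneg k) ENNReal.coe_ne_top) measure_closedBall_lt_top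

lemma sphere_pos (k : ℕ) : μH[(k:ℝ)] (sphere (0 : EuclideanSpace ℝ (Fin (k + 1))) 1) ≠ 0 := by
  set U : Set (Fin k → ℝ) := {y | ∑ i, y i ^ 2 < 1} with hU
  have hUo : IsOpen U := isOpen_lt (by fun_prop) continuous_const
  have hU0 : volume U ≠ 0 := (hUo.measure_pos volume ⟨0, by simp [hU]⟩).ne'
  set p : EuclideanSpace ℝ (Fin (k + 1)) → (Fin k → ℝ) := fun x l => x l.succ with hp
  have hl : LipschitzWith 1 p := by
    refine LipschitzWith.of_dist_le_mul fun x y => ?_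
    rw [NNReal.coe_one, one_mul, dist_pi_le_iff dist_nonneg]
    intro l
    have := PiLp.norm_apply_le (x - y) l.succ
    rw [dist_eq_norm, dist_eq_norm]
    exact this
  have hsub : U ⊆ p '' sphere 0 1 := by
    intro y hy
    have hy1 : ∑ i, y i ^ 2 < 1 := hy
    refine ⟨WithLp.toLp 2 (Fin.cons (√(1 - ∑ i, y i ^ 2)) y), ?_, ?_⟩
    · rw [mem_sphere_zero_iff_norm, EuclideanSpace.norm_eq, Fin.sum_univ_succ]
      simp [Real.sq_sqrt (by linarith : (0:ℝ) ≤ 1 - ∑ i, y i ^ 2)]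
    · ext l; simp [hp]
  intro h0
  have h1 := hl.hausdorffMeasure_image_le (Nat.cast_nonneg k) (sphere 0 1)
  rw [h0, mul_zero] at h1
  have hv := hausdorffMeasure_pi_real (ι := Fin k)
  rw [Fintype.card_fin] at hv
  rw [hv] at h1
  exact hU0 (le_antisymm ((measure_mono hsub).trans h1) zero_le)

lemma sphere_gauss (hn : 1 ≤ n) : ∃ c : ℝ, 0 < c ∧ ∀ f : EuclideanSpace ℝ (Fin n) → ℝ, Continuous f →
    (∀ r x, 0 ≤ r → f (r • x) = r * f x) →
    ∫ x in sphere (0 : EuclideanSpace ℝ (Fin n)) 1, f x ∂(μH[(n:ℝ) - 1]) = c * ∫ x, f x ∂(gaussianM n) := by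
  obtain ⟨k, rfl⟩ : ∃ k, n = k + 1 := ⟨n - 1, by omega⟩
  have hk : ((k + 1 : ℕ) : ℝ) - 1 = k := by push_cast; ring
  rw [hk]
  set σ := (μH[(k:ℝ)]).restrict (sphere (0 : EuclideanSpace ℝ (Fin (k + 1))) 1) with hσ
  have hσu : σ univ = μH[(k:ℝ)] (sphere (0 : EuclideanSpace ℝ (Fin (k + 1))) 1) := by simp [hσ]
  have hfin : IsFiniteMeasure σ := ⟨by rw [hσu]; exact sphere_fin k⟩
  have hpos : 0 < σ.real univ := by
    rw [Measure.real, ENNReal.toReal_pos_iff]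
    exact ⟨by rw [hσu]; exact pos_iff_ne_zero.2 (sphere_pos k), measure_lt_top _ _⟩
  have hpos2 : 0 < (nuM (k+1)).real univ := by
    rw [Measure.real, ENNReal.toReal_pos_iff]
    exact ⟨pos_iff_ne_zero.2 (nuM_pos hn), measure_lt_top _ _⟩
  have key := inv_prop σ (nuM (k + 1))
    (by rw [hσ, ae_restrict_iff' isClosed_sphere.measurableSet]
        exact Filter.Eventually.of_forall fun x hx => by simpa using hx)
    (nuM_ae hn) (sphere_charFun _) nuM_charFun
  refine ⟨σ.real univ / (nuM (k+1)).real univ, by positivity, fun f hf hh => ?_⟩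
  rw [← nuM_hom hn f hf hh]
  have h2 : ∫ x, f x ∂((nuM (k+1) univ) • σ) = ∫ x, f x ∂(σ univ • nuM (k + 1)) := by rw [key]
  rw [integral_smul_measure, integral_smul_measure, smul_eq_mul, smul_eq_mul] at h2
  rw [Measure.real, Measure.real] at *
  field_simp
  linarith
end

section
variable {n : ℕ}

lemma meanWidth_const (hn : 1 ≤ n) : ∃ C : ℝ, 0 < C ∧ ∀ (K : Set (EuclideanSpace ℝ (Fin n)))
    (f : EuclideanSpace ℝ (Fin n) → ℝ), Continuous f → (∀ r x, 0 ≤ r → f (r • x) = r * f x) →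
    (∀ x, suppFn K x = f x) → Integrable f (gaussianM n) →
    meanWidth n K = C * ∫ x, f x ∂(gaussianM n) := by
  obtain ⟨c, hc, h⟩ := sphere_gauss hn
  have hv : 0 < (volume (closedBall (0 : EuclideanSpace ℝ (Fin n)) 1)).toReal :=
    ENNReal.toReal_pos (measure_closedBall_pos _ _ one_pos).ne' measure_closedBall_lt_top.ne
  refine ⟨(1 / (n * (volume (closedBall (0 : EuclideanSpace ℝ (Fin n)) 1)).toReal)) * (c * 2), by positivity, ?_⟩
  intro K f hf hh hK hi
  unfold meanWidth
  simp only [hK]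
  rw [h (fun x => f x + f (-x)) (by fun_prop) (fun r x hr => by
    rw [hh r x hr, ← smul_neg, hh r (-x) hr]; ring)]
  have hi2 : Integrable (fun x => f (-x)) (gaussianM n) := by
    have := hi
    rw [← gauss_neg n] at this
    exact this.comp_measurable (ContinuousLinearMap.continuous _).measurable
  rw [integral_add hi hi2, gauss_int_neg n f hf]
  ring

lemma hyp_red (hn : 1 ≤ n) {Z D : Set (EuclideanSpace ℝ (Fin n))} (hZ : GoodBody Z) (hD : GoodBody D) (ε : ℝ)
    (hyp : (1 - ε) * ellNorm n D ≤ ellNorm n Z ∨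
      (1 - ε) * meanWidth n (polarSet D) ≤ meanWidth n (polarSet Z) ∨
      ellNorm n (polarSet Z) ≤ (1 + ε) * ellNorm n (polarSet D) ∨
      meanWidth n Z ≤ (1 + ε) * meanWidth n D) :
    (1 - ε) * ∫ x, gauge D x ∂(gaussianM n) ≤ ∫ x, gauge Z x ∂(gaussianM n) ∨
    ∫ x, suppFn Z x ∂(gaussianM n) ≤ (1 + ε) * ∫ x, suppFn D x ∂(gaussianM n) := by
  obtain ⟨C, hC, h⟩ := meanWidth_const hn
  have h1 : ∀ K, GoodBody K → meanWidth n (polarSet K) = C * ∫ x, gauge K x ∂(gaussianM n) := fun K hK =>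
    h _ _ (hK.gauge_cont hn) (fun r x hr => by rw [gauge_smul_of_nonneg hr]; rfl)
      (supp_polar hK.1 (hK.nhds hn)) (hK.gauge_int hn)
  have h2 : ∀ K, GoodBody K → meanWidth n K = C * ∫ x, suppFn K x ∂(gaussianM n) := fun K hK =>
    h _ _ (supp_cont hK.ne hK.2.2) (fun r x hr => supp_smul r hr x) (fun _ => rfl) hK.supp_int
  have h3 : ∀ K, GoodBody K → ellNorm n (polarSet K) = ∫ x, suppFn K x ∂(gaussianM n) := fun K hK => by
    unfold ellNorm
    congr 1; ext x
    exact gauge_polar hK.ne hK.2.2 x (hK.supp_nonneg x)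
  rcases hyp with hy | hy | hy | hy
  · exact Or.inl hy
  · left
    rw [h1 _ hZ, h1 _ hD, mul_left_comm] at hy
    exact le_of_mul_le_mul_left hy hC
  · right
    rwa [h3 _ hZ, h3 _ hD] at hy
  · right
    rw [h2 _ hZ, h2 _ hD, mul_left_comm] at hy
    exact le_of_mul_le_mul_left hy hC

variable {ι : Type} [Fintype ι]

lemma good_supp_int_le (hn : 1 ≤ n) {D : Set (EuclideanSpace ℝ (Fin n))} (hD : GoodBody D) :
    ∫ x, suppFn D x ∂(gaussianM n) ≤ n :=
  (integral_mono hD.supp_int (gauss_int_norm n) (supp_le_norm hD.ne hD.2.2)).trans (gauss_norm_le n hn)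

lemma reg_gauge_int (hn : 1 ≤ n) {w : Fin (n + 1) → EuclideanSpace ℝ (Fin n)} (hw : IsRegVerts w) :
    ∫ x, gauge (convexHull ℝ (range w)) x ∂(gaussianM n) =
      n * ∫ x, suppFn (convexHull ℝ (range w)) x ∂(gaussianM n) := by
  have hg := reg_good hn hw
  simp only [reg_gauge hn hw]
  rw [integral_const_mul, gauss_int_neg n _ (supp_cont hg.ne hg.2.2)]

lemma defI_le (hn : 1 ≤ n) {w : Fin (n + 1) → EuclideanSpace ℝ (Fin n)} (hw : IsRegVerts w) {c : ι → ℝ}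
    {u : ι → EuclideanSpace ℝ (Fin n)} (h : IsFrame c u) {Z : Set (EuclideanSpace ℝ (Fin n))} (hZ : GoodBody Z)
    (hsub : convexHull ℝ (range u) ⊆ Z) {ε : ℝ} (hε : 0 < ε)
    (hyp : (1 - ε) * ∫ x, gauge (convexHull ℝ (range w)) x ∂(gaussianM n) ≤ ∫ x, gauge Z x ∂(gaussianM n) ∨
    ∫ x, suppFn Z x ∂(gaussianM n) ≤ (1 + ε) * ∫ x, suppFn (convexHull ℝ (range w)) x ∂(gaussianM n)) :
    defI w c u ≤ 2 ^ (n + 1) * n * ε := by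
  have hg := reg_good hn hw
  have hK := h.good hn
  have hn0 : (0:ℝ) < n := by positivity
  have hb := good_supp_int_le hn hg
  have hb0 : 0 ≤ ∫ x, suppFn (convexHull ℝ (range w)) x ∂(gaussianM n) := integral_nonneg fun x => hg.supp_nonneg x
  have hs0 := sqn_nonneg n
  have hs1 := sqn_le_one n
  have hd0 := defI_nonneg w h
  have hsb : sqn n * ∫ x, suppFn (convexHull ℝ (range w)) x ∂(gaussianM n) ≤ n := by nlinarith
  have hp : (1:ℝ) ≤ 2 ^ (n + 1) := one_le_pow₀ (by norm_num)
  rcases hyp with hy | hy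
  · have h1 := stage1A hn hw h
    have h2 : ∫ x, gauge Z x ∂(gaussianM n) ≤ ∫ x, gauge (convexHull ℝ (range u)) x ∂(gaussianM n) :=
      integral_mono (hZ.gauge_int hn) (hK.gauge_int hn) fun x =>
        gauge_mono (absorbent_nhds_zero (hK.nhds hn)) hsub x
    have h3 := hy.trans h2
    rw [reg_gauge_int hn hw] at h1 h3
    have h4 := mul_le_mul_of_nonneg_left h3 (by positivity : 0 ≤ sqn n / n)
    have e1 : sqn n / n * ((1 - ε) * (n * ∫ x, suppFn (convexHull ℝ (range w)) x ∂(gaussianM n))) =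
      (1 - ε) * (sqn n * ∫ x, suppFn (convexHull ℝ (range w)) x ∂(gaussianM n)) := by field_simp
    have e2 : sqn n / n * (n * ∫ x, suppFn (convexHull ℝ (range w)) x ∂(gaussianM n)) =
      (sqn n * ∫ x, suppFn (convexHull ℝ (range w)) x ∂(gaussianM n)) := by field_simp
    rw [e1] at h4
    rw [e2] at h1
    have h5 : (1 / 2) ^ (n + 1) * defI w c u ≤ ε * n := by nlinarith
    have h6 : defI w c u = 2 ^ (n + 1) * ((1 / 2) ^ (n + 1) * defI w c u) := by
      rw [← mul_assoc, ← mul_pow]; norm_num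
    rw [h6]
    nlinarith
  · have h1 := stage1C hn hw h
    have h2 : ∫ x, suppFn (convexHull ℝ (range u)) x ∂(gaussianM n) ≤ ∫ x, suppFn Z x ∂(gaussianM n) :=
      integral_mono hK.supp_int hZ.supp_int fun x => hK.supp_mono hZ hsub x
    have h4 := mul_le_mul_of_nonneg_left (h2.trans hy) hs0
    have h5 : defI w c u ≤ ε * n := by nlinarith
    have h6 : 0 ≤ ε * n := by positivity
    nlinarith

lemma reg_int_eq (hn : 1 ≤ n) {w v : Fin (n + 1) → EuclideanSpace ℝ (Fin n)} (hw : IsRegVerts w) (hv : IsRegVerts v) :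
    ∫ x, suppFn (convexHull ℝ (range w)) x ∂(gaussianM n) = ∫ x, suppFn (convexHull ℝ (range v)) x ∂(gaussianM n) := by
  have key : ∀ {w v : Fin (n + 1) → EuclideanSpace ℝ (Fin n)} (hw : IsRegVerts w) (hv : IsRegVerts v),
      ∫ x, suppFn (convexHull ℝ (range w)) x ∂(gaussianM n) ≤ ∫ x, suppFn (convexHull ℝ (range v)) x ∂(gaussianM n) := by
    intro w v hw hv
    have h := stage1C hn hw (reg_isFrame hn hv)
    have h0 := defI_nonneg w (reg_isFrame hn hv)
    exact le_of_mul_le_mul_left (by linarith) (sqn_pos hn)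
  exact le_antisymm (key hw hv) (key hv hw)
end

section
variable {n : ℕ} {ι : Type} [Fintype ι]

lemma gauss_ball_crude (m : ℕ) (hm : 1 ≤ m) (y : EuclideanSpace ℝ (Fin m)) (r : ℝ) (hr : 0 < r) (k : ℕ)
    (hk : (‖y‖ + r) ^ 2 / 2 ≤ k) : (1 / 3) ^ m * (1 / 3) ^ k * (r / m) ^ m ≤ (gaussianM m).real (ball y r) := by
  refine le_trans ?_ (gauss_ball_ge m hm y r hr)
  have hpi : 2 * Real.pi ≤ 9 := by linarith [Real.pi_lt_four]
  have hpi0 : 0 < 2 * Real.pi := by positivity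
  have h1 : ((1:ℝ) / 3) ^ m ≤ (2 * Real.pi) ^ (-(m : ℝ) / 2) := by
    have e : ((1:ℝ) / 3) ^ m = (9:ℝ) ^ (-(m : ℝ) / 2) := by
      have : (9:ℝ) = 3 ^ (2:ℝ) := by norm_num
      rw [this, ← Real.rpow_mul (by norm_num), mul_div_cancel₀ _ (by norm_num : (2:ℝ) ≠ 0), Real.rpow_neg (by norm_num),
        Real.rpow_natCast, one_div, inv_pow]
    rw [e]
    apply Real.rpow_le_rpow_of_nonpos hpi0 hpi
    have : (0:ℝ) ≤ m := by positivity
    linarith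
  have h2 : ((1:ℝ) / 3) ^ k ≤ Real.exp (-(‖y‖ + r) ^ 2 / 2) := by
    have e3 : Real.exp 1 ≤ 3 := by linarith [Real.exp_one_lt_d9]
    calc ((1:ℝ) / 3) ^ k ≤ (Real.exp (-1)) ^ k := by
          apply pow_le_pow_left₀ (by norm_num)
          rw [Real.exp_neg, one_div]
          exact inv_anti₀ (Real.exp_pos 1) e3
      _ = Real.exp (-k) := by rw [← Real.exp_nat_mul]; ring_nf
      _ ≤ _ := by
        apply Real.exp_le_exp.2
        have : -(‖y‖ + r) ^ 2 / 2 = -((‖y‖ + r) ^ 2 / 2) := by ring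
        rw [this]; linarith
  gcongr

lemma half_norm (n : ℕ) : ‖xhalf n‖ = √((n:ℝ) + 1) / 2 := by
  rw [EuclideanSpace.norm_eq]
  simp only [xhalf]
  rw [Finset.sum_const, Finset.card_univ, Fintype.card_fin, nsmul_eq_mul]
  have e : ((n + 1 : ℕ) : ℝ) * ‖(1 / 2 : ℝ)‖ ^ 2 = ((n:ℝ) + 1) / 2 ^ 2 := by
    rw [Real.norm_of_nonneg (by norm_num)]; push_cast; ring
  rw [e]
  rw [Real.sqrt_div (by positivity), Real.sqrt_sq (by norm_num)]

lemma half_ball (n : ℕ) (y : EuclideanSpace ℝ (Fin (n + 1))) (hy : ‖y - xhalf n‖ ≤ 1 / 8) :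
    (1 / (144 * ((n:ℝ) + 1))) ^ (n + 1) ≤ (gaussianM (n + 1)).real (ball y (1 / 16)) := by
  have hs1 : 1 ≤ √((n:ℝ) + 1) := Real.one_le_sqrt.2 (by linarith [(Nat.cast_nonneg n : (0:ℝ) ≤ n)])
  have hss : √((n:ℝ) + 1) ^ 2 = n + 1 := Real.sq_sqrt (by positivity)
  have hyn : ‖y‖ ≤ √((n:ℝ) + 1) / 2 + 1 / 8 := by
    rw [← half_norm]
    have := norm_add_le (y - xhalf n) (xhalf n)
    rw [sub_add_cancel] at this
    linarith
  refine le_trans (le_of_eq ?_) (gauss_ball_crude (n + 1) (by omega) y (1 / 16) (by norm_num) (n + 1) ?_)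
  · rw [← mul_pow, ← mul_pow]; congr 1; push_cast; field_simp; norm_num
  · push_cast
    nlinarith [norm_nonneg y]

lemma kap_ge : (1:ℝ) / 2 ^ 29 ≤ kap := by unfold kap; norm_num

lemma etaF_nonneg {m : ℕ} (c : ι → ℝ) (u : ι → EuclideanSpace ℝ (Fin m)) (hc : ∀ i, 0 ≤ c i) : 0 ≤ etaF c u := by
  unfold etaF
  exact Finset.sum_nonneg fun i _ => Finset.sum_nonneg fun j _ => by
    have := hc i; have := hc j; positivity

lemma stageR (hn2 : 2 ≤ n) {w : Fin (n + 1) → EuclideanSpace ℝ (Fin n)} (hw : IsRegVerts w) {c : ι → ℝ}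
    {u : ι → EuclideanSpace ℝ (Fin n)} (h : IsFrame c u) {e : ℝ} (he : 0 < e)
    (hd : defI w c u ≤ 2 ^ (n + 1) * n * e ^ 4) (hsmall : (n:ℝ) ^ (28 * n) * e < 2) :
    ∃ v, IsRegVerts v ∧ ∀ j, ∃ i, ‖u i - v j‖ ≤ (n:ℝ) ^ (3 * n + 15) * e := by
  have hn : 1 ≤ n := by omega
  have hN : (2:ℝ) ≤ n := by exact_mod_cast hn2
  set N : ℝ := (n : ℝ) with hNdef
  have hN1 : 1 ≤ N := by linarith
  have hN0 : 0 < N := by linarith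
  have hc' : ∀ i, 0 ≤ (N + 1) / N * c i := fun i => mul_nonneg (by positivity) (h.1 i)
  set p : ℝ := (1 / (144 * (N + 1))) ^ (n + 1) with hp
  have hp0 : 0 ≤ p := by positivity
  have hq := qForm_lower (fun i => (N + 1) / N * c i) (fun i => liftV w (u i)) hc' (xhalf n)
    (fun i => lift_half hn hw (u i)) p hp0 (half_ball n)
  set η0 := etaF (fun i => (N + 1) / N * c i) (fun i => liftV w (u i)) with hη0
  have hη00 : 0 ≤ η0 := etaF_nonneg _ _ hc'
  have hq2 : kap * (η0 * (p / 256)) ≤ 2 ^ (n + 1) * N * e ^ 4 :=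
    (mul_le_mul_of_nonneg_left hq kap_pos.le).trans hd
  have hpN : 1 / N ^ (9 * n + 9) ≤ p := by
    rw [hp, show 9 * n + 9 = 9 * (n + 1) by ring, pow_mul, one_div_pow]
    have : 144 * (N + 1) ≤ N ^ 9 := by
      have h8 : (2:ℝ) ^ 8 ≤ N ^ 8 := pow_le_pow_left₀ (by norm_num) hN 8
      have : N ^ 9 = N ^ 8 * N := by ring
      rw [this]; nlinarith
    gcongr
  have hkN : 1 / N ^ 29 ≤ kap := le_trans (by gcongr) kap_ge
  have h256 : 1 / N ^ 8 ≤ (1:ℝ) / 256 := by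
    have : (256:ℝ) = 2 ^ 8 := by norm_num
    rw [this]; gcongr
  have hη : η0 ≤ N ^ (10 * n + 48) * e ^ 4 := by
    have h1 : 1 / N ^ 29 * (η0 * (1 / N ^ (9 * n + 9) * (1 / N ^ 8))) ≤ N ^ (n + 1) * N * e ^ 4 := by
      calc _ ≤ kap * (η0 * (p * (1 / 256))) := by gcongr; exact kap_pos.le
        _ = kap * (η0 * (p / 256)) := by ring
        _ ≤ _ := hq2
        _ ≤ _ := by gcongr
    have h2 : 1 / N ^ 29 * (η0 * (1 / N ^ (9 * n + 9) * (1 / N ^ 8))) = η0 / N ^ (9 * n + 46) := by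
      rw [show 9 * n + 46 = 29 + (9 * n + 9) + 8 by ring, pow_add _ (29 + (9 * n + 9)), pow_add _ 29]; field_simp
    rw [h2, div_le_iff₀ (by positivity)] at h1
    refine h1.trans (le_of_eq ?_)
    rw [show 10 * n + 48 = (n + 1) + 1 + (9 * n + 46) by ring, pow_add, pow_add, pow_one]; ring
  obtain ⟨f, hf⟩ := greedy (fun i => (N + 1) / N * c i) (fun i => liftV w (u i)) hc'
    (fun i => lift_norm hn hw (u i) (h.2.1 i)) (fun x => lift_iso hn hw c u (h.sum) h.2.2.1 h.2.2.2 x)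
    (N ^ (10 * n + 48) * e ^ 4) (by positivity) hη
  set X := N ^ (3 * n + 15) * e with hX
  have hX0 : 0 < X := by positivity
  have hXs : X < 1 / 2 := by
    have : N ^ 2 * X ≤ N ^ (28 * n) * e := by
      rw [hX, ← mul_assoc, ← pow_add]
      exact mul_le_mul_of_nonneg_right (pow_le_pow_right₀ hN1 (by omega)) (by positivity)
    nlinarith
  have hin : ∀ i j, i ≠ j → |⟪u (f i), u (f j)⟫ + 1 / N| ≤ N ^ (5 * n + 28) * e ^ 2 := by
    intro i j hij
    have h1 := hf i j hij
    set L := ⟪liftV w (u (f i)), liftV w (u (f j))⟫ with hL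
    have hLe := lift_inner hn hw (u (f i)) (u (f j))
    have hLa : |L| ≤ N ^ (5 * n + 27) * e ^ 2 := by
      apply abs_le_of_sq_le_sq _ (by positivity)
      refine h1.trans ?_
      have e1 : (N ^ (5 * n + 27) * e ^ 2) ^ 2 = N ^ 6 * (N ^ (10 * n + 48) * e ^ 4) := by ring
      rw [e1]
      have : 16 * ((n + 1 : ℕ) : ℝ) ≤ N ^ 6 := by
        push_cast
        have h5 : (2:ℝ) ^ 5 ≤ N ^ 5 := pow_le_pow_left₀ (by norm_num) hN 5
        have : N ^ 6 = N ^ 5 * N := by ring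
        rw [this]; nlinarith
      gcongr
    have e2 : ⟪u (f i), u (f j)⟫ + 1 / N = (N + 1) / N * L := by
      rw [hL, hLe, ← hNdef]; field_simp
    rw [e2, abs_mul, abs_of_nonneg (by positivity)]
    have : (N + 1) / N ≤ N := by rw [div_le_iff₀ hN0]; nlinarith
    calc (N + 1) / N * |L| ≤ N * (N ^ (5 * n + 27) * e ^ 2) := by gcongr
      _ = _ := by ring
  have hXX : N * (N ^ (5 * n + 28) * e ^ 2) ≤ N ^ (3 * n + 14) * e * X := by
    have e1 : N ^ (3 * n + 14) * e * X = N ^ (6 * n + 29) * e ^ 2 := by rw [hX]; ring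
    rw [e1, ← mul_assoc, ← pow_succ']
    exact mul_le_mul_of_nonneg_right (pow_le_pow_right₀ hN1 (by omega)) (by positivity)
  have hY : N ^ (3 * n + 14) * e * 2 ≤ X := by
    calc N ^ (3 * n + 14) * e * 2 ≤ N ^ (3 * n + 14) * e * N := by gcongr
      _ = X := by rw [hX]; ring
  have hY0 : 0 < N ^ (3 * n + 14) * e := by positivity
  obtain ⟨v, hv, hv2⟩ := near_regular hn hw (fun i => u (f i)) (fun i => h.2.1 _) (N ^ (5 * n + 28) * e ^ 2)
    (by positivity) (by nlinarith) hin
  refine ⟨v, hv, fun j => ⟨f j, (hv2 j).trans ?_⟩⟩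
  have hsq : √(N ^ (5 * n + 28) * e ^ 2) ≤ N ^ (3 * n + 14) * e := by
    rw [Real.sqrt_le_left hY0.le]
    have e1 : (N ^ (3 * n + 14) * e) ^ 2 = N ^ (6 * n + 28) * e ^ 2 := by ring
    rw [e1]
    exact mul_le_mul_of_nonneg_right (pow_le_pow_right₀ hN1 (by omega)) (by positivity)
  nlinarith
end

section
variable {n : ℕ}

lemma gain_int (γ : Measure (EuclideanSpace ℝ (Fin n))) [IsProbabilityMeasure γ] {f h : EuclideanSpace ℝ (Fin n) → ℝ}
    (hf : Integrable f γ) (hh : Integrable h γ) (y : EuclideanSpace ℝ (Fin n)) (r g : ℝ)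
    (h1 : ∀ x, f x ≤ h x) (h2 : ∀ x ∈ ball y r, f x + g ≤ h x) :
    ∫ x, f x ∂γ + g * γ.real (ball y r) ≤ ∫ x, h x ∂γ := by
  have hi : Integrable ((ball y r).indicator fun _ => g) γ := (integrable_const g).indicator measurableSet_ball
  have : ∫ x, (f x + (ball y r).indicator (fun _ => g) x) ∂γ ≤ ∫ x, h x ∂γ := by
    apply integral_mono (hf.add hi) hh
    intro x
    by_cases hx : x ∈ ball y r
    · simp only [Pi.add_apply, indicator_of_mem hx]; exact h2 x hx
    · simp only [Pi.add_apply, indicator_of_notMem hx, add_zero]; exact h1 x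
  rw [integral_add hf hi, integral_indicator measurableSet_ball, setIntegral_const, smul_eq_mul] at this
  linarith

lemma exists_near (v : Fin (n + 1) → EuclideanSpace ℝ (Fin n)) (u0 : EuclideanSpace ℝ (Fin n)) :
    ∃ j, ∀ i, ‖u0 - v j‖ ≤ ‖u0 - v i‖ := Finite.exists_min fun i => ‖u0 - v i‖

lemma unit_inner {V : Type*} [NormedAddCommGroup V] [InnerProductSpace ℝ V] {x y : V} (hx : ‖x‖ = 1) (hy : ‖y‖ = 1) :
    ⟪x, y⟫ = 1 - ‖x - y‖ ^ 2 / 2 := by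
  rw [norm_sub_sq_real, hx, hy]; ring

/-- geometric input for the support function case -/
lemma geomC (hn : 1 ≤ n) {v : Fin (n + 1) → EuclideanSpace ℝ (Fin n)} (hv : IsRegVerts v)
    {u0 : EuclideanSpace ℝ (Fin n)} (hu0 : ‖u0‖ = 1) (k : Fin (n + 1)) (hk : ∀ i, ‖u0 - v k‖ ≤ ‖u0 - v i‖) :
    ∃ y0 : EuclideanSpace ℝ (Fin n), ‖y0‖ ≤ 8 / 5 ∧ ∀ x ∈ ball y0 (1 / 20), ∀ j,
      ⟪v j, x⟫ + ‖u0 - v k‖ / 20 ≤ ⟪u0, x⟫ := by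
  set d := ‖u0 - v k‖ with hd
  have hd0 : 0 ≤ d := norm_nonneg _
  have pert : ∀ (y0 x : EuclideanSpace ℝ (Fin n)), x ∈ ball y0 (1 / 20) → ∀ j,
      ⟪u0 - v j, y0⟫ - ‖u0 - v j‖ / 20 ≤ ⟪u0 - v j, x⟫ := by
    intro y0 x hx j
    have h1 : ‖x - y0‖ ≤ 1 / 20 := by rw [← dist_eq_norm]; exact (mem_ball.1 hx).le
    have h2 : -(‖u0 - v j‖ * ‖x - y0‖) ≤ ⟪u0 - v j, x - y0⟫ := neg_le_of_abs_le (abs_real_inner_le_norm _ _)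
    rw [inner_sub_right] at h2
    nlinarith [norm_nonneg (u0 - v j)]
  have suff : ∀ y0 : EuclideanSpace ℝ (Fin n), (∀ j, ‖u0 - v j‖ / 20 + d / 20 ≤ ⟪u0 - v j, y0⟫) →
      ∀ x ∈ ball y0 (1 / 20), ∀ j, ⟪v j, x⟫ + d / 20 ≤ ⟪u0, x⟫ := by
    intro y0 h x hx j
    have h1 := pert y0 x hx j
    have h2 := h j
    rw [inner_sub_left _ _ x] at h1
    linarith
  rcases eq_or_lt_of_le hd0 with hz | hpos
  · refine ⟨v k, by rw [hv.1]; norm_num, suff _ fun j => ?_⟩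
    have : u0 = v k := by
      rw [eq_comm, hd, norm_eq_zero, sub_eq_zero] at hz; exact hz
    rw [← this, inner_sub_left, real_inner_self_eq_norm_sq, hu0, ← hz, real_inner_comm, unit_inner hu0 (hv.1 j)]
    have h1 : ‖u0 - v j‖ ≤ 2 := (norm_sub_le _ _).trans (by rw [hu0, hv.1]; norm_num)
    by_cases hjk : j = k
    · rw [hjk, this]; simp
    · have := hv.2 k j (Ne.symm hjk)
      rw [← ‹u0 = v k›, unit_inner hu0 (hv.1 j)] at this
      have hn0 : (0:ℝ) < n := by positivity
      have : (-1:ℝ) / n < 0 := by rw [neg_div]; exact neg_neg_of_pos (by positivity)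
      nlinarith
  rcases le_or_gt d 1 with hd1 | hd1
  · set p := d⁻¹ • (u0 - v k) with hp
    have hpn : ‖p‖ = 1 := by rw [hp, norm_smul, norm_inv, Real.norm_of_nonneg hd0, ← hd, inv_mul_cancel₀ hpos.ne']
    have hdp : u0 - v k = d • p := by rw [hp, smul_smul, mul_inv_cancel₀ hpos.ne', one_smul]
    refine ⟨v k + (3 / 5 : ℝ) • p, ?_, suff _ fun j => ?_⟩
    · refine (norm_add_le _ _).trans ?_
      rw [hv.1, norm_smul, hpn]; norm_num
    have hpp : ⟪p, p⟫ = 1 := by rw [real_inner_self_eq_norm_sq, hpn]; norm_num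
    have hkp : ⟪v k, p⟫ = -d / 2 := by
      rw [hp, inner_smul_right, inner_sub_right, real_inner_self_eq_norm_sq, hv.1, unit_inner (hv.1 k) hu0,
        norm_sub_rev, ← hd]
      field_simp; ring
    by_cases hjk : j = k
    · rw [hjk, ← hd, hdp, real_inner_smul_left, inner_add_right, real_inner_smul_right, hpp, real_inner_comm, hkp]
      nlinarith
    · have h1 : ‖u0 - v j‖ ≤ 2 := (norm_sub_le _ _).trans (by rw [hu0, hv.1]; norm_num)
      have h2 : ⟪v j, p⟫ ≤ 1 := (real_inner_le_norm _ _).trans (by rw [hv.1, hpn]; norm_num)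
      have h3 := hv.2 j k hjk
      have h4 : ⟪u0, p⟫ = d + -d / 2 := by
        have : u0 = d • p + v k := by rw [← hdp]; abel
        rw [this, inner_add_left, real_inner_smul_left, hpp, hkp]; ring
      have h5 : ⟪u0, v k⟫ = 1 - d ^ 2 / 2 := unit_inner hu0 (hv.1 k)
      have : (-1:ℝ) / n < 0 := by rw [neg_div]; exact neg_neg_of_pos (by positivity)
      rw [inner_add_right, real_inner_smul_right, inner_sub_left, inner_sub_left, h3, h4, h5]
      nlinarith
  · refine ⟨u0, by rw [hu0]; norm_num, suff _ fun j => ?_⟩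
    rw [inner_sub_left, real_inner_self_eq_norm_sq, hu0, real_inner_comm, unit_inner hu0 (hv.1 j)]
    have := hk j
    nlinarith

lemma stageC (hn2 : 2 ≤ n) {v : Fin (n + 1) → EuclideanSpace ℝ (Fin n)} (hv : IsRegVerts v)
    {Z : Set (EuclideanSpace ℝ (Fin n))} (hZ : GoodBody Z) {ρ ε : ℝ} (hρ : 0 ≤ ρ) (hερ : ε ≤ ρ)
    (ha : ∀ j, ∃ a ∈ Z, ‖a - v j‖ ≤ ρ)
    (hyp : ∫ x, suppFn Z x ∂(gaussianM n) ≤ (1 + ε) * ∫ x, suppFn (convexHull ℝ (range v)) x ∂(gaussianM n))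
    {u0 : EuclideanSpace ℝ (Fin n)} (hu0 : ‖u0‖ = 1) (hu0Z : u0 ∈ Z) :
    ∃ j, ‖u0 - v j‖ ≤ (n:ℝ) ^ (7 * n + 13) * ρ := by
  have hn : 1 ≤ n := by omega
  have hN : (2:ℝ) ≤ n := by exact_mod_cast hn2
  obtain ⟨k, hk⟩ := exists_near v u0
  obtain ⟨y0, hy0, hy⟩ := geomC hn hv hu0 k hk
  refine ⟨k, ?_⟩
  set d := ‖u0 - v k‖ with hd
  set D := convexHull ℝ (range v) with hD
  have hg : GoodBody D := reg_good hn hv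
  have h1 : ∀ x, suppFn D x - ρ * ‖x‖ ≤ suppFn Z x := by
    intro x
    rw [sub_le_iff_le_add]
    refine reg_supp_le x _ fun j => ?_
    obtain ⟨a, haZ, haj⟩ := ha j
    have h2 := le_supp hZ.2.2 x haZ
    have h3 := abs_le.1 (abs_real_inner_le_norm (a - v j) x)
    rw [real_inner_comm] at h2
    rw [inner_sub_left] at h3
    have h4 := mul_le_mul_of_nonneg_right haj (norm_nonneg x)
    linarith [h3.1]
  have h2 : ∀ x ∈ ball y0 (1 / 20), suppFn D x - ρ * ‖x‖ + d / 20 ≤ suppFn Z x := by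
    intro x hx
    have h3 : suppFn D x ≤ ⟪u0, x⟫ - d / 20 := reg_supp_le x _ fun j => by linarith [hy x hx j]
    have h4 := le_supp hZ.2.2 x hu0Z
    rw [real_inner_comm] at h4
    nlinarith [norm_nonneg x]
  have h3 := gain_int (gaussianM n) (hg.supp_int.sub ((gauss_int_norm n).const_mul ρ)) hZ.supp_int y0 (1 / 20) (d / 20) h1 h2
  simp only [Pi.sub_apply] at h3
  rw [integral_sub hg.supp_int ((gauss_int_norm n).const_mul ρ), integral_const_mul] at h3
  have h4 := good_supp_int_le hn hg
  have h5 := gauss_norm_le n hn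
  have h40 : 0 ≤ ∫ x, suppFn D x ∂(gaussianM n) := integral_nonneg fun x => hg.supp_nonneg x
  have h6 : d / 20 * (gaussianM n).real (ball y0 (1 / 20)) ≤ 2 * ρ * n := by
    have e1 := mul_le_mul_of_nonneg_left h5 hρ
    have e2 := mul_le_mul_of_nonneg_left h4 hρ
    have e3 := mul_le_mul_of_nonneg_right hερ h40
    linarith
  have h7 := gauss_ball_crude n hn y0 (1 / 20) (by norm_num) 2 (by
    push_cast; nlinarith [norm_nonneg y0])
  have hN0 : (0:ℝ) < n := by linarith
  have e : (1 / 3 : ℝ) ^ n * (1 / 3) ^ 2 * (1 / 20 / n) ^ n = 1 / (9 * (60 * n) ^ n) := by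
    have e1 : (1 / 3 : ℝ) * (1 / 20 / n) = 1 / (60 * n) := by field_simp; norm_num
    rw [mul_right_comm, ← mul_pow, e1, one_div_pow]
    field_simp; norm_num
  rw [e] at h7
  have hd0 : 0 ≤ d := norm_nonneg _
  have h8 : d / 20 * (1 / (9 * (60 * n) ^ n)) ≤ 2 * ρ * n := le_trans (by gcongr) h6
  have h9 : d ≤ 360 * n * (60 * n) ^ n * ρ := by
    rw [div_mul_div_comm, mul_one, div_le_iff₀ (by positivity)] at h8
    linarith
  refine h9.trans ?_
  have h10 : (60 * (n:ℝ)) ^ n ≤ (n:ℝ) ^ (7 * n) := by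
    rw [pow_mul]
    apply pow_le_pow_left₀ (by positivity)
    have h8 : (2:ℝ) ^ 6 ≤ (n:ℝ) ^ 6 := pow_le_pow_left₀ (by norm_num) hN 6
    have : (n:ℝ) ^ 7 = (n:ℝ) ^ 6 * n := by ring
    rw [this]; nlinarith
  have h11 : 360 * (n:ℝ) ≤ (n:ℝ) ^ 13 := by
    have h8 : (2:ℝ) ^ 12 ≤ (n:ℝ) ^ 12 := pow_le_pow_left₀ (by norm_num) hN 12
    have : (n:ℝ) ^ 13 = (n:ℝ) ^ 12 * n := by ring
    rw [this]; nlinarith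
  calc 360 * n * (60 * n) ^ n * ρ ≤ (n:ℝ) ^ 13 * (n:ℝ) ^ (7 * n) * ρ := by gcongr
    _ = _ := by rw [← pow_add, add_comm]
end

section
variable {n : ℕ}

lemma gauge_scale (hn : 1 ≤ n) {Z D : Set (EuclideanSpace ℝ (Fin n))} (hD : GoodBody D) {c : ℝ}
    (h : ∀ y ∈ D, gauge Z y ≤ c) (x : EuclideanSpace ℝ (Fin n)) : gauge Z x ≤ c * gauge D x := by
  have hc0 : 0 ≤ c := (gauge_nonneg 0).trans (h 0 hD.zero)
  have key : ∀ r, gauge D x < r → gauge Z x ≤ c * r := by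
    intro r hr
    obtain ⟨b, hb0, hbr, y, hy, hxy⟩ := exists_lt_of_gauge_lt (absorbent_nhds_zero (hD.nhds hn)) hr
    have hxy' : b • y = x := hxy
    rw [← hxy', gauge_smul_of_nonneg hb0.le, smul_eq_mul]
    have := h y hy
    nlinarith
  have hcont : Filter.Tendsto (fun r => c * r) (nhdsWithin (gauge D x) (Ioi (gauge D x))) (nhds (c * gauge D x)) :=
    ((continuous_const.mul continuous_id).tendsto _).mono_left nhdsWithin_le_nhds
  refine ge_of_tendsto hcont ?_
  filter_upwards [self_mem_nhdsWithin] with r hr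
  exact key r hr

lemma algA (N g M d s : ℝ) (hN : 2 ≤ N) (hd0 : 0 ≤ d) (hd1 : d ≤ 1) (hMD : M = 1 - d ^ 2 / 2) (hgs : g = N * s)
    (hg0 : 0 ≤ g) (hM : 1 ≤ g * M) (hSc : (N + 1) / N + (N + 1) * s ^ 2 ≤ (M + s) ^ 2 + (N * s - M) ^ 2) :
    1 + d / 4 ≤ g := by
  have hN0 : 0 < N := by linarith
  have h3 : N + 1 - (N - 1) * g ^ 2 ≤ 2 * N * M ^ 2 - 2 * (N - 1) * g * M := by
    have h4 : (N + 1) / N * N = N + 1 := by field_simp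
    have h5 := mul_le_mul_of_nonneg_right hSc hN0.le
    rw [add_mul, h4] at h5
    have e : 2 * N * M ^ 2 - 2 * (N - 1) * g * M - (N + 1 - (N - 1) * g ^ 2) =
      ((M + s) ^ 2 + (N * s - M) ^ 2) * N - (N + 1 + (N + 1) * s ^ 2 * N) := by rw [hgs]; ring
    linarith
  by_contra hcon
  push Not at hcon
  have hM1 : M ≤ 1 := by rw [hMD]; nlinarith
  have hg1 : 1 ≤ g := by nlinarith
  obtain ⟨t, ht⟩ : ∃ t, t = g - 1 := ⟨_, rfl⟩
  have hgt : g = 1 + t := by rw [ht]; ring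
  have ht4 : t < d / 4 := by linarith
  have ht0 : 0 ≤ t := by linarith
  have h7 : t ^ 2 ≤ d ^ 2 / 16 := by nlinarith
  obtain ⟨X, hX⟩ : ∃ X, X = d ^ 2 := ⟨_, rfl⟩
  have hX1 : X ≤ 1 := by rw [hX]; nlinarith
  have hXpos : 0 < X := by
    have : 0 < d := by linarith
    rw [hX]; positivity
  rw [← hX] at hMD h7
  have h8 : X * t ≤ X / 4 := by nlinarith
  have h9 : (N - 1) * (t ^ 2 + X * t) ≤ (N - 1) * (X * 5 / 16) := by
    apply mul_le_mul_of_nonneg_left _ (by linarith); linarith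
  have e2 : 2 * N * M ^ 2 - 2 * (N - 1) * g * M - (N + 1 - (N - 1) * g ^ 2) =
      (N - 1) * (t ^ 2 + X * t) + (N - 1) * X - 2 * N * X + N * X ^ 2 / 2 := by rw [hgt, hMD]; ring
  have h10 : N * X ^ 2 ≤ N * X := by
    apply mul_le_mul_of_nonneg_left _ hN0.le; nlinarith
  have h11 : 0 < N * X := by positivity
  linarith

/-- geometric input for the gauge case -/
lemma geomA (hn2 : 2 ≤ n) {v : Fin (n + 1) → EuclideanSpace ℝ (Fin n)} (hv : IsRegVerts v)
    {u0 : EuclideanSpace ℝ (Fin n)} (hu0 : ‖u0‖ = 1) (k : Fin (n + 1)) (hk : ∀ i, ‖u0 - v k‖ ≤ ‖u0 - v i‖)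
    (g : ℝ) (hg : ∀ j, -n * ⟪v j, u0⟫ ≤ g) : 1 + ‖u0 - v k‖ / 4 ≤ g := by
  have hn : 1 ≤ n := by omega
  have hN : (2:ℝ) ≤ n := by exact_mod_cast hn2
  have hN0 : (0:ℝ) < n := by linarith
  set d := ‖u0 - v k‖ with hd
  have hd0 : 0 ≤ d := norm_nonneg _
  set a : Fin (n + 1) → ℝ := fun j => ⟪v j, u0⟫ with ha
  have ha1 : ∑ j, a j = 0 := by
    rw [ha, ← sum_inner, reg_sum hn hv, inner_zero_left]
  have ha2 : ∑ j, a j * a j = (n + 1) / n := by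
    rw [ha, reg_frame_sq hn hv, real_inner_self_eq_norm_sq, hu0]; ring
  have hak : ∀ j, a j = 1 - ‖u0 - v j‖ ^ 2 / 2 := fun j => by
    rw [ha, norm_sub_rev]; exact unit_inner (hv.1 j) hu0
  have hkk : a k = 1 - d ^ 2 / 2 := hak k
  have hmax : ∀ j, a j ≤ a k := by
    intro j
    rw [hak, hak k]
    have := hk j
    nlinarith [norm_nonneg (u0 - v j)]
  set s := g / n with hs
  have hgs : g = n * s := by rw [hs]; field_simp
  have hpos : ∀ j, 0 ≤ a j + s := by
    intro j
    have := hg j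
    have h2 : 0 ≤ n * (a j + s) := by rw [mul_add, ← hgs]; simp only [ha]; linarith
    exact nonneg_of_mul_nonneg_right h2 hN0
  have hS1 : ∑ j, (a j + s) = (n + 1) * s := by
    rw [Finset.sum_add_distrib, ha1, Finset.sum_const, Finset.card_univ, Fintype.card_fin, nsmul_eq_mul]
    push_cast; ring
  have hS2 : ∑ j, (a j + s) ^ 2 = (n + 1) / n + (n + 1) * s ^ 2 := by
    have : ∀ j, (a j + s) ^ 2 = a j * a j + 2 * s * a j + s ^ 2 := fun j => by ring
    simp only [this]
    rw [Finset.sum_add_distrib, Finset.sum_add_distrib, ha2, ← Finset.mul_sum, ha1, Finset.sum_const, Finset.card_univ,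
      Fintype.card_fin, nsmul_eq_mul]
    push_cast; ring
  have hSb : (n + 1) / n + (n + 1) * s ^ 2 ≤ (a k + s) * ((n + 1) * s) := by
    rw [← hS1, ← hS2, Finset.mul_sum]
    refine Finset.sum_le_sum fun j _ => ?_
    have := hmax j
    nlinarith [hpos j]
  have hM : 1 ≤ g * a k := by
    have h1 : (n + 1) / n ≤ a k * ((n + 1) * s) := by nlinarith
    rw [hgs]
    have h2 : (n + 1) / n * (n / (n + 1)) ≤ a k * ((n + 1) * s) * ((n:ℝ) / (n + 1)) :=
      mul_le_mul_of_nonneg_right h1 (by positivity)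
    have e1 : ((n:ℝ) + 1) / n * (n / (n + 1)) = 1 := by field_simp
    have e2 : a k * ((n + 1) * s) * ((n:ℝ) / (n + 1)) = n * s * a k := by field_simp
    rwa [e1, e2] at h2
  have hg0 : 0 ≤ g := by
    by_contra hcon
    push Not at hcon
    have h3 : (n + 1) * s < 0 := by rw [hs]; exact mul_neg_of_pos_of_neg (by positivity) (div_neg_of_neg_of_pos hcon hN0)
    rw [← hS1] at h3
    exact absurd (Finset.sum_nonneg fun j _ => hpos j) (not_le.2 h3)
  rcases le_or_gt d 1 with hd1 | hd1
  · have hSc : (n + 1) / n + (n + 1) * s ^ 2 ≤ (a k + s) ^ 2 + (n * s - a k) ^ 2 := by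
      rw [← hS2]
      have hsplit : ∑ j, (a j + s) ^ 2 = (a k + s) ^ 2 + ∑ j ∈ Finset.univ.erase k, (a j + s) ^ 2 :=
        (Finset.add_sum_erase _ _ (Finset.mem_univ k)).symm
      have hsplit1 : ∑ j, (a j + s) = (a k + s) + ∑ j ∈ Finset.univ.erase k, (a j + s) :=
        (Finset.add_sum_erase _ _ (Finset.mem_univ k)).symm
      rw [hsplit]
      have h1 : ∑ j ∈ Finset.univ.erase k, (a j + s) ^ 2 ≤ (∑ j ∈ Finset.univ.erase k, (a j + s)) ^ 2 :=
        Finset.sum_sq_le_sq_sum_of_nonneg fun j _ => hpos j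
      have h2 : ∑ j ∈ Finset.univ.erase k, (a j + s) = n * s - a k := by rw [hS1] at hsplit1; linarith
      rw [h2] at h1
      linarith
    exact algA n g (a k) d s hN hd0 hd1 hkk hgs hg0 hM hSc
  · rw [hkk] at hM
    have h1 : 0 < 1 - d ^ 2 / 2 := by
      by_contra hcon
      push Not at hcon
      nlinarith
    by_contra hcon
    push Not at hcon
    have : g * (1 - d ^ 2 / 2) < (1 + d / 4) * (1 - d ^ 2 / 2) := mul_lt_mul_of_pos_right hcon h1
    nlinarith

lemma stageA (hn2 : 2 ≤ n) {v : Fin (n + 1) → EuclideanSpace ℝ (Fin n)} (hv : IsRegVerts v)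
    {Z : Set (EuclideanSpace ℝ (Fin n))} (hZ : GoodBody Z) {ρ ε : ℝ} (hρ : 0 ≤ ρ) (hερ : ε ≤ ρ)
    (ha : ∀ j, ∃ a ∈ Z, ‖a - v j‖ ≤ ρ)
    (hyp : (1 - ε) * ∫ x, gauge (convexHull ℝ (range v)) x ∂(gaussianM n) ≤ ∫ x, gauge Z x ∂(gaussianM n))
    {u0 : EuclideanSpace ℝ (Fin n)} (hu0 : ‖u0‖ = 1) (hu0Z : u0 ∈ Z) :
    ∃ j, ‖u0 - v j‖ ≤ (n:ℝ) ^ (7 * n + 13) * ρ := by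
  have hn : 1 ≤ n := by omega
  have hN : (2:ℝ) ≤ n := by exact_mod_cast hn2
  have hN0 : (0:ℝ) < n := by linarith
  obtain ⟨k, hk⟩ := exists_near v u0
  refine ⟨k, ?_⟩
  set D := convexHull ℝ (range v) with hD
  have hg : GoodBody D := reg_good hn hv
  have hgauge : ∀ x j, -n * ⟪v j, x⟫ ≤ gauge D x := by
    intro x j
    rw [hD, reg_gauge hn hv]
    have := reg_supp_ge hv (-x) j
    rw [inner_neg_right] at this
    nlinarith
  have hgauge2 : ∀ x c, (∀ j, -n * ⟪v j, x⟫ ≤ c) → gauge D x ≤ c := by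
    intro x c h
    rw [hD, reg_gauge hn hv, mul_comm, ← le_div_iff₀ hN0]
    refine reg_supp_le _ _ fun j => ?_
    rw [inner_neg_right, le_div_iff₀ hN0]
    linarith [h j]
  have hgeo := geomA hn2 hv hu0 k hk _ (hgauge u0)
  set d := ‖u0 - v k‖ with hd
  have hd0 : 0 ≤ d := norm_nonneg _
  obtain ⟨l, hl⟩ := Finite.exists_max fun j => -n * ⟪v j, u0⟫
  have hlg : gauge D u0 = -n * ⟪v l, u0⟫ := le_antisymm (hgauge2 _ _ hl) (hgauge _ _)
  have hZadd : ∀ x y, gauge Z (x + y) ≤ gauge Z x + gauge Z y := gauge_add_le hZ.1 (absorbent_nhds_zero (hZ.nhds hn))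
  have hZD : ∀ y ∈ D, gauge Z y ≤ 1 + n * ρ := by
    have hconv : Convex ℝ {y | gauge Z y ≤ 1 + n * ρ} := hZ.1.gauge_le hZ.zero (absorbent_nhds_zero (hZ.nhds hn)) _
    have : D ⊆ {y | gauge Z y ≤ 1 + n * ρ} := convexHull_min (by
      rintro _ ⟨j, rfl⟩
      obtain ⟨a, haZ, haj⟩ := ha j
      have h1 := hZadd a (v j - a)
      rw [add_sub_cancel] at h1
      have h2 := gauge_le_one_of_mem haZ
      have h3 := hZ.gauge_le hn (v j - a)
      rw [norm_sub_rev] at h3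
      have h4 := mul_le_mul_of_nonneg_left haj hN0.le
      simp only [mem_setOf_eq]
      linarith) hconv
    exact fun y hy => this hy
  have hsc := gauge_scale hn hg hZD
  have hnρ : 0 ≤ n * ρ := by positivity
  have h2 : ∀ x ∈ ball (u0 - v l) (1 / 2), gauge Z x + d / 4 ≤ (1 + n * ρ) * gauge D x := by
    intro x hx
    set z := x - (u0 - v l) with hz
    have hzn : ‖z‖ ≤ 1 / 2 := by rw [hz, ← dist_eq_norm]; exact (mem_ball.1 hx).le
    have hxz : x - u0 = z - v l := by rw [hz]; abel
    have h3 : gauge D (x - u0) ≤ -n * ⟪v l, x - u0⟫ := by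
      refine hgauge2 _ _ fun j => ?_
      by_cases hjl : j = l
      · rw [hjl]
      · rw [hxz, inner_sub_right _ z, inner_sub_right _ z, hv.2 j l hjl, real_inner_self_eq_norm_sq, hv.1]
        have h5 := abs_le.1 (abs_real_inner_le_norm (v j) z)
        have h6 := abs_le.1 (abs_real_inner_le_norm (v l) z)
        rw [hv.1, one_mul] at h5 h6
        have h7 : (0:ℝ) < 1 / n := by positivity
        have h8 : (-1:ℝ) / n = - (1 / n) := by ring
        rw [h8]
        nlinarith [h5.1, h6.2]
    have h4 := hgauge x l
    have h5 : ⟪v l, x⟫ = ⟪v l, u0⟫ + ⟪v l, x - u0⟫ := by rw [← inner_add_right]; congr 1; abel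
    rw [h5] at h4
    have h6 : gauge D u0 + gauge D (x - u0) ≤ gauge D x := by rw [hlg]; linarith
    have h7 := hZadd (x - u0) u0
    rw [sub_add_cancel] at h7
    have h8 := gauge_le_one_of_mem hu0Z
    have h9 := hsc (x - u0)
    have h10 : (1 + n * ρ) * (gauge D u0 + gauge D (x - u0)) ≤ (1 + n * ρ) * gauge D x :=
      mul_le_mul_of_nonneg_left h6 (by linarith)
    have h11 : 0 ≤ gauge D u0 := gauge_nonneg _
    nlinarith
  have h3 := gain_int (gaussianM n) (hZ.gauge_int hn) ((hg.gauge_int hn).const_mul (1 + n * ρ)) (u0 - v l) (1 / 2) (d / 4)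
    hsc h2
  rw [integral_const_mul] at h3
  have h4 : ∫ x, gauge D x ∂(gaussianM n) ≤ n * n := by
    rw [hD, reg_gauge_int hn hv]
    exact mul_le_mul_of_nonneg_left (good_supp_int_le hn hg) hN0.le
  have h40 : 0 ≤ ∫ x, gauge D x ∂(gaussianM n) := integral_nonneg fun x => gauge_nonneg _
  have h6 : d / 4 * (gaussianM n).real (ball (u0 - v l) (1 / 2)) ≤ 2 * (n * ρ) * (n * n) := by
    have e1 : ε ≤ n * ρ := by nlinarith
    have e2 := mul_le_mul_of_nonneg_left h4 hnρ
    have e3 := mul_le_mul_of_nonneg_right e1 h40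
    linarith
  have hyn : ‖u0 - v l‖ ≤ 2 := (norm_sub_le _ _).trans (by rw [hu0, hv.1]; norm_num)
  have h7 := gauss_ball_crude n hn (u0 - v l) (1 / 2) (by norm_num) 4 (by
    push_cast; nlinarith [norm_nonneg (u0 - v l)])
  have e : (1 / 3 : ℝ) ^ n * (1 / 3) ^ 4 * (1 / 2 / n) ^ n = 1 / (81 * (6 * n) ^ n) := by
    have e1 : (1 / 3 : ℝ) * (1 / 2 / n) = 1 / (6 * n) := by field_simp; norm_num
    rw [mul_right_comm, ← mul_pow, e1, one_div_pow]
    field_simp; norm_num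
  rw [e] at h7
  have h8 : d / 4 * (1 / (81 * (6 * n) ^ n)) ≤ 2 * (n * ρ) * (n * n) := le_trans (by gcongr) h6
  have h9 : d ≤ 648 * n ^ 3 * (6 * n) ^ n * ρ := by
    rw [div_mul_div_comm, mul_one, div_le_iff₀ (by positivity)] at h8
    linarith
  refine h9.trans ?_
  have h10 : (6 * (n:ℝ)) ^ n ≤ (n:ℝ) ^ (7 * n) := by
    rw [pow_mul]
    apply pow_le_pow_left₀ (by positivity)
    have h8 : (2:ℝ) ^ 6 ≤ (n:ℝ) ^ 6 := pow_le_pow_left₀ (by norm_num) hN 6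
    have : (n:ℝ) ^ 7 = (n:ℝ) ^ 6 * n := by ring
    rw [this]; nlinarith
  have h11 : 648 * (n:ℝ) ^ 3 ≤ (n:ℝ) ^ 13 := by
    have h8 : (2:ℝ) ^ 10 ≤ (n:ℝ) ^ 10 := pow_le_pow_left₀ (by norm_num) hN 10
    have : (n:ℝ) ^ 13 = (n:ℝ) ^ 10 * n ^ 3 := by ring
    rw [this]
    have : (0:ℝ) < n ^ 3 := by positivity
    nlinarith
  calc 648 * (n:ℝ) ^ 3 * (6 * n) ^ n * ρ ≤ (n:ℝ) ^ 13 * (n:ℝ) ^ (7 * n) * ρ := by gcongr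
    _ = _ := by rw [← pow_add, add_comm]
end

section

lemma dim_one_pm {x y : EuclideanSpace ℝ (Fin 1)} (hx : ‖x‖ = 1) (hy : ‖y‖ = 1) : x = y ∨ x = -y := by
  have h1 : x 0 ^ 2 = 1 := by
    have := EuclideanSpace.norm_sq_eq x
    rw [hx] at this; simp at this; linarith
  have h2 : y 0 ^ 2 = 1 := by
    have := EuclideanSpace.norm_sq_eq y
    rw [hy] at this; simp at this; linarith
  have h3 : x 0 ^ 2 = y 0 ^ 2 := by rw [h1, h2]
  rcases sq_eq_sq_iff_eq_or_eq_neg.1 h3 with h | h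
  · left; ext i; rw [Subsingleton.elim i 0]; exact h
  · right; ext i; rw [Subsingleton.elim i 0]; simpa using h

lemma stab_one {μ : Measure (EuclideanSpace ℝ (Fin 1))} (hμ : IsCenteredIsotropic μ)
    {w : Fin (1 + 1) → EuclideanSpace ℝ (Fin 1)} (hw : IsRegVerts w) {r : ℝ} (hr : 0 ≤ r) :
    hausdorffDist (msupp μ) (Set.range w) ≤ r := by
  obtain ⟨ι, hι, c, u, h, hu⟩ := exists_frame le_rfl hμ
  have hA : ∀ a ∈ msupp μ, ‖a‖ = 1 := fun a ha => by simpa using hμ.1 ha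
  refine hausdorffDist_le_of_mem_dist hr ?_ ?_
  · intro a ha
    rcases dim_one_pm (hA a ha) (hw.1 0) with h1 | h1
    · exact ⟨w 0, mem_range_self _, by simp [h1, hr]⟩
    · rcases dim_one_pm (hw.1 1) (hw.1 0) with h2 | h2
      · have h3 := hw.2 1 0 (by decide)
        rw [h2, real_inner_self_eq_norm_sq, hw.1 0] at h3
        norm_num at h3
      · exact ⟨w 1, mem_range_self _, by simp [h1, h2, hr]⟩
  · rintro _ ⟨j, rfl⟩
    by_contra hcon
    push Not at hcon
    have h1 : ∀ i, u i = - w j := fun i => by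
      rcases dim_one_pm (h.2.1 i) (hw.1 j) with h2 | h2
      · have := hcon _ (hu i)
        rw [h2, dist_self] at this
        linarith
      · exact h2
    have h2 := h.2.2.2
    simp only [h1] at h2
    rw [← Finset.sum_smul, h.sum] at h2
    have h3 := hw.1 j
    have h4 : w j = 0 := by simpa using h2
    rw [h4] at h3; simp at h3

lemma stab_two {n : ℕ} (hn2 : 2 ≤ n) {μ : Measure (EuclideanSpace ℝ (Fin n))}
    (hμ : IsCenteredIsotropic μ)
    {w : Fin (n + 1) → EuclideanSpace ℝ (Fin n)} (hw : IsRegVerts w)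
    {e : ℝ} (he0 : 0 < e) (he1 : e ≤ 1)
    (hyp :
      (1 - e ^ 4) * ellNorm n (convexHull ℝ (Set.range w)) ≤ ellNorm n (convexHull ℝ (msupp μ)) ∨
      (1 - e ^ 4) * meanWidth n (polarSet (convexHull ℝ (Set.range w))) ≤
          meanWidth n (polarSet (convexHull ℝ (msupp μ))) ∨
      ellNorm n (polarSet (convexHull ℝ (msupp μ))) ≤
          (1 + e ^ 4) * ellNorm n (polarSet (convexHull ℝ (Set.range w))) ∨
      meanWidth n (convexHull ℝ (msupp μ)) ≤ (1 + e ^ 4) * meanWidth n (convexHull ℝ (Set.range w))) :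
    ∃ v : Fin (n + 1) → EuclideanSpace ℝ (Fin n), IsRegVerts v ∧
      hausdorffDist (msupp μ) (Set.range v) ≤ (n : ℝ) ^ (28 * n) * e := by
  have hn : 1 ≤ n := by omega
  have hN : (1:ℝ) ≤ n := by exact_mod_cast hn
  obtain ⟨ι, hι, c, u, h, hu⟩ := exists_frame hn hμ
  have hA : ∀ a ∈ msupp μ, ‖a‖ = 1 := fun a ha => by simpa using hμ.1 ha
  have hr : 0 ≤ (n:ℝ) ^ (28 * n) * e := by positivity
  rcases le_or_gt 2 ((n:ℝ) ^ (28 * n) * e) with hbig | hsmall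
  · refine ⟨w, hw, hausdorffDist_le_of_mem_dist hr ?_ ?_⟩
    · intro a ha
      refine ⟨w 0, mem_range_self _, ?_⟩
      rw [dist_eq_norm]
      have := norm_sub_le a (w 0)
      rw [hA a ha, hw.1 0] at this
      linarith
    · rintro _ ⟨j, rfl⟩
      obtain ⟨i⟩ := h.nonempty hn
      refine ⟨u i, hu i, ?_⟩
      rw [dist_eq_norm]
      have := norm_sub_le (w j) (u i)
      rw [hw.1 j, h.2.1 i] at this
      linarith
  · have hsub : range u ⊆ msupp μ := by rintro _ ⟨i, rfl⟩; exact hu i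
    have hZ : GoodBody (convexHull ℝ (msupp μ)) :=
      (h.good hn).mono_hull hsub fun y hy => (hA y hy).le
    have hyp2 := hyp_red hn hZ (reg_good hn hw) (e ^ 4) hyp
    have hd := defI_le hn hw h hZ (convexHull_mono hsub) (by positivity) hyp2
    obtain ⟨v, hv, hvu⟩ := stageR hn2 hw h he0 hd hsmall
    set ρ := (n:ℝ) ^ (3 * n + 15) * e with hρdef
    have hρ : 0 ≤ ρ := by positivity
    have hep : e ^ 4 ≤ ρ := by
      have h1 : e ^ 4 ≤ e := by simpa using pow_le_pow_of_le_one he0.le he1 (show 1 ≤ 4 by norm_num)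
      have h2 : e ≤ ρ := le_mul_of_one_le_left he0.le (one_le_pow₀ hN)
      linarith
    have ha : ∀ j, ∃ a ∈ convexHull ℝ (msupp μ), ‖a - v j‖ ≤ ρ := fun j => by
      obtain ⟨i, hi⟩ := hvu j
      exact ⟨u i, subset_convexHull _ _ (hu i), hi⟩
    have hfin : ∀ a ∈ msupp μ, ∃ j, ‖a - v j‖ ≤ (n:ℝ) ^ (7 * n + 13) * ρ := by
      intro a haA
      rcases hyp2 with h1 | h1
      · rw [reg_gauge_int hn hw, reg_int_eq hn hw hv, ← reg_gauge_int hn hv] at h1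
        exact stageA hn2 hv hZ hρ hep ha h1 (hA a haA) (subset_convexHull _ _ haA)
      · rw [reg_int_eq hn hw hv] at h1
        exact stageC hn2 hv hZ hρ hep ha h1 (hA a haA) (subset_convexHull _ _ haA)
    refine ⟨v, hv, hausdorffDist_le_of_mem_dist hr ?_ ?_⟩
    · intro a haA
      obtain ⟨j, hj⟩ := hfin a haA
      refine ⟨v j, mem_range_self _, ?_⟩
      rw [dist_eq_norm]
      refine hj.trans ?_
      rw [hρdef, ← mul_assoc, ← pow_add]
      exact mul_le_mul_of_nonneg_right (pow_le_pow_right₀ hN (by omega)) he0.le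
    · rintro _ ⟨j, rfl⟩
      obtain ⟨i, hi⟩ := hvu j
      refine ⟨u i, hu i, ?_⟩
      rw [dist_comm, dist_eq_norm]
      exact hi.trans (mul_le_mul_of_nonneg_right (pow_le_pow_right₀ hN (by omega)) he0.le)
end

theorem isotropic_stability
    (n : ℕ) (hn : 1 ≤ n) (μ : Measure (EuclideanSpace ℝ (Fin n)))
    (hμ : IsCenteredIsotropic μ)
    (w : Fin (n + 1) → EuclideanSpace ℝ (Fin n)) (hw : IsRegVerts w)
    (ε : ℝ) (hε0 : 0 < ε) (hε1 : ε < 1)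
    (hyp :
      (1 - ε) * ellNorm n (convexHull ℝ (Set.range w)) ≤ ellNorm n (convexHull ℝ (msupp μ)) ∨
      (1 - ε) * meanWidth n (polarSet (convexHull ℝ (Set.range w))) ≤
          meanWidth n (polarSet (convexHull ℝ (msupp μ))) ∨
      ellNorm n (polarSet (convexHull ℝ (msupp μ))) ≤
          (1 + ε) * ellNorm n (polarSet (convexHull ℝ (Set.range w))) ∨
      meanWidth n (convexHull ℝ (msupp μ)) ≤ (1 + ε) * meanWidth n (convexHull ℝ (Set.range w))) :
    ∃ v : Fin (n + 1) → EuclideanSpace ℝ (Fin n), IsRegVerts v ∧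
      hausdorffDist (msupp μ) (Set.range v) ≤ (n : ℝ) ^ (28 * n) * ε ^ ((1 : ℝ) / 4) := by
  have he0 : 0 < ε ^ ((1 : ℝ) / 4) := Real.rpow_pos_of_pos hε0 _
  have he4 : (ε ^ ((1 : ℝ) / 4)) ^ 4 = ε := by
    rw [← Real.rpow_natCast, ← Real.rpow_mul hε0.le]; norm_num
  rcases Nat.lt_or_ge 1 n with h2 | h1
  · refine stab_two h2 hμ hw he0 (Real.rpow_le_one hε0.le hε1.le (by norm_num)) ?_
    rw [he4]
    exact hyp
  · obtain rfl : n = 1 := le_antisymm h1 hn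
    exact ⟨w, hw, stab_one hμ hw (by positivity)⟩

end
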